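/- arXiv:1812.04896 — 8 statements merged into one kernel-verified Lean document; each statement's English description precedes it below -/
import Mathlib

section
/- There exists a family of elements μₙ ∈ FreeLieAlgebra ℚ (Fin n), one for each n ≥ 1, with the following three properties. (μ1) μ₁ equals the unique generator X₁. (μ2) Each μₙ lies in the ℚ-span of the multilinear Lie monomials B(Fin n). (μ3) For every n ≥ 2 and every k with 2 ≤ k ≤ n one has μₙ − σₖ(μₙ) = ρₖ(μ_{n−1}), where σₖ is the Lie algebra automorphism of FreeLieAlgebra ℚ (Fin n) interchanging the generators X_{k−1} and X_k and fixing all other generators, and ρₖ : FreeLieAlgebra ℚ (Fin (n−1)) → FreeLieAlgebra ℚ (Fin n) is the Lie algebra morphism sending X_j ↦ X_j for j < k−1, X_{k−1} ↦ ⁅X_{k−1}, X_k⁆, and X_j ↦ X_{j+1} for j ≥ k. -/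
/-- The multilinear Lie monomials of `FreeLieAlgebra K (Fin n)`: `IsLieMonomialOn K n S u`
says that `u` is a Lie monomial in which each generator `X_i` with `i ∈ S` occurs exactly
once (and no other generator occurs). -/
inductive IsLieMonomialOn (K : Type*) [CommRing K] (n : ℕ) :
    Finset (Fin n) → FreeLieAlgebra K (Fin n) → Prop
  | of (i : Fin n) : IsLieMonomialOn K n {i} (FreeLieAlgebra.of K i)
  | bracket {S T : Finset (Fin n)} {u v : FreeLieAlgebra K (Fin n)} :
      S.Nonempty → T.Nonempty → Disjoint S T →
      IsLieMonomialOn K n S u → IsLieMonomialOn K n T v →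
      IsLieMonomialOn K n (S ∪ T) ⁅u, v⁆

namespace MagnusCommutators

section FixedPoint

variable {M : Type*}

/-- Downward recursion `w l = T l (w (l + 1))` for `l ≤ j`, started at `w (j + 1) = m`. -/
theorem exists_descending_orbit (T : ℕ → M → M) (j : ℕ) (m : M) :
    ∃ w : ℕ → M, w (j + 1) = m ∧ ∀ l ≤ j, w l = T l (w (l + 1)) := by
  let v : ℕ → M := fun d => Nat.rec m (fun d x => T (j - d) x) d
  refine ⟨fun l => v (j + 1 - l), by simp [v], fun l hl => ?_⟩
  have h1 : j + 1 - l = (j - l) + 1 := by omega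
  have h2 : j + 1 - (l + 1) = j - l := by omega
  have h3 : T (j - (j - l)) (v (j - l)) = T l (v (j - l)) := by
    rw [show j - (j - l) = l by omega]
  simp only [h1, h2]
  exact h3

/-- Operators satisfying the Coxeter relations of type `A` permute the orbit of a point fixed by
all but the last of them through adjacent transpositions. -/
theorem apply_orbit_eq_swap {T : ℕ → M → M} {j : ℕ} {m : M} {w : ℕ → M}
    (hinv : ∀ k ≤ j, ∀ x, T k (T k x) = x)
    (hcomm : ∀ k l, k + 1 < l → l ≤ j → ∀ x, T k (T l x) = T l (T k x))
    (hbraid : ∀ k, k + 1 ≤ j → ∀ x, T k (T (k + 1) (T k x)) = T (k + 1) (T k (T (k + 1) x)))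
    (hfix : ∀ k < j, T k m = m) (hm : w (j + 1) = m) (hw : ∀ l ≤ j, w l = T l (w (l + 1)))
    {i l : ℕ} (hi : i ≤ j) (hl : l ≤ j + 1) :
    T i (w l) = w (Equiv.swap i (i + 1) l) := by
  have above : ∀ d i l : ℕ, j + 1 - l = d → i + 1 < l → l ≤ j + 1 → T i (w l) = w l := by
    intro d
    induction d with
    | zero =>
      intro i l hd hil hl
      obtain rfl : l = j + 1 := by omega
      rw [hm]
      exact hfix i (by omega)
    | succ d ih =>
      intro i l hd hil hl
      rw [hw l (by omega), hcomm i l hil (by omega), ih i (l + 1) (by omega) (by omega) (by omega)]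
  have below : ∀ d l : ℕ, i = l + 1 + d → T i (w l) = w l := by
    intro d
    induction d with
    | zero =>
      rintro l rfl
      rw [hw l (by omega), hw (l + 1) (by omega)]
      simp only [add_zero] at hi ⊢
      rw [← hbraid l hi, above _ l (l + 1 + 1) rfl (by omega) (by omega)]
    | succ d ih =>
      intro l hd
      rw [hw l (by omega), ← hcomm l i (by omega) hi, ih (l + 1) (by omega)]
  rcases lt_trichotomy l i with h | rfl | h
  · rw [Equiv.swap_apply_of_ne_of_ne (by omega) (by omega)]
    exact below (i - l - 1) l (by omega)
  · rw [Equiv.swap_apply_left, hw l hi, hinv l hi]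
  · rcases (show i + 1 ≤ l from h).eq_or_lt with rfl | h'
    · rw [Equiv.swap_apply_right, hw i hi]
    · rw [Equiv.swap_apply_of_ne_of_ne (by omega) (by omega)]
      exact above _ i l rfl h' hl

/-- Affine operators over `ℚ` satisfying the Coxeter relations of type `A` have a common fixed
point in any submodule they preserve. -/
theorem exists_common_fixed_point [AddCommGroup M] [Module ℚ M] (N : Submodule ℚ M)
    (S : ℕ → M →ₗ[ℚ] M) (c : ℕ → M) (T : ℕ → M → M) (hT : ∀ k x, T k x = S k x + c k) (n : ℕ)
    (hN : ∀ k < n, ∀ x ∈ N, T k x ∈ N)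
    (hinv : ∀ k < n, ∀ x, T k (T k x) = x)
    (hcomm : ∀ k l, k + 1 < l → l < n → ∀ x, T k (T l x) = T l (T k x))
    (hbraid : ∀ k, k + 1 < n → ∀ x, T k (T (k + 1) (T k x)) = T (k + 1) (T k (T (k + 1) x))) :
    ∃ m ∈ N, ∀ k < n, T k m = m := by
  suffices h : ∀ j ≤ n, ∃ m ∈ N, ∀ k < j, T k m = m from h n le_rfl
  intro j
  induction j with
  | zero => exact fun _ => ⟨0, N.zero_mem, by simp⟩
  | succ j ih =>
    intro hj
    obtain ⟨m, hmN, hfix⟩ := ih (by omega)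
    obtain ⟨w, hm, hw⟩ := exists_descending_orbit T j m
    have hwN : ∀ d l, j + 1 - l = d → l ≤ j + 1 → w l ∈ N := by
      intro d
      induction d with
      | zero =>
        intro l hd hl
        obtain rfl : l = j + 1 := by omega
        rwa [hm]
      | succ d ihd =>
        intro l hd hl
        rw [hw l (by omega)]
        exact hN l (by omega) _ (ihd (l + 1) (by omega) (by omega))
    have hne : ((j + 2 : ℕ) : ℚ) ≠ 0 := by positivity
    refine ⟨((j + 2 : ℕ) : ℚ)⁻¹ • ∑ l ∈ Finset.range (j + 2), w l,
      N.smul_mem _ (N.sum_mem fun l hl => hwN _ l rfl (by simp at hl; omega)), fun k hk => ?_⟩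
    have key : ∑ l ∈ Finset.range (j + 2), T k (w l) = ∑ l ∈ Finset.range (j + 2), w l := by
      refine Finset.sum_equiv (Equiv.swap k (k + 1)) (fun l => ?_) (fun l hl => ?_)
      · simp only [Finset.mem_range, Equiv.swap_apply_def]
        split_ifs <;> omega
      · exact apply_orbit_eq_swap (fun k hk => hinv k (by omega))
          (fun k l h h' => hcomm k l h (by omega)) (fun k h => hbraid k (by omega)) hfix hm hw
          (by omega) (by simp at hl; omega)
    simp only [hT, Finset.sum_add_distrib, Finset.sum_const, Finset.card_range] at key
    rw [hT, map_smul, map_sum]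
    conv_rhs => rw [← key]
    rw [smul_add, ← Nat.cast_smul_eq_nsmul ℚ, inv_smul_smul₀ hne]

end FixedPoint

section Sequences

variable {L : Type*}

/-- The sequence `f` with its entries at `k` and `k + 1` interchanged. -/
def swapAt (k : ℕ) (f : ℕ → L) : ℕ → L := fun i => f (Equiv.swap k (k + 1) i)

theorem swapAt_swapAt (k : ℕ) (f : ℕ → L) : swapAt k (swapAt k f) = f := by
  funext i
  simp [swapAt]

theorem swapAt_comm {k l : ℕ} (h : k + 1 < l) (f : ℕ → L) :
    swapAt k (swapAt l f) = swapAt l (swapAt k f) := by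
  funext i
  simp only [swapAt, Equiv.swap_apply_def]
  congr 1
  grind

theorem swapAt_braid (k : ℕ) (f : ℕ → L) :
    swapAt k (swapAt (k + 1) (swapAt k f)) = swapAt (k + 1) (swapAt k (swapAt (k + 1) f)) := by
  funext i
  simp only [swapAt, Equiv.swap_apply_def]
  congr 1
  grind

variable [LieRing L]

/-- The sequence `f` with its entries at `k` and `k + 1` replaced by their bracket. -/
def mergeAt (k : ℕ) (f : ℕ → L) : ℕ → L := fun j =>
  if j < k then f j else if j = k then ⁅f k, f (k + 1)⁆ else f (j + 1)

theorem mergeAt_congr {n k : ℕ} {f g : ℕ → L} (hk : k < n) (h : ∀ i < n + 1, f i = g i) :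
    ∀ i < n, mergeAt k f i = mergeAt k g i := by
  intro i hi
  simp only [mergeAt, h k (by omega), h (k + 1) (by omega), h i (by omega), h (i + 1) (by omega)]

theorem mergeAt_swapAt_of_lt {k l : ℕ} (h : k + 1 < l) (f : ℕ → L) :
    mergeAt l (swapAt k f) = swapAt k (mergeAt l f) := by
  funext i
  simp only [mergeAt, swapAt, Equiv.swap_apply_def]
  grind

theorem mergeAt_swapAt_of_gt {k l : ℕ} (h : k < l) (f : ℕ → L) :
    mergeAt k (swapAt (l + 1) f) = swapAt l (mergeAt k f) := by
  funext i
  simp only [mergeAt, swapAt, Equiv.swap_apply_def]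
  grind

theorem mergeAt_mergeAt_of_lt {k l : ℕ} (h : k < l) (f : ℕ → L) :
    mergeAt k (mergeAt (l + 1) f) = mergeAt l (mergeAt k f) := by
  funext i
  simp only [mergeAt]
  grind

end Sequences

section Evaluation

variable {L L' : Type*} [LieRing L] [LieAlgebra ℚ L] [LieRing L'] [LieAlgebra ℚ L']

/-- Substitution of `f 0, …, f (n - 1)` for the generators. -/
noncomputable def ev (n : ℕ) (f : ℕ → L) : FreeLieAlgebra ℚ (Fin n) →ₗ⁅ℚ⁆ L :=
  FreeLieAlgebra.lift ℚ fun i : Fin n => f i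

/-- The generators of the free Lie algebra, extended by zero to a sequence. -/
noncomputable def gen (n : ℕ) : ℕ → FreeLieAlgebra ℚ (Fin n) := fun i =>
  if h : i < n then FreeLieAlgebra.of ℚ ⟨i, h⟩ else 0

theorem ev_of {n : ℕ} (f : ℕ → L) (i : Fin n) : ev n f (FreeLieAlgebra.of ℚ i) = f i :=
  FreeLieAlgebra.lift_of_apply _ _

theorem ev_congr {n : ℕ} {f g : ℕ → L} (h : ∀ i < n, f i = g i) : ev n f = ev n g := by
  ext i
  simp [ev_of, h i i.isLt]

theorem map_ev {n : ℕ} (φ : L →ₗ⁅ℚ⁆ L') (f : ℕ → L) (u : FreeLieAlgebra ℚ (Fin n)) :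
    φ (ev n f u) = ev n (fun i => φ (f i)) u := by
  have : φ.comp (ev n f) = ev n (fun i => φ (f i)) := by
    ext i
    simp [ev_of]
  exact LieHom.congr_fun this u

theorem ev_gen_apply {n : ℕ} (f : ℕ → L) {i : ℕ} (h : i < n) : ev n f (gen n i) = f i := by
  simp [gen, h, ev_of]

theorem ev_gen {n : ℕ} (u : FreeLieAlgebra ℚ (Fin n)) : ev n (gen n) u = u := by
  have : ev n (gen n) = LieHom.id := by
    ext i
    simp [ev_of, gen]
  simp [this]

theorem map_mergeAt (φ : L →ₗ⁅ℚ⁆ L') (k : ℕ) (f : ℕ → L) :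
    (fun i => φ (mergeAt k f i)) = mergeAt k fun i => φ (f i) := by
  funext i
  simp only [mergeAt]
  split_ifs <;> simp

theorem ev_swapAt_gen {n k : ℕ} (hk : k + 1 < n) (f : ℕ → L) (u : FreeLieAlgebra ℚ (Fin n)) :
    ev n f (ev n (swapAt k (gen n)) u) = ev n (swapAt k f) u := by
  rw [map_ev]
  refine LieHom.congr_fun (ev_congr fun i hi => ?_) u
  refine ev_gen_apply f ?_
  rw [Equiv.swap_apply_def]
  split_ifs <;> omega

theorem ev_mergeAt_gen {n k : ℕ} (hk : k < n) (f : ℕ → L) (u : FreeLieAlgebra ℚ (Fin n)) :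
    ev (n + 1) f (ev n (mergeAt k (gen (n + 1))) u) = ev n (mergeAt k f) u := by
  rw [map_ev, map_mergeAt]
  exact LieHom.congr_fun (ev_congr (mergeAt_congr hk fun i hi => ev_gen_apply f hi)) u

end Evaluation

section Multilinear

/-- The span of the multilinear Lie monomials. -/
noncomputable abbrev multilinear (n : ℕ) : Submodule ℚ (FreeLieAlgebra ℚ (Fin n)) :=
  Submodule.span ℚ {u | IsLieMonomialOn ℚ n Finset.univ u}

variable {L : Type*} [LieRing L] [LieAlgebra ℚ L]

theorem ev_update_of_notMem {n : ℕ} {S : Finset (Fin n)} {u : FreeLieAlgebra ℚ (Fin n)}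
    (hu : IsLieMonomialOn ℚ n S u) (f : ℕ → L) {k : Fin n} (hk : k ∉ S) (a : L) :
    ev n (Function.update f k a) u = ev n f u := by
  induction hu with
  | of i =>
    have : (i : ℕ) ≠ k := fun h => hk (by simp [Fin.ext h])
    simp [ev_of, this]
  | bracket _ _ _ _ _ ih₁ ih₂ =>
    simp only [Finset.mem_union, not_or] at hk
    rw [LieHom.map_lie, LieHom.map_lie, ih₁ hk.1, ih₂ hk.2]

theorem ev_update_add_of_mem {n : ℕ} {S : Finset (Fin n)} {u : FreeLieAlgebra ℚ (Fin n)}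
    (hu : IsLieMonomialOn ℚ n S u) (f : ℕ → L) {k : Fin n} (hk : k ∈ S) (a b : L) :
    ev n (Function.update f k (a + b)) u =
      ev n (Function.update f k a) u + ev n (Function.update f k b) u := by
  induction hu with
  | of i =>
    obtain rfl := Finset.mem_singleton.mp hk
    simp [ev_of]
  | bracket _ _ hd hu hv ih₁ ih₂ =>
    simp only [LieHom.map_lie]
    rcases Finset.mem_union.mp hk with h | h
    · have h' := Finset.disjoint_left.mp hd h
      simp only [ev_update_of_notMem hv f h', ih₁ h, add_lie]
    · have h' := Finset.disjoint_right.mp hd h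
      simp only [ev_update_of_notMem hu f h', ih₂ h, lie_add]

theorem ev_update_add {n k : ℕ} (hk : k < n) {u : FreeLieAlgebra ℚ (Fin n)}
    (hu : u ∈ multilinear n) (f : ℕ → L) (a b : L) :
    ev n (Function.update f k (a + b)) u =
      ev n (Function.update f k a) u + ev n (Function.update f k b) u := by
  induction hu using Submodule.span_induction with
  | mem u hu => exact ev_update_add_of_mem hu f (k := ⟨k, hk⟩) (Finset.mem_univ _) a b
  | zero => simp
  | add x y _ _ hx hy =>
    simp only [map_add, hx, hy]
    abel
  | smul c x _ hx => simp only [map_smul, hx, smul_add]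

/-- Evaluation of a multilinear element, as an additive function of the entry at `k`. -/
noncomputable def evEntry {n k : ℕ} (hk : k < n) {u : FreeLieAlgebra ℚ (Fin n)}
    (hu : u ∈ multilinear n) (f : ℕ → L) : L →+ L :=
  AddMonoidHom.mk' (fun a => ev n (Function.update f k a) u) (ev_update_add hk hu f)

theorem isLieMonomialOn_ev {n m : ℕ} {f : ℕ → FreeLieAlgebra ℚ (Fin m)}
    {g : Fin n → Finset (Fin m)} (hf : ∀ i : Fin n, IsLieMonomialOn ℚ m (g i) (f i))
    (hg : ∀ i, (g i).Nonempty) (hd : Pairwise fun i j => Disjoint (g i) (g j))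
    {S : Finset (Fin n)} {u : FreeLieAlgebra ℚ (Fin n)} (hu : IsLieMonomialOn ℚ n S u) :
    IsLieMonomialOn ℚ m (S.biUnion g) (ev n f u) := by
  induction hu with
  | of i =>
    rw [ev_of, Finset.singleton_biUnion]
    exact hf i
  | bracket hS hT hST _ _ ih₁ ih₂ =>
    rw [LieHom.map_lie, Finset.union_biUnion]
    refine .bracket (hS.biUnion fun i _ => hg i) (hT.biUnion fun i _ => hg i) ?_ ih₁ ih₂
    simp only [Finset.disjoint_biUnion_left, Finset.disjoint_biUnion_right]
    exact fun i hi j hj => hd (Finset.disjoint_iff_ne.mp hST _ ‹_› _ ‹_›)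

theorem ev_mem_multilinear {n m : ℕ} {f : ℕ → FreeLieAlgebra ℚ (Fin m)}
    {g : Fin n → Finset (Fin m)} (hf : ∀ i : Fin n, IsLieMonomialOn ℚ m (g i) (f i))
    (hg : ∀ i, (g i).Nonempty) (hd : Pairwise fun i j => Disjoint (g i) (g j))
    (hcover : Finset.univ.biUnion g = Finset.univ)
    {u : FreeLieAlgebra ℚ (Fin n)} (hu : u ∈ multilinear n) : ev n f u ∈ multilinear m := by
  induction hu using Submodule.span_induction with
  | mem u hu => exact Submodule.subset_span (hcover ▸ isLieMonomialOn_ev hf hg hd hu)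
  | zero => simp
  | add x y _ _ hx hy => simpa only [map_add] using add_mem hx hy
  | smul c x _ hx => simpa only [map_smul] using Submodule.smul_mem _ c hx

theorem isLieMonomialOn_gen {n i : ℕ} (h : i < n) :
    IsLieMonomialOn ℚ n {⟨i, h⟩} (gen n i) := by
  rw [gen, dif_pos h]
  exact .of _

theorem ev_swapAt_mem_multilinear {n k : ℕ} (hk : k + 1 < n) {u : FreeLieAlgebra ℚ (Fin n)}
    (hu : u ∈ multilinear n) : ev n (swapAt k (gen n)) u ∈ multilinear n := by
  have hlt : ∀ i : Fin n, Equiv.swap k (k + 1) (i : ℕ) < n := by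
    intro i
    rw [Equiv.swap_apply_def]
    split_ifs <;> omega
  refine ev_mem_multilinear (g := fun i => {⟨Equiv.swap k (k + 1) (i : ℕ), hlt i⟩})
    (fun i => isLieMonomialOn_gen (hlt i)) (by simp) (fun i j hij => ?_) ?_ hu
  · simpa [Fin.ext_iff] using hij
  · ext i
    simp only [Finset.mem_biUnion, Finset.mem_univ, true_and, Finset.mem_singleton, iff_true]
    exact ⟨⟨_, hlt i⟩, by simp⟩

theorem ev_mergeAt_mem_multilinear {n k : ℕ} (hk : k < n) {u : FreeLieAlgebra ℚ (Fin n)}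
    (hu : u ∈ multilinear n) : ev n (mergeAt k (gen (n + 1))) u ∈ multilinear (n + 1) := by
  let p : Fin (n + 1) → ℕ := fun i => if (i : ℕ) ≤ k then i else i - 1
  refine ev_mem_multilinear (g := fun j => Finset.univ.filter fun i => p i = j)
    (fun j => ?_) (fun j => ?_) (fun i j hij => ?_) ?_ hu
  · rcases lt_trichotomy (j : ℕ) k with h | h | h
    · simp only [mergeAt, if_pos h]
      convert isLieMonomialOn_gen (n := n + 1) (i := j) (by omega) using 1
      ext i
      simp [p, Fin.ext_iff]
      grind
    · simp only [mergeAt, if_neg (show ¬ (j : ℕ) < k by omega), if_pos h]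
      convert IsLieMonomialOn.bracket (Finset.singleton_nonempty _) (Finset.singleton_nonempty _) ?_
        (isLieMonomialOn_gen (n := n + 1) (i := k) (by omega))
        (isLieMonomialOn_gen (n := n + 1) (i := k + 1) (by omega)) using 1
      · ext i
        simp [p, Fin.ext_iff]
        grind
      · simp
    · simp only [mergeAt, if_neg (show ¬ (j : ℕ) < k by omega),
        if_neg (show ¬ (j : ℕ) = k by omega)]
      convert isLieMonomialOn_gen (n := n + 1) (i := j + 1) (by omega) using 1
      ext i
      simp [p, Fin.ext_iff]
      grind
  · by_cases h : (j : ℕ) ≤ k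
    · exact ⟨⟨j, by omega⟩, by simp [p, h]⟩
    · exact ⟨⟨j + 1, by omega⟩, by simp [p]; omega⟩
  · exact Finset.disjoint_filter.mpr fun x _ h h' => hij (Fin.ext (h.symm.trans h'))
  · ext i
    simp only [Finset.mem_biUnion, Finset.mem_univ, true_and, Finset.mem_filter, iff_true]
    exact ⟨⟨p i, by grind⟩, rfl⟩

end Multilinear

section Recursion

/-- The exchange relation `v(f) - v(σₖ f) = u(ρₖ f)`, for all substitutions `f`. -/
def Exchange (n : ℕ) (u : FreeLieAlgebra ℚ (Fin n)) (v : FreeLieAlgebra ℚ (Fin (n + 1))) : Prop :=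
  ∀ (L : Type) [LieRing L] [LieAlgebra ℚ L] (f : ℕ → L) (k : ℕ), k < n →
    ev (n + 1) f v = ev (n + 1) (swapAt k f) v + ev n (mergeAt k f) u

variable {L : Type} [LieRing L] [LieAlgebra ℚ L]

theorem ev_mergeAt_swapAt_self {n k : ℕ} (hk : k < n) {u : FreeLieAlgebra ℚ (Fin n)}
    (hu : u ∈ multilinear n) (f : ℕ → L) :
    ev n (mergeAt k (swapAt k f)) u + ev n (mergeAt k f) u = 0 := by
  have h1 : mergeAt k f = Function.update (mergeAt k f) k ⁅f k, f (k + 1)⁆ := by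
    funext i
    simp only [mergeAt, Function.update_apply]
    grind
  have h2 : mergeAt k (swapAt k f) = Function.update (mergeAt k f) k ⁅f (k + 1), f k⁆ := by
    funext i
    simp only [mergeAt, swapAt, Function.update_apply, Equiv.swap_apply_def]
    grind
  rw [h2]
  nth_rewrite 2 [h1]
  rw [← ev_update_add hk hu, ← lie_skew, neg_add_cancel]
  exact map_zero (evEntry hk hu (mergeAt k f))

theorem Exchange.comm {n : ℕ} {u : FreeLieAlgebra ℚ (Fin n)} {v : FreeLieAlgebra ℚ (Fin (n + 1))}
    (h : Exchange n u v) {k l : ℕ} (hkl : k + 1 < l) (hl : l < n + 1) (f : ℕ → L) :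
    ev (n + 1) (mergeAt l (swapAt k f)) v + ev (n + 1) (mergeAt k f) v =
      ev (n + 1) (mergeAt k (swapAt l f)) v + ev (n + 1) (mergeAt l f) v := by
  obtain ⟨l, rfl⟩ : ∃ l', l = l' + 1 := ⟨l - 1, by omega⟩
  rw [mergeAt_swapAt_of_lt hkl, mergeAt_swapAt_of_gt (by omega),
    h L (mergeAt k f) l (by omega), h L (mergeAt (l + 1) f) k (by omega),
    mergeAt_mergeAt_of_lt (by omega)]
  abel

theorem Exchange.braid {n : ℕ} {u : FreeLieAlgebra ℚ (Fin n)} {v : FreeLieAlgebra ℚ (Fin (n + 1))}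
    (h : Exchange n u v) (hu : u ∈ multilinear n) {k : ℕ} (hk : k < n) (f : ℕ → L) :
    ev (n + 1) (mergeAt k (swapAt (k + 1) (swapAt k f))) v +
        ev (n + 1) (mergeAt (k + 1) (swapAt k f)) v + ev (n + 1) (mergeAt k f) v =
      ev (n + 1) (mergeAt (k + 1) (swapAt k (swapAt (k + 1) f))) v +
        ev (n + 1) (mergeAt k (swapAt (k + 1) f)) v + ev (n + 1) (mergeAt (k + 1) f) v := by
  have e₁ : mergeAt (k + 1) (swapAt k (swapAt (k + 1) f)) = swapAt k (mergeAt k f) := by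
    funext i
    simp only [mergeAt, swapAt, Equiv.swap_apply_def]
    grind
  have e₂ : mergeAt (k + 1) (swapAt k f) = swapAt k (mergeAt k (swapAt (k + 1) f)) := by
    funext i
    simp only [mergeAt, swapAt, Equiv.swap_apply_def]
    grind
  have e₃ : mergeAt (k + 1) f = swapAt k (mergeAt k (swapAt (k + 1) (swapAt k f))) := by
    funext i
    simp only [mergeAt, swapAt, Equiv.swap_apply_def]
    grind
  set g := mergeAt k (mergeAt k f) with hg
  have g₁ : mergeAt k (mergeAt k f) =
      Function.update g k ⁅⁅f k, f (k + 1)⁆, f (k + 2)⁆ := by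
    funext i
    simp only [hg, mergeAt, Function.update_apply]
    grind
  have g₂ : mergeAt k (mergeAt k (swapAt (k + 1) f)) =
      Function.update g k ⁅⁅f k, f (k + 2)⁆, f (k + 1)⁆ := by
    funext i
    simp only [hg, mergeAt, swapAt, Function.update_apply, Equiv.swap_apply_def]
    grind
  have g₃ : mergeAt k (mergeAt k (swapAt (k + 1) (swapAt k f))) =
      Function.update g k ⁅⁅f (k + 1), f (k + 2)⁆, f k⁆ := by
    funext i
    simp only [hg, mergeAt, swapAt, Function.update_apply, Equiv.swap_apply_def]
    grind
  have jac : ev n (mergeAt k (mergeAt k f)) u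
      + ev n (mergeAt k (mergeAt k (swapAt (k + 1) (swapAt k f)))) u
      = ev n (mergeAt k (mergeAt k (swapAt (k + 1) f))) u := by
    rw [g₁, g₂, g₃, ← ev_update_add hk hu]
    congr 3
    rw [lie_lie (f k) (f (k + 1)), ← lie_skew ⁅f (k + 1), f (k + 2)⁆ (f k),
      ← lie_skew ⁅f k, f (k + 2)⁆ (f (k + 1))]
    abel
  rw [e₁, e₂, e₃, h L (mergeAt k f) k hk, h L (mergeAt k (swapAt (k + 1) f)) k hk,
    h L (mergeAt k (swapAt (k + 1) (swapAt k f))) k hk, ← jac]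
  abel

theorem Exchange.exists_next {n : ℕ} {u : FreeLieAlgebra ℚ (Fin n)}
    {v : FreeLieAlgebra ℚ (Fin (n + 1))} (h : Exchange n u v) (hu : u ∈ multilinear n)
    (hv : v ∈ multilinear (n + 1)) :
    ∃ w ∈ multilinear (n + 2), Exchange (n + 1) v w := by
  have hS : ∀ k < n + 1, ∀ f : ℕ → FreeLieAlgebra ℚ (Fin (n + 2)), ∀ x,
      ev (n + 2) f (ev (n + 2) (swapAt k (gen (n + 2))) x) = ev (n + 2) (swapAt k f) x :=
    fun k hk f x => ev_swapAt_gen (by omega) f x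
  have hc : ∀ k < n + 1, ∀ f : ℕ → FreeLieAlgebra ℚ (Fin (n + 2)),
      ev (n + 2) f (ev (n + 1) (mergeAt k (gen (n + 2))) v) = ev (n + 1) (mergeAt k f) v :=
    fun k hk f => ev_mergeAt_gen hk f v
  obtain ⟨w, hw, hfix⟩ := exists_common_fixed_point (multilinear (n + 2))
    (fun k => (ev (n + 2) (swapAt k (gen (n + 2)))).toLinearMap)
    (fun k => ev (n + 1) (mergeAt k (gen (n + 2))) v)
    (fun k x => ev (n + 2) (swapAt k (gen (n + 2))) x + ev (n + 1) (mergeAt k (gen (n + 2))) v)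
    (fun k x => rfl) (n + 1)
    (fun k hk x hx => add_mem (ev_swapAt_mem_multilinear (by omega) hx)
      (ev_mergeAt_mem_multilinear hk hv))
    (fun k hk x => by
      rw [map_add, hS k hk, hc k hk, swapAt_swapAt, ev_gen, add_assoc,
        ev_mergeAt_swapAt_self hk hv, add_zero])
    (fun k l hkl hl x => by
      rw [map_add, map_add, hS l hl, hS k (by omega), hc l hl, hc k (by omega),
        swapAt_comm hkl, add_assoc, add_assoc, h.comm hkl hl])
    (fun k hk x => by
      have hb := h.braid hu (k := k) (by omega) (gen (n + 2))
      have hk' : k < n + 1 := by omega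
      simp only [map_add]
      simp only [↓hS k hk', ↓hS (k + 1) hk, ↓hc k hk', ↓hc (k + 1) hk]
      rw [swapAt_braid]
      simp only [add_assoc] at hb ⊢
      rw [hb])
  refine ⟨w, hw, fun L _ _ f k hk => ?_⟩
  conv_lhs => rw [← hfix k hk]
  rw [map_add, ev_swapAt_gen (by omega), ev_mergeAt_gen hk]

/-- Consecutive terms of a sequence of Magnus commutators. -/
def Stage (n : ℕ) : Type :=
  {p : FreeLieAlgebra ℚ (Fin n) × FreeLieAlgebra ℚ (Fin (n + 1)) //
    p.1 ∈ multilinear n ∧ p.2 ∈ multilinear (n + 1) ∧ Exchange n p.1 p.2}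

/-- The recursive construction of the Magnus commutators. -/
noncomputable def stage : (n : ℕ) → Stage n
  | 0 => ⟨(0, FreeLieAlgebra.of ℚ 0), zero_mem _, Submodule.subset_span (.of 0),
      fun _ _ _ _ _ hk => absurd hk (Nat.not_lt_zero _)⟩
  | n + 1 =>
    let p := stage n
    let e := p.2.2.2.exists_next p.2.1 p.2.2.1
    ⟨(p.1.2, e.choose), p.2.2.1, e.choose_spec.1, e.choose_spec.2⟩

end Recursion

end MagnusCommutators

/-- Existence of the Magnus commutators `μₙ`:  a family of elements
`μ n ∈ FreeLieAlgebra ℚ (Fin n)` such that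
(μ1) `μ 1` is the unique generator;
(μ2) each `μ n` (`n ≥ 1`) lies in the span of the multilinear Lie monomials;
(μ3) for `2 ≤ k ≤ n`, `μ n - σₖ (μ n) = ρₖ (μ (n-1))`, where `σₖ` swaps the generators
`X_{k-1}` and `X_k` (zero-indexed: the generators at positions `k-2` and `k-1`), and
`ρₖ` sends `X_j ↦ X_j` for `j < k-1`, `X_{k-1} ↦ ⁅X_{k-1}, X_k⁆`, and `X_j ↦ X_{j+1}`
for `j ≥ k` (in the one-indexed labeling of the statement). -/
theorem exists_magnus_commutators :
    ∃ μ : (n : ℕ) → FreeLieAlgebra ℚ (Fin n),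
      μ 1 = FreeLieAlgebra.of ℚ (0 : Fin 1) ∧
      (∀ n, 1 ≤ n → μ n ∈ Submodule.span ℚ {u | IsLieMonomialOn ℚ n Finset.univ u}) ∧
      (∀ (n : ℕ) (hn2 : 2 ≤ n) (k : ℕ) (hk2 : 2 ≤ k) (hk : k ≤ n),
        μ n - (FreeLieAlgebra.lift ℚ (fun i : Fin n =>
            FreeLieAlgebra.of ℚ
              (Equiv.swap (⟨k - 2, by omega⟩ : Fin n) (⟨k - 1, by omega⟩ : Fin n) i))) (μ n)
        = (FreeLieAlgebra.lift ℚ (fun j : Fin (n - 1) =>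
            if (j : ℕ) < k - 2 then
              FreeLieAlgebra.of ℚ (⟨(j : ℕ), by have := j.isLt; omega⟩ : Fin n)
            else if (j : ℕ) = k - 2 then
              ⁅FreeLieAlgebra.of ℚ (⟨k - 2, by omega⟩ : Fin n),
               FreeLieAlgebra.of ℚ (⟨k - 1, by omega⟩ : Fin n)⁆
            else
              FreeLieAlgebra.of ℚ (⟨(j : ℕ) + 1, by have := j.isLt; omega⟩ : Fin n)))
            (μ (n - 1))) := by
  refine ⟨fun n => (MagnusCommutators.stage n).1.1, rfl,
    fun n _ => (MagnusCommutators.stage n).2.1, fun n hn2 k hk2 hk => ?_⟩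
  obtain ⟨n, rfl⟩ : ∃ m, n = m + 1 := ⟨n - 1, by omega⟩
  obtain ⟨k, rfl⟩ : ∃ l, k = l + 2 := ⟨k - 2, by omega⟩
  have h := (MagnusCommutators.stage n).2.2.2 _ (MagnusCommutators.gen (n + 1)) k (by omega)
  rw [MagnusCommutators.ev_gen] at h
  rw [sub_eq_iff_eq_add']
  refine h.trans (congrArg₂ (· + ·)
    (LieHom.congr_fun (congrArg (FreeLieAlgebra.lift ℚ) (funext fun i => ?_)) _)
    (LieHom.congr_fun (congrArg (FreeLieAlgebra.lift ℚ) (funext fun i => ?_)) _))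
  · simp only [MagnusCommutators.swapAt, MagnusCommutators.gen, Equiv.swap_apply_def, Fin.ext_iff,
      show k + 2 - 2 = k from rfl, show k + 2 - 1 = k + 1 from rfl,
      apply_ite (FreeLieAlgebra.of ℚ)]
    split_ifs <;> first | rfl | omega
  · have hi : (i : ℕ) < n := i.isLt
    simp only [MagnusCommutators.mergeAt, MagnusCommutators.gen, show k + 2 - 2 = k from rfl]
    split_ifs <;> first | rfl | omega
end

section
/- Let K be a commutative ring and n ≥ 2. If P ∈ FreeLieAlgebra K (Fin n) lies in the K-span of the multilinear Lie monomials B(Fin n), then Σ_{σ ∈ Sym (Fin n)} σ•P = 0, where σ•P denotes the image of P under the Lie algebra automorphism of FreeLieAlgebra K (Fin n) induced by permuting the generators according to σ (X_i ↦ X_{σ(i)}). -/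
namespace IsLieMonomialOn

variable {K : Type*} [CommRing K] {n : ℕ} {S : Finset (Fin n)} {u : FreeLieAlgebra K (Fin n)}

/-- The image of a Lie monomial under a homomorphism only depends on the images of the generators
occurring in it. -/
theorem lift_congr {L : Type*} [LieRing L] [LieAlgebra K L] (hu : IsLieMonomialOn K n S u)
    {f g : Fin n → L} (hfg : ∀ i ∈ S, f i = g i) :
    FreeLieAlgebra.lift K f u = FreeLieAlgebra.lift K g u := by
  induction hu with
  | of i => simpa using hfg i (by simp)
  | bracket _ _ _ _ _ ihu ihv =>
    rw [LieHom.map_lie, LieHom.map_lie, ihu fun i hi => hfg i (Finset.mem_union_left _ hi),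
      ihv fun i hi => hfg i (Finset.mem_union_right _ hi)]

/-- A Lie monomial is fixed by every permutation fixing the generators occurring in it. -/
theorem lift_eq_self (hu : IsLieMonomialOn K n S u) {σ : Equiv.Perm (Fin n)}
    (hσ : ∀ i ∈ S, σ i = i) :
    FreeLieAlgebra.lift K (fun i => FreeLieAlgebra.of K (σ i)) u = u := by
  rw [hu.lift_congr (g := FreeLieAlgebra.of K) fun i hi => by rw [hσ i hi]]
  exact LieHom.congr_fun (FreeLieAlgebra.lift_comp_of (R := K) LieHom.id) u

/-- A Lie monomial that is not a generator is negated by a transposition, namely that of two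
generators forming an innermost bracket. -/
theorem eq_of_or_exists_lift_swap_eq_neg (hu : IsLieMonomialOn K n S u) :
    (∃ i, S = {i} ∧ u = FreeLieAlgebra.of K i) ∨
      ∃ i ∈ S, ∃ j ∈ S, i ≠ j ∧
        FreeLieAlgebra.lift K (fun k => FreeLieAlgebra.of K (Equiv.swap i j k)) u = -u := by
  induction hu with
  | of i => exact .inl ⟨i, rfl, rfl⟩
  | @bracket S T u v _ _ hST hu hv ihu ihv =>
    right
    rcases ihu with ⟨i, rfl, rfl⟩ | ⟨i, hi, j, hj, hij, h⟩
    · rcases ihv with ⟨j, rfl, rfl⟩ | ⟨j, hj, k, hk, hjk, h⟩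
      · refine ⟨i, by simp, j, by simp, by simpa using hST, ?_⟩
        simp
      · refine ⟨j, Finset.mem_union_right _ hj, k, Finset.mem_union_right _ hk, hjk, ?_⟩
        rw [LieHom.map_lie, h, hu.lift_eq_self fun l hl => Equiv.swap_apply_of_ne_of_ne
          (Finset.disjoint_iff_ne.1 hST l hl j hj) (Finset.disjoint_iff_ne.1 hST l hl k hk),
          lie_neg]
    · refine ⟨i, Finset.mem_union_left _ hi, j, Finset.mem_union_left _ hj, hij, ?_⟩
      rw [LieHom.map_lie, h, hv.lift_eq_self fun l hl => Equiv.swap_apply_of_ne_of_ne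
        (Finset.disjoint_iff_ne.1 hST i hi l hl).symm
        (Finset.disjoint_iff_ne.1 hST j hj l hl).symm, neg_lie]

end IsLieMonomialOn

/-- The action of permutations on the free Lie algebra is multiplicative. -/
theorem FreeLieAlgebra.lift_of_mul_apply {K X : Type*} [CommRing K] (σ τ : Equiv.Perm X)
    (u : FreeLieAlgebra K X) :
    FreeLieAlgebra.lift K (fun i => FreeLieAlgebra.of K ((σ * τ) i)) u =
      FreeLieAlgebra.lift K (fun i => FreeLieAlgebra.of K (σ i))
        (FreeLieAlgebra.lift K (fun i => FreeLieAlgebra.of K (τ i)) u) := by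
  rw [← LieHom.comp_apply]
  congr 1
  ext i
  simp

/-- If a nontrivial involution negates `u`, the images of `u` under all permutations of the
generators cancel in pairs. -/
theorem FreeLieAlgebra.sum_perm_eq_zero_of_lift_eq_neg {K X : Type*} [CommRing K] [Fintype X]
    [DecidableEq X] {u : FreeLieAlgebra K X} {τ : Equiv.Perm X} (hτ : τ ≠ 1) (hττ : τ * τ = 1)
    (h : FreeLieAlgebra.lift K (fun i => FreeLieAlgebra.of K (τ i)) u = -u) :
    ∑ σ : Equiv.Perm X, FreeLieAlgebra.lift K (fun i => FreeLieAlgebra.of K (σ i)) u = 0 := by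
  refine Finset.sum_involution (fun σ _ => σ * τ) (fun σ _ => ?_) (fun σ _ _ => by simpa using hτ)
    (fun _ _ => Finset.mem_univ _) (fun σ _ => by rw [mul_assoc, hττ, mul_one])
  rw [FreeLieAlgebra.lift_of_mul_apply, h, map_neg, add_neg_cancel]

/-- If `P` lies in the span of the multilinear Lie monomials (each generator occurring
exactly once), then the sum of all its images under permutations of the generators
vanishes. -/
theorem sum_perm_of_multilinear (K : Type*) [CommRing K] (n : ℕ) (hn : 2 ≤ n)
    (P : FreeLieAlgebra K (Fin n))
    (hP : P ∈ Submodule.span K {u | IsLieMonomialOn K n Finset.univ u}) :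
    ∑ σ : Equiv.Perm (Fin n),
      (FreeLieAlgebra.lift K (fun i => FreeLieAlgebra.of K (σ i))) P = 0 := by
  induction hP using Submodule.span_induction with
  | mem u hu =>
    rcases hu.eq_of_or_exists_lift_swap_eq_neg with ⟨i, hi, -⟩ | ⟨i, -, j, -, hij, h⟩
    · have := congrArg Finset.card hi
      simp at this
      lia
    · exact FreeLieAlgebra.sum_perm_eq_zero_of_lift_eq_neg (mt Equiv.swap_eq_one_iff.1 hij)
        (Equiv.swap_mul_self i j) h
  | zero => simp
  | add u v _ _ hu hv => simp only [map_add, Finset.sum_add_distrib, hu, hv, add_zero]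
  | smul c u _ hu => simp only [map_smul, ← Finset.smul_sum, hu, smul_zero]
end

section
/- Let K be a commutative ring that is a ℚ-algebra and let g be a Lie algebra over K. Then the restriction of the canonical algebra map m : T(g) → U(g) to the submodule of symmetric tensors T_Σ(g) is bijective, i.e. m restricted to T_Σ(g) is an isomorphism of K-modules onto U(g) (the symmetric global Poincaré–Birkhoff–Witt theorem). -/
/-- The `K`-submodule of symmetric tensors of the tensor algebra `T(g)`: the span of `1`
(the case `n = 0`) together with the symmetrized products
`(1/n!) • ∑_{σ ∈ Sym (Fin n)} ι(x_{σ 1}) ⋯ ι(x_{σ n})`. -/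
noncomputable def symTensors (K : Type*) [CommRing K] [Algebra ℚ K]
    (g : Type*) [LieRing g] [LieAlgebra K g] : Submodule K (TensorAlgebra K g) :=
  Submodule.span K {z | ∃ (n : ℕ) (x : Fin n → g),
    z = algebraMap ℚ K ((n.factorial : ℚ)⁻¹) •
        ∑ σ : Equiv.Perm (Fin n),
          (List.ofFn fun i => TensorAlgebra.ι K (x (σ i))).prod}

namespace SymmetricPBW

open scoped TensorProduct

section LeftRecursion

variable {K V N : Type*} [CommRing K] [AddCommGroup V] [Module K V] [AddCommGroup N] [Module K N]

/-- The linear map `F` on the tensor algebra determined by `F 1 = n₀` and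
`F (x t) = φ x t + ψ x (F t)` for `x ∈ V`. -/
noncomputable def leftRec (φ : V →ₗ[K] TensorAlgebra K V →ₗ[K] N) (ψ : V →ₗ[K] N →ₗ[K] N)
    (n₀ : N) : TensorAlgebra K V →ₗ[K] N :=
  LinearMap.snd K (TensorAlgebra K V) N ∘ₗ LinearMap.applyₗ (1, n₀) ∘ₗ
    (TensorAlgebra.lift K (A := Module.End K (TensorAlgebra K V × N))
      (LinearMap.mk₂ K (fun x p => (TensorAlgebra.ι K x * p.1, φ x p.1 + ψ x p.2))
        (fun x y p => by simp [add_mul]; abel) (fun c x p => by simp)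
        (fun x p q => by simp [mul_add]; abel) (fun c x p => by simp))).toLinearMap

variable (φ : V →ₗ[K] TensorAlgebra K V →ₗ[K] N) (ψ : V →ₗ[K] N →ₗ[K] N) (n₀ : N)

@[simp] lemma leftRec_one : leftRec φ ψ n₀ 1 = n₀ := by simp [leftRec]

@[simp] lemma leftRec_ι_mul (x : V) (t : TensorAlgebra K V) :
    leftRec φ ψ n₀ (TensorAlgebra.ι K x * t) = φ x t + ψ x (leftRec φ ψ n₀ t) := by
  set L := TensorAlgebra.lift K (A := Module.End K (TensorAlgebra K V × N))
      (LinearMap.mk₂ K (fun x p => (TensorAlgebra.ι K x * p.1, φ x p.1 + ψ x p.2))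
        (fun x y p => by simp [add_mul]; abel) (fun c x p => by simp)
        (fun x p q => by simp [mul_add]; abel) (fun c x p => by simp)) with hL
  have key : ∀ (a : TensorAlgebra K V) (p : TensorAlgebra K V × N), (L a p).1 = a * p.1 := by
    intro a
    induction a using TensorAlgebra.induction with
    | algebraMap r => intro p; simp [Module.algebraMap_end_apply, Algebra.smul_def]
    | ι x => intro p; simp [hL]
    | mul a b ha hb => intro p; simp [ha, hb, mul_assoc]
    | add a b ha hb => intro p; simp [ha, hb, add_mul]
  have h1 : ∀ a, leftRec φ ψ n₀ a = (L a (1, n₀)).2 := fun a => rfl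
  rw [h1, h1, map_mul, Module.End.mul_apply]
  nth_rewrite 1 [hL]
  rw [TensorAlgebra.lift_ι_apply]
  simp [key]

end LeftRecursion

section Operators

variable {K g : Type*} [CommRing K] [LieRing g] [LieAlgebra K g]

/-- The product in `T(g)` of a list of elements of `g`. -/
noncomputable def word (l : List g) : TensorAlgebra K g := (l.map (TensorAlgebra.ι K)).prod

@[simp] lemma word_nil : word (K := K) ([] : List g) = 1 := rfl

@[simp] lemma word_cons (x : g) (l : List g) :
    word (K := K) (x :: l) = TensorAlgebra.ι K x * word l := by
  simp [word]

@[simp] lemma word_append (l l' : List g) :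
    word (K := K) (l ++ l') = word l * word l' := by simp [word]

lemma span_word_eq_top : Submodule.span K (Set.range (word (K := K) (g := g))) = ⊤ := by
  refine eq_top_iff.2 fun t _ => ?_
  induction t using TensorAlgebra.induction with
  | algebraMap r =>
    rw [Algebra.algebraMap_eq_smul_one]
    exact Submodule.smul_mem _ _ (Submodule.subset_span ⟨[], rfl⟩)
  | ι x => exact Submodule.subset_span ⟨[x], by simp⟩
  | mul a b ha hb =>
    have h := Submodule.mul_mem_mul (ha trivial) (hb trivial)
    rw [Submodule.span_mul_span] at h
    refine Submodule.span_mono ?_ h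
    rintro _ ⟨_, ⟨u, rfl⟩, _, ⟨v, rfl⟩, rfl⟩
    exact ⟨u ++ v, by simp⟩
  | add a b ha hb => exact add_mem (ha trivial) (hb trivial)

local notation "T" => TensorAlgebra K g
local notation "ι" => TensorAlgebra.ι K (M := g)

/-- The unshuffle `x₁⋯xₙ ↦ ∑ₖ xₖ ⊗ x₁⋯x̂ₖ⋯xₙ`. -/
noncomputable def unshuffle : T →ₗ[K] g ⊗[K] T :=
  leftRec (TensorProduct.mk K g T)
    (LinearMap.lTensorHom g ∘ₗ LinearMap.mul K T ∘ₗ ι) 0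

/-- The contraction `y ⊗ s ↦ f(y) s`. -/
noncomputable def contr : (g →ₗ[K] T) →ₗ[K] g ⊗[K] T →ₗ[K] T :=
  LinearMap.mk₂ K (fun f z => LinearMap.mul' K T (f.rTensor T z))
    (fun f f' z => by simp [LinearMap.rTensor_add]) (fun c f z => by simp [LinearMap.rTensor_smul])
    (fun f z z' => by simp) (fun c f z => by simp)

/-- `bracketLeft x` is the map `y ↦ ι ⁅x, y⁆`. -/
noncomputable def bracketLeft : g →ₗ[K] g →ₗ[K] T :=
  LinearMap.mk₂ K (fun x y => ι ⁅x, y⁆) (by simp) (by simp) (by simp) (by simp)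

/-- `derivBracket t y` is the value at `t` of the derivation of `T(g)` extending
`x ↦ ι ⁅x, y⁆`. -/
noncomputable def derivBracket : T →ₗ[K] g →ₗ[K] T :=
  leftRec
    (LinearMap.mk₂ K (fun x t => LinearMap.mulRight K t ∘ₗ bracketLeft x)
      (fun x y t => by ext; simp [add_mul]) (fun c x t => by ext; simp)
      (fun x t s => by ext; simp [mul_add]) (fun c x t => by ext; simp))
    (LinearMap.mk₂ K (fun x f => LinearMap.mulLeft K (ι x) ∘ₗ f)
      (fun x y t => by ext; simp [add_mul]) (fun c x t => by ext; simp)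
      (fun x t s => by ext; simp [mul_add]) (fun c x t => by ext; simp)) 0

/-- The map `x₁⋯xₙ ↦ ∑_{j < k} x₁⋯⁅xⱼ, xₖ⁆⋯x̂ₖ⋯xₙ`. -/
noncomputable def bracketSum : T →ₗ[K] T :=
  leftRec ((contr ∘ₗ bracketLeft).compl₂ unshuffle) (LinearMap.mul K T ∘ₗ ι) 0

@[simp] lemma unshuffle_one : unshuffle (1 : T) = 0 := leftRec_one _ _ _

@[simp] lemma unshuffle_ι_mul (x : g) (t : T) : unshuffle (ι x * t) =
    x ⊗ₜ t + (LinearMap.mulLeft K (ι x)).lTensor g (unshuffle t) := leftRec_ι_mul _ _ _ _ _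

@[simp] lemma contr_tmul (f : g →ₗ[K] T) (y : g) (s : T) : contr f (y ⊗ₜ s) = f y * s := by
  simp [contr]

@[simp] lemma bracketLeft_apply (x y : g) : bracketLeft (K := K) x y = ι ⁅x, y⁆ := rfl

@[simp] lemma derivBracket_one : derivBracket (1 : T) = 0 := leftRec_one _ _ _

@[simp] lemma derivBracket_ι_mul (x : g) (t : T) (y : g) : derivBracket (ι x * t) y =
    ι ⁅x, y⁆ * t + ι x * derivBracket t y := by simp [derivBracket]

@[simp] lemma bracketSum_one : bracketSum (1 : T) = 0 := leftRec_one _ _ _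

@[simp] lemma bracketSum_ι_mul (x : g) (t : T) : bracketSum (ι x * t) =
    contr (bracketLeft x) (unshuffle t) + ι x * bracketSum t := leftRec_ι_mul _ _ _ _ _

lemma unshuffle_word_mul (l : List g) (b : T) : unshuffle (word l * b) =
    (LinearMap.mulRight K b).lTensor g (unshuffle (word l)) +
      (LinearMap.mulLeft K (word l)).lTensor g (unshuffle b) := by
  induction l with
  | nil => simp [LinearMap.mulLeft_one]
  | cons x l ih =>
    simp only [word_cons, mul_assoc, unshuffle_ι_mul, ih, map_add, LinearMap.lTensor_tmul,
      LinearMap.mulRight_apply, ← LinearMap.lTensor_comp_apply]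
    rw [LinearMap.mulLeft_mul]
    have : LinearMap.mulLeft K (ι x) ∘ₗ LinearMap.mulRight K b =
      LinearMap.mulRight K b ∘ₗ LinearMap.mulLeft K (ι x) := by ext; simp [mul_assoc]
    rw [this]
    abel

lemma derivBracket_word_mul (l : List g) (b : T) (y : g) : derivBracket (word l * b) y =
    derivBracket (word l) y * b + word l * derivBracket b y := by
  induction l with
  | nil => simp
  | cons x l ih => simp only [word_cons, mul_assoc, derivBracket_ι_mul, ih]; noncomm_ring

lemma bracketSum_word_mul (l : List g) (b : T) : bracketSum (word l * b) =
    bracketSum (word l) * b + word l * bracketSum b +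
      contr (derivBracket (word l)) (unshuffle b) := by
  induction l with
  | nil => simp
  | cons x l ih =>
    simp only [word_cons, mul_assoc, bracketSum_ι_mul, ih, unshuffle_word_mul, map_add]
    have h1 : ∀ z : g ⊗[K] T, contr (bracketLeft x) ((LinearMap.mulRight K b).lTensor g z) =
        contr (bracketLeft x) z * b := by
      intro z
      induction z with
      | zero => simp
      | tmul y s => simp [mul_assoc]
      | add _ _ h h' => simp only [map_add, h, h', add_mul]
    have h2 : ∀ z : g ⊗[K] T, contr (derivBracket (ι x * word l)) z =
        contr (bracketLeft x) ((LinearMap.mulLeft K (word l)).lTensor g z) +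
          ι x * contr (derivBracket (word l)) z := by
      intro z
      induction z with
      | zero => simp
      | tmul y s => simp [mul_assoc, add_mul]
      | add _ _ h h' => simp only [map_add, h, h', mul_add]; abel
    rw [h1, h2]
    noncomm_ring

lemma unshuffle_word_mem {N : Type*} [AddCommGroup N] [Module K N] (S : Submodule K N)
    (l : List g) (φ : g ⊗[K] T →ₗ[K] N)
    (h : ∀ x l', l'.length + 1 = l.length → φ (x ⊗ₜ word l') ∈ S) :
    φ (unshuffle (word l)) ∈ S := by
  induction l generalizing φ with
  | nil => simp
  | cons x l ih =>
    rw [word_cons, unshuffle_ι_mul, map_add]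
    refine S.add_mem (h x l (by simp)) ?_
    rw [← LinearMap.comp_apply]
    refine ih _ fun y l' hl' => ?_
    simpa using h y (x :: l') (by simp [hl'])

/-- `ι x * ι y - ι y * ι x - ι ⁅x, y⁆`. -/
noncomputable def relator (x y : g) : T := ι x * ι y - ι y * ι x - ι ⁅x, y⁆

variable (K g) in
/-- The span of all `u (xy - yx - ⁅x, y⁆) v` with `u`, `v` words of total length at most `m - 2`. -/
noncomputable def relFilt (m : ℕ) : Submodule K T :=
  Submodule.span K {z | ∃ (u v : List g) (x y : g), u.length + v.length + 2 ≤ m ∧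
    z = word u * relator x y * word v}

variable (K g) in
/-- The span of all words of length less than `m`. -/
noncomputable def shortWords (m : ℕ) : Submodule K T :=
  Submodule.span K {z | ∃ u : List g, u.length < m ∧ z = word u}

lemma word_mem_shortWords {l : List g} {m : ℕ} (h : l.length < m) : word l ∈ shortWords K g m :=
  Submodule.subset_span ⟨l, h, rfl⟩

lemma relFilt_mono {m n : ℕ} (h : m ≤ n) : relFilt K g m ≤ relFilt K g n :=
  Submodule.span_mono fun _ ⟨u, v, x, y, hl, e⟩ => ⟨u, v, x, y, hl.trans h, e⟩

lemma word_mul_relFilt (l : List g) {m n : ℕ} {t : T} (ht : t ∈ relFilt K g m)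
    (h : l.length + m ≤ n) : word l * t ∈ relFilt K g n := by
  induction ht using Submodule.span_induction with
  | mem t ht =>
    obtain ⟨u, v, x, y, hl, rfl⟩ := ht
    exact Submodule.subset_span ⟨l ++ u, v, x, y, by simp; lia, by simp [mul_assoc]⟩
  | zero => simp
  | add a b _ _ ha hb => rw [mul_add]; exact add_mem ha hb
  | smul c a _ ha => rw [mul_smul_comm]; exact Submodule.smul_mem _ _ ha

lemma relFilt_mul_word (l : List g) {m n : ℕ} {t : T} (ht : t ∈ relFilt K g m)
    (h : m + l.length ≤ n) : t * word l ∈ relFilt K g n := by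
  induction ht using Submodule.span_induction with
  | mem t ht =>
    obtain ⟨u, v, x, y, hl, rfl⟩ := ht
    exact Submodule.subset_span ⟨u, v ++ l, x, y, by simp; lia, by simp [mul_assoc]⟩
  | zero => simp
  | add a b _ _ ha hb => rw [add_mul]; exact add_mem ha hb
  | smul c a _ ha => rw [smul_mul_assoc]; exact Submodule.smul_mem _ _ ha

lemma ι_mul_relFilt (x : g) {m : ℕ} {t : T} (ht : t ∈ relFilt K g m) :
    ι x * t ∈ relFilt K g (m + 1) := by
  simpa using word_mul_relFilt [x] ht (n := m + 1) (by simp; lia)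

lemma ι_mul_shortWords (x : g) {m : ℕ} {t : T} (ht : t ∈ shortWords K g m) :
    ι x * t ∈ shortWords K g (m + 1) := by
  induction ht using Submodule.span_induction with
  | mem t ht =>
    obtain ⟨u, hl, rfl⟩ := ht
    exact Submodule.subset_span ⟨x :: u, by simp; lia, by simp⟩
  | zero => simp
  | add a b _ _ ha hb => rw [mul_add]; exact add_mem ha hb
  | smul c a _ ha => rw [mul_smul_comm]; exact Submodule.smul_mem _ _ ha

lemma mul_relator_mul_mem {p q m : ℕ} {s t : T} (hs : s ∈ shortWords K g p)
    (ht : t ∈ shortWords K g q) (x y : g) (h : p + q ≤ m) :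
    s * relator x y * t ∈ relFilt K g m := by
  induction hs using Submodule.span_induction with
  | mem s hs =>
    obtain ⟨u, hu, rfl⟩ := hs
    induction ht using Submodule.span_induction with
    | mem t ht =>
      obtain ⟨v, hv, rfl⟩ := ht
      exact Submodule.subset_span ⟨u, v, x, y, by lia, rfl⟩
    | zero => simp
    | add a b _ _ ha hb => rw [mul_add]; exact add_mem ha hb
    | smul c a _ ha => rw [mul_smul_comm]; exact Submodule.smul_mem _ _ ha
  | zero => simp
  | add a b _ _ ha hb => rw [add_mul, add_mul]; exact add_mem ha hb
  | smul c a _ ha => rw [smul_mul_assoc, smul_mul_assoc]; exact Submodule.smul_mem _ _ ha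

lemma relator_mul_word_mem (x y : g) (l : List g) {m : ℕ} (h : l.length + 2 ≤ m) :
    relator x y * word l ∈ relFilt K g m :=
  Submodule.subset_span ⟨[], l, x, y, by simpa using h, by simp⟩

lemma derivBracket_word_mem (l : List g) (y : g) :
    derivBracket (word l) y ∈ shortWords K g (l.length + 1) := by
  induction l with
  | nil => simp
  | cons x l ih =>
    rw [word_cons, derivBracket_ι_mul]
    refine add_mem ?_ (ι_mul_shortWords x ih)
    simpa using word_mem_shortWords (K := K) (l := ⁅x, y⁆ :: l) (by simp)

lemma bracketSum_word_mem (l : List g) : bracketSum (word l) ∈ shortWords K g l.length := by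
  induction l with
  | nil => simp
  | cons x l ih =>
    rw [word_cons, bracketSum_ι_mul]
    refine add_mem (unshuffle_word_mem _ _ _ fun y l' hl' => ?_) (ι_mul_shortWords x ih)
    simpa using word_mem_shortWords (K := K) (l := ⁅x, y⁆ :: l') (by simp; lia)

lemma derivBracket_relator_mul (x y z : g) (t : T) : derivBracket (relator x y * t) z =
    relator ⁅x, z⁆ y * t + relator x ⁅y, z⁆ * t + relator x y * derivBracket t z := by
  have h : ι ⁅⁅x, y⁆, z⁆ = ι ⁅⁅x, z⁆, y⁆ + ι ⁅x, ⁅y, z⁆⁆ := by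
    rw [← map_add, leibniz_lie x y z, ← lie_skew ⁅x, z⁆ y]
    congr 1
    abel_nf
  simp only [relator, sub_mul, mul_assoc, map_sub, LinearMap.sub_apply, derivBracket_ι_mul, h]
  noncomm_ring

lemma derivBracket_mem_relFilt {m : ℕ} {t : T} (ht : t ∈ relFilt K g m) (z : g) :
    derivBracket t z ∈ relFilt K g m := by
  induction ht using Submodule.span_induction with
  | mem t ht =>
    obtain ⟨u, v, x, y, hl, rfl⟩ := ht
    have hu := word_mem_shortWords (K := K) (Nat.lt_succ_self u.length)
    have hv := word_mem_shortWords (K := K) (Nat.lt_succ_self v.length)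
    rw [mul_assoc, derivBracket_word_mul, derivBracket_relator_mul]
    simp only [mul_add, ← mul_assoc]
    refine add_mem ?_ (add_mem (add_mem ?_ ?_) ?_)
    · exact mul_relator_mul_mem (derivBracket_word_mem u z) hv _ _ (by lia)
    · exact mul_relator_mul_mem hu hv _ _ (by lia)
    · exact mul_relator_mul_mem hu hv _ _ (by lia)
    · exact mul_relator_mul_mem hu (derivBracket_word_mem v z) _ _ (by lia)
  | zero => simp
  | add a b _ _ ha hb => rw [map_add]; exact add_mem ha hb
  | smul c a _ ha => rw [map_smul]; exact Submodule.smul_mem _ _ ha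

lemma word_mul_ι_sub_mem (l : List g) (y : g) :
    word l * ι y - ι y * word l - derivBracket (word l) y ∈ relFilt K g (l.length + 1) := by
  induction l with
  | nil => simp
  | cons x l ih =>
    have h := add_mem (ι_mul_relFilt x ih) (relator_mul_word_mem x y l le_rfl)
    rw [List.length_cons]
    convert h using 1
    simp only [word_cons, derivBracket_ι_mul, relator]
    noncomm_ring

lemma bracketSum_add_contr_sub_mem (l : List g) :
    bracketSum (word l) + contr ι (unshuffle (word l)) - l.length • word l ∈
      relFilt K g l.length := by
  induction l with
  | nil => simp
  | cons x l ih =>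
    have h : (contr (bracketLeft x) + contr ι ∘ₗ (LinearMap.mulLeft K (ι x)).lTensor g -
        LinearMap.mulLeft K (ι x) ∘ₗ contr ι : g ⊗[K] T →ₗ[K] T) (unshuffle (word l)) ∈
          relFilt K g (l.length + 1) := by
      refine unshuffle_word_mem _ _ _ fun y l' hl' => ?_
      convert relator_mul_word_mem (K := K) y x l' (m := l.length + 1) (by lia) using 1
      simp only [relator, LinearMap.sub_apply, LinearMap.add_apply, LinearMap.comp_apply,
        contr_tmul, LinearMap.lTensor_tmul, LinearMap.mulLeft_apply, bracketLeft_apply]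
      rw [← lie_skew, map_neg]
      noncomm_ring
    rw [List.length_cons]
    convert add_mem (ι_mul_relFilt x ih) h using 1
    simp only [word_cons, bracketSum_ι_mul, unshuffle_ι_mul, map_add, contr_tmul,
      LinearMap.sub_apply, LinearMap.add_apply, LinearMap.comp_apply, LinearMap.mulLeft_apply,
      mul_sub, mul_add, succ_nsmul, mul_smul_comm]
    abel

lemma unshuffle_commutator (a b : List g) (x y : g) :
    unshuffle (word a * (ι x * ι y - ι y * ι x) * word b) =
      (LinearMap.mulRight K ((ι x * ι y - ι y * ι x) * word b)).lTensor g (unshuffle (word a)) +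
      (LinearMap.mulLeft K (word a * (ι x * ι y - ι y * ι x))).lTensor g (unshuffle (word b)) := by
  rw [mul_assoc, unshuffle_word_mul, LinearMap.mulLeft_mul, LinearMap.lTensor_comp_apply]
  congr 2
  have h : LinearMap.mulLeft K (ι x * ι y - ι y * ι x) =
      LinearMap.mulLeft K (ι x) ∘ₗ LinearMap.mulLeft K (ι y) -
        LinearMap.mulLeft K (ι y) ∘ₗ LinearMap.mulLeft K (ι x) := by
    ext; simp [sub_mul, mul_assoc]
  rw [h, LinearMap.lTensor_sub, LinearMap.sub_apply]
  simp only [sub_mul, mul_assoc, map_sub, unshuffle_ι_mul, map_add, LinearMap.lTensor_tmul,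
    LinearMap.mulLeft_apply, LinearMap.lTensor_comp_apply]
  abel

lemma bracketSum_commutator (a b : List g) (x y : g) :
    bracketSum (word a * (ι x * ι y - ι y * ι x) * word b) =
      bracketSum (word a) * (ι x * ι y - ι y * ι x) * word b + 2 • (word a * ι ⁅x, y⁆ * word b) +
      word a * (ι x * ι y - ι y * ι x) * bracketSum (word b) +
      contr (derivBracket (word a * (ι x * ι y - ι y * ι x))) (unshuffle (word b)) := by
  have h1 : ∀ x y, bracketSum (word a * (ι x * ι y) * word b) =
      (bracketSum (word a) * (ι x * ι y) + word a * ι ⁅x, y⁆ +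
        (derivBracket (word a) x * ι y + derivBracket (word a) y * ι x)) * word b +
        word a * (ι x * ι y) * bracketSum (word b) +
        contr (derivBracket (word a * (ι x * ι y))) (unshuffle (word b)) := by
    intro x y
    have e : word a * (ι x * ι y) = word (a ++ [x, y]) := by simp
    have e1 : unshuffle (ι x * ι y) = x ⊗ₜ ι y + y ⊗ₜ ι x := by
      have := unshuffle_ι_mul y (1 : T)
      simp only [mul_one, unshuffle_one, map_zero, add_zero] at this
      simp [this]
    have e2 : bracketSum (ι x * ι y) = ι ⁅x, y⁆ := by
      have := bracketSum_ι_mul y (1 : T)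
      have h' := unshuffle_ι_mul y (1 : T)
      simp only [mul_one, bracketSum_one, mul_zero, unshuffle_one, map_zero, add_zero] at this h'
      simp [this, h']
    rw [e, bracketSum_word_mul, ← e, bracketSum_word_mul, e1, e2]
    simp
  have h2 : ι ⁅y, x⁆ = - ι ⁅x, y⁆ := by rw [← lie_skew, map_neg]
  rw [mul_sub, sub_mul, map_sub, h1, h1, h2]
  simp only [map_sub, LinearMap.sub_apply]
  noncomm_ring

variable (K g) in
/-- The projection of the tensor algebra onto its component of degree `n`. -/
noncomputable def degreeProj (n : ℕ) : T →ₗ[K] T :=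
  (Polynomial.lcoeff T n).restrictScalars K ∘ₗ
    (TensorAlgebra.lift K ((Polynomial.monomial 1).restrictScalars K ∘ₗ ι)).toLinearMap

lemma degreeProj_word (n : ℕ) (l : List g) :
    degreeProj K g n (word l) = if l.length = n then word l else 0 := by
  have h : TensorAlgebra.lift K ((Polynomial.monomial (R := T) 1).restrictScalars K ∘ₗ ι)
      (word l) = Polynomial.monomial l.length (word l) := by
    induction l with
    | nil => simp
    | cons x l ih => simp [ih, Polynomial.monomial_mul_monomial, add_comm]
  simp [degreeProj, h, Polynomial.coeff_monomial]

lemma unshuffle_word_ofFn {n : ℕ} (x : Fin (n + 1) → g) : unshuffle (word (List.ofFn x)) =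
    ∑ k, x k ⊗ₜ[K] word (List.ofFn fun i => x (k.succAbove i)) := by
  induction n with
  | zero =>
    have := unshuffle_ι_mul (x 0) (1 : T)
    simpa using this
  | succ n ih =>
    rw [List.ofFn_succ, word_cons, unshuffle_ι_mul, ih, map_sum,
      Fin.sum_univ_succ (n := n + 1)]
    simp [List.ofFn_succ]

section Rational

variable [Algebra ℚ K]

variable (K) in
/-- The inverse of a natural number in a `ℚ`-algebra. -/
noncomputable def invNat (n : ℕ) : K := algebraMap ℚ K (n : ℚ)⁻¹

lemma invNat_mul_cast {n : ℕ} (h : n ≠ 0) : invNat K n * n = 1 := by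
  rw [invNat, ← map_natCast (algebraMap ℚ K) n, ← map_mul, inv_mul_cancel₀ (by exact_mod_cast h),
    map_one]

lemma invNat_mul (m n : ℕ) : invNat K (m * n) = invNat K m * invNat K n := by
  rw [invNat, invNat, invNat, ← map_mul, Nat.cast_mul, mul_inv]

lemma invNat_smul_nsmul {M : Type*} [AddCommGroup M] [Module K M] {n : ℕ} (h : n ≠ 0) (t : M) :
    invNat K n • n • t = t := by
  rw [← Nat.cast_smul_eq_nsmul K, smul_smul, invNat_mul_cast h, one_smul]

/-- On words of length `n`, the symmetrization operator. -/
noncomputable def symmetrize : ℕ → T →ₗ[K] T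
  | 0 => LinearMap.id
  | n + 1 => invNat K (n + 1) • (contr ι ∘ₗ (symmetrize n).lTensor g ∘ₗ unshuffle)

/-- On words of length `n`, a lower order term with
`t ≡ symmetrize n t + correction n t` modulo the relators. -/
noncomputable def correction : ℕ → T →ₗ[K] T
  | 0 => 0
  | n + 1 => invNat K (n + 1) •
      (bracketSum + contr ι ∘ₗ (correction n).lTensor g ∘ₗ unshuffle)

lemma symmetrize_commutator (n : ℕ) (a b : List g) (x y : g) (h : a.length + b.length + 2 = n) :
    symmetrize n (word a * (ι x * ι y - ι y * ι x) * word b) = 0 := by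
  induction n generalizing a b with
  | zero => lia
  | succ n ih =>
    simp only [symmetrize, LinearMap.smul_apply, LinearMap.comp_apply, unshuffle_commutator,
      map_add, ← LinearMap.lTensor_comp_apply]
    have h1 := unshuffle_word_mem (K := K) ⊥ a (contr ι ∘ₗ (symmetrize n ∘ₗ
      LinearMap.mulRight K ((ι x * ι y - ι y * ι x) * word b)).lTensor g) (fun z l hl => by
        have := ih l b (by lia)
        simp [this])
    have h2 := unshuffle_word_mem (K := K) ⊥ b (contr ι ∘ₗ (symmetrize n ∘ₗ
      LinearMap.mulLeft K (word a * (ι x * ι y - ι y * ι x))).lTensor g) (fun z l hl => by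
        simp only [LinearMap.comp_apply, LinearMap.lTensor_tmul, contr_tmul,
          LinearMap.mulLeft_apply, ih a l (by lia), mul_zero, Submodule.zero_mem])
    rw [Submodule.mem_bot, LinearMap.comp_apply] at h1 h2
    rw [h1, h2, add_zero, smul_zero]

lemma correction_commutator (n : ℕ) (a b : List g) (x y : g) (h : a.length + b.length + 2 = n) :
    correction n (word a * (ι x * ι y - ι y * ι x) * word b) - word a * ι ⁅x, y⁆ * word b ∈
      relFilt K g (a.length + b.length + 1) := by
  induction n generalizing a b with
  | zero => lia
  | succ m ih =>
    have hm : a.length + b.length + 1 = m := by lia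
    rw [hm]
    set q := ι x * ι y - ι y * ι x with hq
    set k := ι ⁅x, y⁆ with hk
    have hqr : q = relator x y + k := by simp [relator, hq, hk]
    have h1 : (contr ι ∘ₗ (correction m ∘ₗ LinearMap.mulRight K (q * word b)).lTensor g -
        LinearMap.mulRight K (k * word b) ∘ₗ contr ι : g ⊗[K] T →ₗ[K] T) (unshuffle (word a)) ∈
          relFilt K g m := by
      refine unshuffle_word_mem _ _ _ fun z l hl => ?_
      refine relFilt_mono ?_ (ι_mul_relFilt z (ih l b (by lia))) |> Set.mem_of_eq_of_mem ?_
      · simp [mul_sub, mul_assoc]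
      · lia
    have h2 : (contr ι ∘ₗ (correction m ∘ₗ LinearMap.mulLeft K (word a * q)).lTensor g -
        contr ι ∘ₗ (LinearMap.mulLeft K (word a * k)).lTensor g : g ⊗[K] T →ₗ[K] T)
          (unshuffle (word b)) ∈ relFilt K g m := by
      refine unshuffle_word_mem _ _ _ fun z l hl => ?_
      refine relFilt_mono ?_ (ι_mul_relFilt z (ih a l (by lia))) |> Set.mem_of_eq_of_mem ?_
      · simp [mul_sub, mul_assoc]
      · lia
    have ha := word_mem_shortWords (K := K) (Nat.lt_succ_self a.length)
    have hb := word_mem_shortWords (K := K) (Nat.lt_succ_self b.length)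
    have h3 : bracketSum (word a) * relator x y * word b ∈ relFilt K g m :=
      mul_relator_mul_mem (bracketSum_word_mem a) hb _ _ (by lia)
    have h4 : word a * relator x y * bracketSum (word b) ∈ relFilt K g m :=
      mul_relator_mul_mem ha (bracketSum_word_mem b) _ _ (by lia)
    have h5 : contr (derivBracket (word a * relator x y)) (unshuffle (word b)) ∈
        relFilt K g m := by
      refine unshuffle_word_mem _ _ _ fun z l hl => ?_
      rw [contr_tmul]
      refine relFilt_mul_word l (derivBracket_mem_relFilt (m := a.length + 2) ?_ z) (by lia)
      exact Submodule.subset_span ⟨a, [], x, y, by simp, by simp⟩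
    have h6 : (bracketSum (word a) + contr ι (unshuffle (word a)) - a.length • word a) *
        (k * word b) ∈ relFilt K g m := by
      simpa [hk] using relFilt_mul_word (⁅x, y⁆ :: b) (bracketSum_add_contr_sub_mem (K := K) a)
        (n := m) (by simp; lia)
    have h7 : word a * k *
        (bracketSum (word b) + contr ι (unshuffle (word b)) - b.length • word b) ∈
          relFilt K g m := by
      simpa [hk] using word_mul_relFilt (a ++ [⁅x, y⁆]) (bracketSum_add_contr_sub_mem (K := K) b)
        (n := m) (by simp; lia)
    have h8 : (contr (derivBracket (word a * k)) +
        contr ι ∘ₗ (LinearMap.mulLeft K (word a * k)).lTensor g -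
        LinearMap.mulLeft K (word a * k) ∘ₗ contr ι : g ⊗[K] T →ₗ[K] T) (unshuffle (word b)) ∈
          relFilt K g m := by
      refine unshuffle_word_mem _ _ _ fun z l hl => ?_
      have := relFilt_mul_word l (word_mul_ι_sub_mem (K := K) (a ++ [⁅x, y⁆]) z) (n := m)
        (by simp; lia)
      convert neg_mem this using 1
      simp [hk]
      noncomm_ring
    have key : correction (m + 1) (word a * q * word b) - word a * k * word b =
        invNat K (m + 1) • (bracketSum (word a * q * word b) +
          contr ι ((correction m).lTensor g (unshuffle (word a * q * word b))) -
          (m + 1) • (word a * k * word b)) := by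
      rw [smul_sub, invNat_smul_nsmul m.add_one_ne_zero]
      simp [correction]
    rw [key]
    refine Submodule.smul_mem _ _ ?_
    rw [hq, bracketSum_commutator, unshuffle_commutator, ← hq, ← hk, ← hm]
    rw [← hm] at h1 h2 h3 h4 h5 h6 h7 h8
    convert add_mem h1 (add_mem h2 (add_mem h3 (add_mem h4 (add_mem h5 (add_mem h6
      (add_mem h7 h8)))))) using 1
    simp only [hqr, map_add, ← LinearMap.lTensor_comp_apply, LinearMap.sub_apply,
      LinearMap.add_apply, LinearMap.comp_apply, LinearMap.mulLeft_apply,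
      LinearMap.mulRight_apply, mul_add, add_mul, mul_sub, sub_mul, ← mul_assoc, add_smul,
      smul_mul_assoc, mul_smul_comm]
    abel

lemma word_sub_symmetrize_sub_correction_mem (l : List g) (n : ℕ) (h : l.length = n) :
    word l - symmetrize n (word l) - correction n (word l) ∈ relFilt K g n := by
  induction n generalizing l with
  | zero => simp [symmetrize, correction]
  | succ n ih =>
    have h1 : (contr ι ∘ₗ (LinearMap.id - symmetrize n - correction n).lTensor g :
        g ⊗[K] T →ₗ[K] T) (unshuffle (word l)) ∈ relFilt K g (n + 1) := by
      refine unshuffle_word_mem _ _ _ fun z l' hl => ?_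
      simpa [mul_sub] using ι_mul_relFilt z (ih l' (by lia))
    have h2 := bracketSum_add_contr_sub_mem (K := K) l
    rw [h] at h2
    convert Submodule.smul_mem _ (invNat K (n + 1)) (sub_mem h1 h2) using 1
    have h3 := invNat_smul_nsmul (K := K) (n.add_one_ne_zero) (word (K := K) l)
    simp only [LinearMap.lTensor_sub, LinearMap.comp_apply, LinearMap.sub_apply, map_sub,
      LinearMap.lTensor_id, LinearMap.id_apply, smul_sub, smul_add, h3, symmetrize, correction,
      LinearMap.smul_apply, LinearMap.add_apply]
    abel

lemma correction_word_mem (l : List g) (n : ℕ) (h : l.length = n) :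
    correction n (word l) ∈ shortWords K g n := by
  induction n generalizing l with
  | zero => simp [correction]
  | succ n ih =>
    refine Submodule.smul_mem _ _ (add_mem (h ▸ bracketSum_word_mem l) ?_)
    refine unshuffle_word_mem _ l (contr ι ∘ₗ (correction n).lTensor g) fun z l' hl => ?_
    simpa using ι_mul_shortWords z (ih l' (by lia))

lemma symmetrize_word {n : ℕ} (x : Fin n → g) : symmetrize n (word (K := K) (List.ofFn x)) =
    invNat K n.factorial • ∑ σ : Equiv.Perm (Fin n), word (List.ofFn fun i => x (σ i)) := by
  induction n with
  | zero => simp [symmetrize, invNat]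
  | succ n ih =>
    have h1 : ∀ k : Fin (n + 1), ∑ τ : Equiv.Perm (Fin n),
        word (K := K) (List.ofFn fun i => x (k.succAbove (τ i))) =
          ∑ τ : Equiv.Perm (Fin n), word (List.ofFn fun i => x (Equiv.swap 0 k (τ i).succ)) := by
      intro k
      induction k using Fin.cases with
      | zero => simp
      | succ k =>
        refine (Fintype.sum_equiv (Equiv.mulLeft k.cycleRange) _ _ fun τ => ?_).symm
        simp [← Fin.succAbove_cycleRange]
    have h2 : ∑ σ : Equiv.Perm (Fin (n + 1)), word (K := K) (List.ofFn fun i => x (σ i)) =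
        ∑ k : Fin (n + 1), ∑ τ : Equiv.Perm (Fin n),
          ι (x k) * word (List.ofFn fun i => x (Equiv.swap 0 k (τ i).succ)) := by
      rw [← Fintype.sum_prod_type']
      refine Fintype.sum_equiv Equiv.Perm.decomposeFin _ _ fun σ => ?_
      obtain ⟨⟨k, τ⟩, rfl⟩ := Equiv.Perm.decomposeFin.symm.surjective σ
      simp [List.ofFn_succ]
    simp only [symmetrize, LinearMap.smul_apply, LinearMap.comp_apply, unshuffle_word_ofFn,
      map_sum, LinearMap.lTensor_tmul, contr_tmul]
    rw [h2, Nat.factorial_succ, invNat_mul, mul_smul, Finset.smul_sum (r := invNat K n.factorial)]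
    congr 1
    refine Finset.sum_congr rfl fun k _ => ?_
    rw [ih fun i => x (k.succAbove i), h1, mul_smul_comm, Finset.mul_sum]

lemma symmetrize_symmetrize_word {n : ℕ} (x : Fin n → g) :
    symmetrize n (symmetrize n (word (K := K) (List.ofFn x))) =
      symmetrize n (word (List.ofFn x)) := by
  rw [symmetrize_word x, map_smul, map_sum]
  congr 1
  have h : ∀ σ : Equiv.Perm (Fin n), symmetrize n (word (K := K) (List.ofFn fun i => x (σ i))) =
      invNat K n.factorial • ∑ τ : Equiv.Perm (Fin n), word (List.ofFn fun i => x (τ i)) := by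
    intro σ
    rw [symmetrize_word]
    congr 1
    exact Fintype.sum_equiv (Equiv.mulLeft σ) _ _ fun τ => by simp
  simp only [h]
  rw [Finset.sum_const, Finset.card_univ, Fintype.card_perm, Fintype.card_fin, smul_comm,
    invNat_smul_nsmul (Nat.factorial_ne_zero n)]

lemma symmetrize_degreeProj_of_mem (m : ℕ) {t : T} (ht : t ∈ symTensors K g) :
    symmetrize m (degreeProj K g m t) = degreeProj K g m t := by
  induction ht using Submodule.span_induction with
  | mem t ht =>
    obtain ⟨n, x, rfl⟩ := ht
    change symmetrize m (degreeProj K g m (invNat K n.factorial • ∑ σ : Equiv.Perm (Fin n),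
      (List.ofFn fun i => ι (x (σ i))).prod)) = degreeProj K g m (invNat K n.factorial •
        ∑ σ : Equiv.Perm (Fin n), (List.ofFn fun i => ι (x (σ i))).prod)
    have h : ∀ σ : Equiv.Perm (Fin n), (List.ofFn fun i => ι (x (σ i))).prod =
      word (List.ofFn fun i => x (σ i)) := fun σ => by simp [word, List.map_ofFn]; rfl
    simp only [h]
    rcases eq_or_ne n m with rfl | hne
    · have e : degreeProj K g n (invNat K n.factorial •
          ∑ σ : Equiv.Perm (Fin n), word (List.ofFn fun i => x (σ i))) =
          symmetrize n (word (List.ofFn x)) := by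
        simp [symmetrize_word, degreeProj_word]
      rw [e, symmetrize_symmetrize_word]
    · simp [degreeProj_word, hne]
  | zero => simp
  | add a b _ _ ha hb => simp only [map_add, ha, hb]
  | smul c a _ ha => simp only [map_smul, ha]

lemma symmetrize_word_mem (l : List g) : symmetrize l.length (word l) ∈ symTensors K g := by
  have h := symmetrize_word (K := K) l.get
  rw [List.ofFn_get] at h
  rw [h]
  refine Submodule.subset_span ⟨l.length, l.get, ?_⟩
  simp [word, List.map_ofFn, invNat]
  rfl

lemma leading_term_of_mem_relFilt (n : ℕ) {t : T} (ht : t ∈ relFilt K g (n + 1)) :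
    symmetrize (n + 1) (degreeProj K g (n + 1) t) = 0 ∧
      t - degreeProj K g (n + 1) t + correction (n + 1) (degreeProj K g (n + 1) t) ∈
        relFilt K g n := by
  induction ht using Submodule.span_induction with
  | mem t ht =>
    obtain ⟨u, v, x, y, hl, rfl⟩ := ht
    have e : word u * relator x y * word v = word (u ++ [x, y] ++ v) - word (u ++ [y, x] ++ v) -
        word (K := K) (u ++ [⁅x, y⁆] ++ v) := by
      simp only [word_append, word_cons, word_nil, relator]
      noncomm_ring
    have e' : word u * (ι x * ι y - ι y * ι x) * word v =
        word (u ++ [x, y] ++ v) - word (K := K) (u ++ [y, x] ++ v) := by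
      simp only [word_append, word_cons, word_nil]
      noncomm_ring
    rcases hl.eq_or_lt with heq | hlt
    · have hp : degreeProj K g (n + 1) (word u * relator x y * word v) =
          word u * (ι x * ι y - ι y * ι x) * word v := by
        rw [e, e', map_sub, map_sub, degreeProj_word, degreeProj_word, degreeProj_word,
          if_pos (by simp; lia), if_pos (by simp; lia), if_neg (by simp; lia), sub_zero]
      rw [hp]
      refine ⟨symmetrize_commutator _ _ _ _ _ heq, ?_⟩
      have h := correction_commutator (K := K) _ u v x y heq
      rw [show u.length + v.length + 1 = n by lia] at h
      convert h using 1
      simp only [relator]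
      noncomm_ring
    · have hp : degreeProj K g (n + 1) (word u * relator x y * word v) = 0 := by
        rw [e, map_sub, map_sub, degreeProj_word, degreeProj_word, degreeProj_word,
          if_neg (by simp; lia), if_neg (by simp; lia), if_neg (by simp; lia), sub_zero, sub_zero]
      rw [hp]
      have h : word u * relator x y * word v ∈ relFilt K g n :=
        Submodule.subset_span ⟨u, v, x, y, by lia, rfl⟩
      simpa using h
  | zero => simp
  | add a b _ _ ha hb =>
    refine ⟨by simp only [map_add, ha.1, hb.1, add_zero], ?_⟩
    convert add_mem ha.2 hb.2 using 1
    simp only [map_add]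
    abel
  | smul c a _ ha =>
    refine ⟨by simp only [map_smul, ha.1, smul_zero], ?_⟩
    convert Submodule.smul_mem _ c ha.2 using 1
    simp only [map_smul, smul_add, smul_sub]

lemma eq_zero_of_mem_symTensors_of_mem_relFilt (n : ℕ) {t : T} (hs : t ∈ symTensors K g)
    (ht : t ∈ relFilt K g n) : t = 0 := by
  induction n with
  | zero =>
    rw [relFilt, Submodule.mem_span] at ht
    exact ht ⊥ fun z ⟨_, _, _, _, h, _⟩ => by lia
  | succ n ih =>
    obtain ⟨h1, h2⟩ := leading_term_of_mem_relFilt n ht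
    rw [symmetrize_degreeProj_of_mem _ hs] at h1
    refine ih ?_
    simpa [h1] using h2

end Rational

variable (K g) in
/-- The left ideal `⋃ₘ relFilt K g m` of the tensor algebra, as a submodule over it. -/
noncomputable def relIdeal : Submodule T T where
  carrier := {t | ∃ m, t ∈ relFilt K g m}
  add_mem' := by
    rintro a b ⟨m, ha⟩ ⟨n, hb⟩
    exact ⟨max m n, add_mem (relFilt_mono (le_max_left m n) ha)
      (relFilt_mono (le_max_right m n) hb)⟩
  zero_mem' := ⟨0, zero_mem _⟩
  smul_mem' := by
    rintro c t ⟨m, ht⟩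
    have hc : c ∈ Submodule.span K (Set.range (word (K := K) (g := g))) := by
      simp [span_word_eq_top]
    induction hc using Submodule.span_induction with
    | mem c hc =>
      obtain ⟨l, rfl⟩ := hc
      exact ⟨l.length + m, word_mul_relFilt l ht le_rfl⟩
    | zero => exact ⟨0, by simp⟩
    | add a b _ _ ha hb =>
      obtain ⟨p, hp⟩ := ha
      obtain ⟨q, hq⟩ := hb
      refine ⟨max p q, ?_⟩
      rw [add_smul]
      exact add_mem (relFilt_mono (le_max_left p q) hp) (relFilt_mono (le_max_right p q) hq)
    | smul r a _ ha =>
      obtain ⟨p, hp⟩ := ha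
      exact ⟨p, by rw [smul_assoc]; exact Submodule.smul_mem _ _ hp⟩

lemma relator_mul_mem_relIdeal (x y : g) (t : T) : relator x y * t ∈ relIdeal K g := by
  have ht : t ∈ Submodule.span K (Set.range (word (K := K) (g := g))) := by
    simp [span_word_eq_top]
  induction ht using Submodule.span_induction with
  | mem t ht =>
    obtain ⟨l, rfl⟩ := ht
    exact ⟨_, relator_mul_word_mem x y l le_rfl⟩
  | zero => simp
  | add a b _ _ ha hb => rw [mul_add]; exact add_mem ha hb
  | smul r a _ ha =>
    obtain ⟨p, hp⟩ := ha
    exact ⟨p, by rw [mul_smul_comm]; exact Submodule.smul_mem _ _ hp⟩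

attribute [local instance] LieRing.ofAssociativeRing

lemma mem_relFilt_of_mkAlgHom_eq_zero {t : T}
    (ht : UniversalEnvelopingAlgebra.mkAlgHom K g t = 0) : ∃ m, t ∈ relFilt K g m := by
  let ρ : T →ₐ[K] Module.End K (T ⧸ relIdeal K g) := Algebra.lsmul K K (T ⧸ relIdeal K g)
  let f : g →ₗ⁅K⁆ Module.End K (T ⧸ relIdeal K g) :=
    { ρ.toLinearMap ∘ₗ ι with
      map_lie' := by
        intro x y
        refine LinearMap.ext fun z => ?_
        obtain ⟨z, rfl⟩ := Submodule.Quotient.mk_surjective _ z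
        refine ((Submodule.Quotient.eq _).2 ?_).symm
        have h := relator_mul_mem_relIdeal (K := K) x y z
        simpa [relator, sub_mul, mul_assoc] using h }
  have h : (UniversalEnvelopingAlgebra.lift K f).comp (UniversalEnvelopingAlgebra.mkAlgHom K g) =
      ρ := by
    ext1
    ext1 x
    exact UniversalEnvelopingAlgebra.lift_ι_apply' K f x
  have h' : ρ t = 0 := by rw [← h, AlgHom.comp_apply, ht, map_zero]
  have h1 : Submodule.Quotient.mk (p := relIdeal K g) (t • (1 : T)) = 0 :=
    LinearMap.congr_fun h' (Submodule.Quotient.mk 1)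
  rw [Submodule.Quotient.mk_eq_zero, smul_eq_mul, mul_one] at h1
  exact h1

lemma mkAlgHom_relator (x y : g) :
    UniversalEnvelopingAlgebra.mkAlgHom K g (relator x y) = 0 := by
  have h := (UniversalEnvelopingAlgebra.ι K).map_lie x y
  simp only [UniversalEnvelopingAlgebra.ι_apply, LieRing.of_associative_ring_bracket] at h
  rw [relator, map_sub, map_sub, map_mul, map_mul, h, sub_self]

lemma mkAlgHom_eq_zero_of_mem_relFilt {m : ℕ} {t : T} (ht : t ∈ relFilt K g m) :
    UniversalEnvelopingAlgebra.mkAlgHom K g t = 0 := by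
  induction ht using Submodule.span_induction with
  | mem t ht =>
    obtain ⟨u, v, x, y, -, rfl⟩ := ht
    simp [mkAlgHom_relator]
  | zero => simp
  | add a b _ _ ha hb => rw [map_add, ha, hb, add_zero]
  | smul r a _ ha => rw [map_smul, ha, smul_zero]

lemma exists_symTensors_mkAlgHom_eq [Algebra ℚ K] (t : T) : ∃ s ∈ symTensors K g,
    UniversalEnvelopingAlgebra.mkAlgHom K g s = UniversalEnvelopingAlgebra.mkAlgHom K g t := by
  set m := UniversalEnvelopingAlgebra.mkAlgHom K g with hm
  suffices h : ∀ n, ∀ t ∈ shortWords K g n, m t ∈ (symTensors K g).map m.toLinearMap by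
    have ht : t ∈ Submodule.span K (Set.range (word (K := K) (g := g))) := by
      simp [span_word_eq_top]
    change m t ∈ (symTensors K g).map m.toLinearMap
    induction ht using Submodule.span_induction with
    | mem t ht =>
      obtain ⟨l, rfl⟩ := ht
      exact h _ _ (word_mem_shortWords (Nat.lt_succ_self l.length))
    | zero => simp
    | add a b _ _ ha hb => rw [map_add]; exact add_mem ha hb
    | smul r a _ ha => rw [map_smul]; exact Submodule.smul_mem _ _ ha
  intro n
  induction n using Nat.strong_induction_on with
  | _ n ih =>
  intro t ht
  induction ht using Submodule.span_induction with
  | mem t ht =>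
    obtain ⟨l, hl, rfl⟩ := ht
    have h := mkAlgHom_eq_zero_of_mem_relFilt
      (word_sub_symmetrize_sub_correction_mem (K := K) l _ rfl)
    rw [map_sub, map_sub, sub_sub, sub_eq_zero] at h
    rw [hm, h]
    exact add_mem (Submodule.mem_map_of_mem (f := m.toLinearMap) (symmetrize_word_mem l))
      (ih _ hl _ (correction_word_mem l _ rfl))
  | zero => simp
  | add a b _ _ ha hb => rw [map_add]; exact add_mem ha hb
  | smul r a _ ha => rw [map_smul]; exact Submodule.smul_mem _ _ ha

lemma mkAlgHom_surjective :
    Function.Surjective (UniversalEnvelopingAlgebra.mkAlgHom K g) := by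
  exact Quotient.mk_surjective

end Operators

end SymmetricPBW

/-- The symmetric global Poincaré–Birkhoff–Witt theorem: over a `ℚ`-algebra `K`, the
restriction of the canonical map `m : T(g) → U(g)` to the submodule of symmetric tensors
is bijective. -/
theorem symmetric_global_pbw (K : Type*) [CommRing K] [Algebra ℚ K]
    (g : Type*) [LieRing g] [LieAlgebra K g] :
    Function.Bijective (fun p : symTensors K g =>
      UniversalEnvelopingAlgebra.mkAlgHom K g (p : TensorAlgebra K g)) := by
  constructor
  · intro p q h
    have h' : UniversalEnvelopingAlgebra.mkAlgHom K g ((p - q : symTensors K g) :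
        TensorAlgebra K g) = 0 := by
      rw [Submodule.coe_sub, map_sub, sub_eq_zero]
      exact h
    obtain ⟨n, hn⟩ := SymmetricPBW.mem_relFilt_of_mkAlgHom_eq_zero h'
    have h0 := SymmetricPBW.eq_zero_of_mem_symTensors_of_mem_relFilt n (p - q).2 hn
    exact sub_eq_zero.1 (Subtype.ext h0)
  · intro u
    obtain ⟨t, rfl⟩ := SymmetricPBW.mkAlgHom_surjective u
    obtain ⟨s, hs, h⟩ := SymmetricPBW.exists_symTensors_mkAlgHom_eq t
    exact ⟨⟨s, hs⟩, h⟩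
end

section
/- Let K be a commutative ring that is a ℚ-algebra and let g be a Lie algebra over K. Inside the tensor algebra T(g), the submodule of symmetric tensors T_Σ(g) and the underlying K-submodule of the ideal J(g) are complementary: T_Σ(g) ∩ J(g) = 0 and T_Σ(g) + J(g) = T(g). -/
/-- The underlying `K`-submodule of the two-sided ideal `J(g)` of `T(g)` generated by the
elements `ι(x)ι(y) − ι(y)ι(x) − ι(⁅x,y⁆)`. -/
noncomputable def envIdeal (K : Type*) [CommRing K]
    (g : Type*) [LieRing g] [LieAlgebra K g] : Submodule K (TensorAlgebra K g) :=
  Submodule.span K {z | ∃ (a b : TensorAlgebra K g) (x y : g),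
    z = a * (TensorAlgebra.ι K x * TensorAlgebra.ι K y
          - TensorAlgebra.ι K y * TensorAlgebra.ι K x
          - TensorAlgebra.ι K ⁅x, y⁆) * b}

namespace SymmetricAlgebra

section Contraction

variable {K : Type*} [CommRing K] {V : Type*} [AddCommGroup V] [Module K V]

/-- Induction on an element of the symmetric algebra by left multiplication by vectors. -/
theorem left_induction {motive : SymmetricAlgebra K V → Prop} (one : motive 1)
    (smul : ∀ (r : K) s, motive s → motive (r • s))
    (add : ∀ s t, motive s → motive t → motive (s + t))
    (ι_mul : ∀ x s, motive s → motive (ι K V x * s)) (s : SymmetricAlgebra K V) : motive s := by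
  suffices h : ∀ t, motive t → motive (s * t) by simpa using h 1 one
  induction s using SymmetricAlgebra.induction with
  | algebraMap r => intro t ht; simpa [Algebra.smul_def] using smul r t ht
  | ι x => exact fun t ht => ι_mul x t ht
  | mul a b ha hb => intro t ht; rw [mul_assoc]; exact ha _ (hb _ ht)
  | add a b ha hb => intro t ht; rw [add_mul]; exact add _ _ (ha _ ht) (hb _ ht)

variable (K V) in
/-- The algebra map `S(V) → S(V)[t]` sending a vector `x` to `x t`. -/
noncomputable def gradingHom : SymmetricAlgebra K V →ₐ[K] Polynomial (SymmetricAlgebra K V) :=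
  lift ((LinearMap.mulLeft K Polynomial.X).comp
    ((Algebra.linearMap (SymmetricAlgebra K V)
      (Polynomial (SymmetricAlgebra K V))).restrictScalars K ∘ₗ ι K V))

@[simp]
theorem gradingHom_ι (x : V) :
    gradingHom K V (ι K V x) = Polynomial.X * Polynomial.C (ι K V x) := by
  simp [gradingHom]

variable (K V) in
/-- The projection of the symmetric algebra onto its part of degree `n`. -/
noncomputable def proj (n : ℕ) : SymmetricAlgebra K V →ₗ[K] SymmetricAlgebra K V :=
  ((Polynomial.lcoeff (SymmetricAlgebra K V) n).restrictScalars K).comp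
    (gradingHom K V).toLinearMap

theorem proj_apply (n : ℕ) (s : SymmetricAlgebra K V) :
    proj K V n s = (gradingHom K V s).coeff n := rfl

theorem proj_one (n : ℕ) : proj K V n 1 = if n = 0 then 1 else 0 := by
  simp [proj_apply, Polynomial.coeff_one]

@[simp]
theorem proj_zero_ι_mul (x : V) (s : SymmetricAlgebra K V) : proj K V 0 (ι K V x * s) = 0 := by
  simp [proj_apply, mul_assoc]

@[simp]
theorem proj_succ_ι_mul (n : ℕ) (x : V) (s : SymmetricAlgebra K V) :
    proj K V (n + 1) (ι K V x * s) = ι K V x * proj K V n s := by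
  simp [proj_apply, mul_assoc]

theorem proj_proj (m n : ℕ) (s : SymmetricAlgebra K V) :
    proj K V m (proj K V n s) = if m = n then proj K V n s else 0 := by
  induction s using left_induction generalizing m n with
  | one => by_cases hn : n = 0 <;> simp_all [proj_one]
  | smul r s h => by_cases hmn : m = n <;> simp_all
  | add s t hs ht => by_cases hmn : m = n <;> simp_all
  | ι_mul x s h => cases m <;> cases n <;> simp_all

theorem proj_ι_pow (y : V) (m n : ℕ) :
    proj K V m (ι K V y ^ n) = if m = n then ι K V y ^ n else 0 := by
  induction n generalizing m with
  | zero => simp [proj_one]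
  | succ n ih => cases m <;> simp_all [pow_succ']

variable (K V) in
/-- The elements of the symmetric algebra of degree at most `n`. -/
noncomputable def degreeLE (n : ℕ) : Submodule K (SymmetricAlgebra K V) where
  carrier := {s | ∀ j, n < j → proj K V j s = 0}
  add_mem' hs ht j hj := by simp [hs j hj, ht j hj]
  zero_mem' j _ := by simp
  smul_mem' r s hs j hj := by simp [hs j hj]

theorem degreeLE_mono {m n : ℕ} (h : m ≤ n) : degreeLE K V m ≤ degreeLE K V n :=
  fun _ hs j hj => hs j (h.trans_lt hj)

theorem proj_mem_degreeLE (n : ℕ) (s : SymmetricAlgebra K V) : proj K V n s ∈ degreeLE K V n :=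
  fun j hj => by rw [proj_proj, if_neg hj.ne']

theorem one_mem_degreeLE (n : ℕ) : (1 : SymmetricAlgebra K V) ∈ degreeLE K V n :=
  fun j hj => by rw [proj_one, if_neg (by lia)]

theorem ι_mul_mem_degreeLE (x : V) {n : ℕ} {s : SymmetricAlgebra K V} (hs : s ∈ degreeLE K V n) :
    ι K V x * s ∈ degreeLE K V (n + 1) := by
  rintro (_ | j) hj
  · simp
  · rw [proj_succ_ι_mul, hs j (by lia), mul_zero]

theorem sum_proj_of_mem_degreeLE {n : ℕ} {s : SymmetricAlgebra K V} (hs : s ∈ degreeLE K V n) :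
    ∑ j ∈ Finset.range (n + 1), proj K V j s = s := by
  have hdeg : (gradingHom K V s).natDegree < n + 1 :=
    Nat.lt_succ_of_le (Polynomial.natDegree_le_iff_coeff_eq_zero.2 fun j hj => hs j hj)
  have heval : ∀ s, (gradingHom K V s).eval 1 = s := by
    intro s
    induction s using left_induction with
    | one => simp
    | smul r s h => simp [h]
    | add s t hs ht => simp [hs, ht]
    | ι_mul x s h => simp [h]
  conv_rhs => rw [← heval s, Polynomial.eval_eq_sum_range' hdeg]
  simp [proj_apply]

open TensorProduct

/-- The opposite action, through which `TrivSqZeroExt K V` is a commutative algebra. -/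
local instance oppositeModule : Module Kᵐᵒᵖ V :=
  Module.compHom V ((RingHom.id K).fromOpposite fun x y => mul_comm x y)

local instance oppositeIsCentralScalar : IsCentralScalar K V := ⟨fun _ _ => rfl⟩

variable (K V) in
/-- The algebra map `S(V) → S(V) ⊗ (K ⊕ V)` sending `x` to `x ⊗ 1 + 1 ⊗ x`. -/
noncomputable def polarHom : SymmetricAlgebra K V →ₐ[K]
    SymmetricAlgebra K V ⊗[K] TrivSqZeroExt K V :=
  lift ((Algebra.TensorProduct.includeLeft (R := K) (S := K) (A := SymmetricAlgebra K V)
      (B := TrivSqZeroExt K V)).toLinearMap ∘ₗ ι K V +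
    (Algebra.TensorProduct.includeRight (R := K) (A := SymmetricAlgebra K V)
      (B := TrivSqZeroExt K V)).toLinearMap ∘ₗ TrivSqZeroExt.inrHom K V)

theorem polarHom_ι (x : V) : polarHom K V (ι K V x) =
    ι K V x ⊗ₜ 1 + 1 ⊗ₜ TrivSqZeroExt.inr x := by
  simp [polarHom]

theorem rid_fst_polarHom (s : SymmetricAlgebra K V) :
    TensorProduct.rid K _ ((TrivSqZeroExt.fstHom K K V).toLinearMap.lTensor _
      (polarHom K V s)) = s := by
  have h : ((Algebra.TensorProduct.rid K K (SymmetricAlgebra K V)).toAlgHom.comp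
      (Algebra.TensorProduct.map (AlgHom.id K _) (TrivSqZeroExt.fstHom K K V))).comp
      (polarHom K V) = AlgHom.id K _ := by
    ext x
    simp [polarHom_ι]
  exact DFunLike.congr_fun h s

variable (K V) in
/-- The derivation `S(V) → S(V) ⊗ V` sending `x` to `1 ⊗ x`, as a linear map. -/
noncomputable def polarMap : SymmetricAlgebra K V →ₗ[K] SymmetricAlgebra K V ⊗[K] V :=
  (TrivSqZeroExt.sndHom K V).lTensor _ ∘ₗ (polarHom K V).toLinearMap

theorem polarMap_one : polarMap K V 1 = 0 := by
  simp [polarMap, Algebra.TensorProduct.one_def]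

theorem polarMap_ι_mul (x : V) (s : SymmetricAlgebra K V) :
    polarMap K V (ι K V x * s) =
      s ⊗ₜ x + (LinearMap.mulLeft K (ι K V x)).rTensor V (polarMap K V s) := by
  have h₁ : ∀ w : SymmetricAlgebra K V ⊗[K] TrivSqZeroExt K V,
      (TrivSqZeroExt.sndHom K V).lTensor _ ((ι K V x ⊗ₜ 1) * w) =
        (LinearMap.mulLeft K (ι K V x)).rTensor V
          ((TrivSqZeroExt.sndHom K V).lTensor _ w) := by
    intro w
    induction w with
    | zero => simp
    | tmul a b => simp
    | add a b ha hb => simp [mul_add, ha, hb]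
  have h₂ : ∀ w : SymmetricAlgebra K V ⊗[K] TrivSqZeroExt K V,
      (TrivSqZeroExt.sndHom K V).lTensor _ ((1 ⊗ₜ TrivSqZeroExt.inr x) * w) =
        TensorProduct.rid K _ ((TrivSqZeroExt.fstHom K K V).toLinearMap.lTensor _ w) ⊗ₜ x := by
    intro w
    induction w with
    | zero => simp
    | tmul a b => simp [TensorProduct.smul_tmul]
    | add a b ha hb => simp [mul_add, ha, hb, TensorProduct.add_tmul]
  simp only [polarMap, LinearMap.comp_apply, AlgHom.toLinearMap_apply, map_mul, polarHom_ι,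
    add_mul, map_add, h₁, h₂, rid_fst_polarHom]
  rw [add_comm]

variable {M : Type*} [AddCommGroup M] [Module K M]

/-- The linear map `S(V) → M` sending `x₁ ⋯ xₙ` to `∑ i, β xᵢ (∏ j ≠ i, xⱼ)`. -/
noncomputable def contract (β : V →ₗ[K] SymmetricAlgebra K V →ₗ[K] M) :
    SymmetricAlgebra K V →ₗ[K] M :=
  TensorProduct.lift β.flip ∘ₗ polarMap K V

@[simp]
theorem contract_one (β : V →ₗ[K] SymmetricAlgebra K V →ₗ[K] M) : contract β 1 = 0 := by
  simp [contract, polarMap_one]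

theorem contract_ι_mul (β : V →ₗ[K] SymmetricAlgebra K V →ₗ[K] M) (x : V)
    (s : SymmetricAlgebra K V) : contract β (ι K V x * s) =
      β x s + contract (β.compl₂ (LinearMap.mulLeft K (ι K V x))) s := by
  have h : ∀ w : SymmetricAlgebra K V ⊗[K] V, TensorProduct.lift β.flip
      ((LinearMap.mulLeft K (ι K V x)).rTensor V w) =
      TensorProduct.lift (β.compl₂ (LinearMap.mulLeft K (ι K V x))).flip w := by
    intro w
    induction w with
    | zero => simp
    | tmul a b => simp
    | add a b ha hb => simp [ha, hb]
  simp [contract, polarMap_ι_mul, h]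

theorem contract_add (β γ : V →ₗ[K] SymmetricAlgebra K V →ₗ[K] M) (s : SymmetricAlgebra K V) :
    contract (β + γ) s = contract β s + contract γ s := by
  induction s using left_induction generalizing β γ with
  | one => simp
  | smul r s h => simp [h]
  | add s t hs ht => simp only [map_add, hs, ht]; abel
  | ι_mul x s h =>
    simp only [contract_ι_mul, LinearMap.add_apply]
    rw [show (β + γ).compl₂ (LinearMap.mulLeft K (ι K V x)) =
      β.compl₂ (LinearMap.mulLeft K (ι K V x)) + γ.compl₂ (LinearMap.mulLeft K (ι K V x)) from rfl,
      h]
    abel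

theorem contract_smul (r : K) (β : V →ₗ[K] SymmetricAlgebra K V →ₗ[K] M)
    (s : SymmetricAlgebra K V) : contract (r • β) s = r • contract β s := by
  induction s using left_induction generalizing β with
  | one => simp
  | smul q s h => rw [map_smul, map_smul, h, smul_comm]
  | add s t hs ht => simp only [map_add, hs, ht, smul_add]
  | ι_mul x s h =>
    simp only [contract_ι_mul, LinearMap.smul_apply, smul_add]
    rw [show (r • β).compl₂ (LinearMap.mulLeft K (ι K V x)) =
      r • β.compl₂ (LinearMap.mulLeft K (ι K V x)) from rfl, h]

@[simp]
theorem contract_zero (s : SymmetricAlgebra K V) :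
    contract (0 : V →ₗ[K] SymmetricAlgebra K V →ₗ[K] M) s = 0 := by
  rw [← zero_smul K (0 : V →ₗ[K] SymmetricAlgebra K V →ₗ[K] M), contract_smul, zero_smul]

theorem contract_mem (β : V →ₗ[K] SymmetricAlgebra K V →ₗ[K] M) (N : Submodule K M)
    (h : ∀ x t, β x t ∈ N) (s : SymmetricAlgebra K V) : contract β s ∈ N := by
  induction s using left_induction generalizing β with
  | one => simp
  | smul r s hs => rw [map_smul]; exact N.smul_mem _ (hs β h)
  | add s t hs ht => rw [map_add]; exact N.add_mem (hs β h) (ht β h)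
  | ι_mul x s hs =>
    rw [contract_ι_mul]
    exact N.add_mem (h _ _) (hs _ fun y t => h y _)

theorem contract_proj_zero (β : V →ₗ[K] SymmetricAlgebra K V →ₗ[K] M)
    (s : SymmetricAlgebra K V) : contract β (proj K V 0 s) = 0 := by
  induction s using left_induction with
  | one => simp [proj_one]
  | smul r s h => simp [h]
  | add s t hs ht => simp [hs, ht]
  | ι_mul x s h => simp

theorem contract_proj_succ (β : V →ₗ[K] SymmetricAlgebra K V →ₗ[K] M) (m : ℕ)
    (s : SymmetricAlgebra K V) :
    contract β (proj K V (m + 1) s) = contract (β.compl₂ (proj K V m)) s := by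
  induction s using left_induction generalizing β m with
  | one => simp [proj_one]
  | smul r s h => simp [h]
  | add s t hs ht => simp [hs, ht]
  | ι_mul x s h =>
    rw [proj_succ_ι_mul, contract_ι_mul, contract_ι_mul, LinearMap.compl₂_apply]
    congr 1
    cases m with
    | zero =>
      rw [contract_proj_zero, show (β.compl₂ (proj K V 0)).compl₂
        (LinearMap.mulLeft K (ι K V x)) = 0 by ext; simp,
        contract_zero]
    | succ m =>
      rw [h]
      congr 2
      refine LinearMap.ext fun y => LinearMap.ext fun t => ?_
      simp

/-- Euler's identity: a homogeneous element of degree `m` is an eigenvector of contraction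
with multiplication. -/
theorem contract_proj_of_mul (f : SymmetricAlgebra K V →ₗ[K] M)
    (β : V →ₗ[K] SymmetricAlgebra K V →ₗ[K] M) (hβ : ∀ x t, β x t = f (ι K V x * t)) (m : ℕ)
    (s : SymmetricAlgebra K V) : contract β (proj K V m s) = m • f (proj K V m s) := by
  induction s using left_induction generalizing f β m with
  | one => cases m <;> simp [proj_one]
  | smul r s h => rw [map_smul, map_smul, map_smul, h f β hβ, smul_comm]
  | add s t hs ht => simp [hs f β hβ, ht f β hβ]
  | ι_mul x s h =>
    cases m with
    | zero => simp
    | succ m =>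
      rw [proj_succ_ι_mul, contract_ι_mul, hβ,
        h (f ∘ₗ LinearMap.mulLeft K (ι K V x)) _ fun y t => by simp [hβ, mul_left_comm],
        add_smul, one_smul, add_comm]
      rfl

theorem contract_ι_pow_succ (β : V →ₗ[K] SymmetricAlgebra K V →ₗ[K] M) (y : V) (n : ℕ) :
    contract β (ι K V y ^ (n + 1)) = (n + 1) • β y (ι K V y ^ n) := by
  induction n generalizing β with
  | zero => simpa using contract_ι_mul β y 1
  | succ n ih =>
    rw [pow_succ', contract_ι_mul, ih, LinearMap.compl₂_apply, LinearMap.mulLeft_apply,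
      ← pow_succ', add_smul (n + 1), one_smul, add_comm]

end Contraction

section ApproxAction

variable {K : Type*} [CommRing K] {g : Type*} [LieRing g] [LieAlgebra K g]

/-- The failure of a linear map `ρ : g → End S(g)` to be a representation. -/
noncomputable def lieDefect (ρ : g →ₗ[K] Module.End K (SymmetricAlgebra K g)) :
    g →ₗ[K] g →ₗ[K] SymmetricAlgebra K g →ₗ[K] SymmetricAlgebra K g :=
  LinearMap.mk₂ K (fun a b => ρ a * ρ b - ρ b * ρ a - ρ ⁅a, b⁆)
    (fun a₁ a₂ b => by simp only [map_add, add_lie, add_mul, mul_add]; abel)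
    (fun r a b => by
      simp only [map_smul, smul_lie, smul_mul_assoc, mul_smul_comm, smul_sub])
    (fun a b₁ b₂ => by simp only [map_add, lie_add, add_mul, mul_add]; abel)
    (fun r a b => by
      simp only [map_smul, lie_smul, smul_mul_assoc, mul_smul_comm, smul_sub])

theorem lieDefect_apply (ρ : g →ₗ[K] Module.End K (SymmetricAlgebra K g)) (a b : g)
    (s : SymmetricAlgebra K g) :
    lieDefect ρ a b s = ρ a (ρ b s) - ρ b (ρ a s) - ρ ⁅a, b⁆ s := rfl

theorem lieDefect_swap (ρ : g →ₗ[K] Module.End K (SymmetricAlgebra K g)) (a b : g)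
    (s : SymmetricAlgebra K g) : lieDefect ρ b a s = -lieDefect ρ a b s := by
  rw [lieDefect_apply, lieDefect_apply, ← lie_skew a b, map_neg, LinearMap.neg_apply]
  abel

theorem lieDefect_self (ρ : g →ₗ[K] Module.End K (SymmetricAlgebra K g)) (a : g)
    (s : SymmetricAlgebra K g) : lieDefect ρ a a s = 0 := by
  simp [lieDefect_apply]

/-- A linear map `ρ : g → End S(g)` that agrees with multiplication up to terms of lower degree,
satisfies `ρ y (yⁿ) = yⁿ⁺¹`, and is a representation on elements of degree less than `m`. -/
structure IsApproxAction (m : ℕ) (ρ : g →ₗ[K] Module.End K (SymmetricAlgebra K g)) : Prop where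
  apply_sub_mem (a : g) {k : ℕ} {s : SymmetricAlgebra K g} (hs : s ∈ degreeLE K g k) :
    ρ a s - ι K g a * s ∈ degreeLE K g k
  apply_pow (y : g) (n : ℕ) : ρ y (ι K g y ^ n) = ι K g y ^ (n + 1)
  lieDefect_proj (a b : g) {k : ℕ} (hk : k < m) (s : SymmetricAlgebra K g) :
    lieDefect ρ a b (proj K g k s) = 0

theorem isApproxAction_zero :
    IsApproxAction 0 ((LinearMap.mul K (SymmetricAlgebra K g)) ∘ₗ ι K g) where
  apply_sub_mem a k s _ := by simp
  apply_pow y n := by simp [pow_succ']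
  lieDefect_proj a b k hk := by simp at hk

namespace IsApproxAction

variable {m : ℕ} {ρ : g →ₗ[K] Module.End K (SymmetricAlgebra K g)}

theorem apply_mem (h : IsApproxAction m ρ) (a : g) {k : ℕ}
    {s : SymmetricAlgebra K g} (hs : s ∈ degreeLE K g k) :
    ρ a s ∈ degreeLE K g (k + 1) := by
  have h₁ := add_mem (degreeLE_mono k.le_succ (h.apply_sub_mem a hs)) (ι_mul_mem_degreeLE a hs)
  rwa [sub_add_cancel] at h₁

theorem lieDefect_eq_zero (h : IsApproxAction m ρ) (a b : g) {k : ℕ} (hk : k < m)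
    {s : SymmetricAlgebra K g} (hs : s ∈ degreeLE K g k) : lieDefect ρ a b s = 0 := by
  rw [← sum_proj_of_mem_degreeLE hs, map_sum]
  exact Finset.sum_eq_zero fun j hj =>
    h.lieDefect_proj a b (by simp at hj; lia) s

theorem lieDefect_mem (h : IsApproxAction m ρ) (a b : g) {k : ℕ}
    {s : SymmetricAlgebra K g} (hs : s ∈ degreeLE K g k) :
    lieDefect ρ a b s ∈ degreeLE K g (k + 1) := by
  have h₁ : ∀ a b, ρ a (ρ b s) - ι K g a * ι K g b * s ∈ degreeLE K g (k + 1) := by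
    intro a b
    have h₂ := add_mem (h.apply_sub_mem a (h.apply_mem b hs))
      (ι_mul_mem_degreeLE a (h.apply_sub_mem b hs))
    convert h₂ using 1
    ring
  have h₃ := sub_mem (sub_mem (h₁ a b) (h₁ b a)) (h.apply_mem ⁅a, b⁆ hs)
  convert h₃ using 1
  rw [lieDefect_apply]
  ring

/-- The defect satisfies the Bianchi identity in the lowest degree where it can be nonzero. -/
theorem lieDefect_cyclic (h : IsApproxAction m ρ) (a b c : g) {k : ℕ} (hk : k + 1 = m)
    {s : SymmetricAlgebra K g} (hs : s ∈ degreeLE K g k) :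
    lieDefect ρ a b (ι K g c * s) + lieDefect ρ b c (ι K g a * s) +
      lieDefect ρ c a (ι K g b * s) = 0 := by
  have hk' : k < m := by lia
  have h₁ : ∀ a b c, lieDefect ρ a b (ι K g c * s) =
      ρ a (ρ b (ρ c s)) - ρ b (ρ a (ρ c s)) - ρ c (ρ a (ρ b s)) + ρ c (ρ b (ρ a s)) +
        ρ ⁅c, ⁅a, b⁆⁆ s := by
    intro a b c
    have h₂ := h.lieDefect_eq_zero a b hk' (h.apply_sub_mem c hs)
    have h₃ := congrArg (ρ c) (h.lieDefect_eq_zero a b hk' hs)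
    have h₄ := h.lieDefect_eq_zero c ⁅a, b⁆ hk' hs
    rw [map_sub, sub_eq_zero] at h₂
    rw [← h₂]
    simp only [lieDefect_apply, map_sub, map_zero] at h₃ h₄ ⊢
    linear_combination h₃ + h₄
  rw [h₁ a b c, h₁ b c a, h₁ c a b]
  have h₅ : ρ ⁅c, ⁅a, b⁆⁆ s + ρ ⁅a, ⁅b, c⁆⁆ s + ρ ⁅b, ⁅c, a⁆⁆ s = 0 := by
    rw [← LinearMap.add_apply, ← LinearMap.add_apply, ← map_add, ← map_add,
      lie_jacobi c a b, map_zero, LinearMap.zero_apply]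
  linear_combination h₅

theorem contract_lieDefect (h : IsApproxAction m ρ) (a b : g) (s : SymmetricAlgebra K g) :
    contract (lieDefect ρ a) (ι K g b * proj K g m s) -
      contract (lieDefect ρ b) (ι K g a * proj K g m s) =
      (m + 2) • lieDefect ρ a b (proj K g m s) := by
  have h₁ : contract ((lieDefect ρ a).compl₂ (LinearMap.mulLeft K (ι K g b))) (proj K g m s) -
      contract ((lieDefect ρ b).compl₂ (LinearMap.mulLeft K (ι K g a))) (proj K g m s) =
      m • lieDefect ρ a b (proj K g m s) := by
    cases m with
    | zero => simp [contract_proj_zero]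
    | succ k =>
      rw [← contract_proj_of_mul (lieDefect ρ a b)
        ((LinearMap.mul K (SymmetricAlgebra K g) ∘ₗ ι K g).compr₂ (lieDefect ρ a b))
        (fun _ _ => rfl), contract_proj_succ, contract_proj_succ, contract_proj_succ,
        sub_eq_iff_eq_add, ← contract_add]
      congr 2
      refine LinearMap.ext fun x => LinearMap.ext fun t => ?_
      have h₂ := h.lieDefect_cyclic a b x rfl (proj_mem_degreeLE k t)
      have h₃ := lieDefect_swap ρ x a (ι K g b * proj K g k t)
      simp only [LinearMap.compl₂_apply, LinearMap.add_apply, LinearMap.compr₂_apply,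
        LinearMap.mulLeft_apply, LinearMap.comp_apply, LinearMap.mul_apply_apply]
      linear_combination h₃ - h₂
  rw [contract_ι_mul, contract_ι_mul, add_sub_add_comm, h₁, lieDefect_swap ρ a b]
  simp only [add_smul, two_smul]
  abel

theorem exists_succ (h : IsApproxAction m ρ) {r : K} (hr : r * (m + 2 : ℕ) = 1) :
    ∃ ρ' : g →ₗ[K] Module.End K (SymmetricAlgebra K g), IsApproxAction (m + 1) ρ' := by
  let E : g →ₗ[K] Module.End K (SymmetricAlgebra K g) :=
    { toFun := fun a => contract (lieDefect ρ a) ∘ₗ proj K g (m + 1)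
      map_add' := fun a b => LinearMap.ext fun s => by simp [contract_add]
      map_smul' := fun q a => LinearMap.ext fun s => by simp [contract_smul] }
  have hE : ∀ a s, (ρ - r • E) a s =
      ρ a s - r • contract (lieDefect ρ a) (proj K g (m + 1) s) := fun a s => rfl
  have hE_low : ∀ a {k} s, k ≤ m → s ∈ degreeLE K g k → (ρ - r • E) a s = ρ a s := by
    intro a k s hk hs
    rw [hE, hs _ (by lia), map_zero, smul_zero, sub_zero]
  refine ⟨ρ - r • E, ?_, ?_, ?_⟩
  · intro a k s hs
    rcases le_or_gt k m with hk | hk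
    · rw [hE_low a s hk hs]
      exact h.apply_sub_mem a hs
    · rw [hE, sub_right_comm]
      refine sub_mem (h.apply_sub_mem a hs) (Submodule.smul_mem _ _ (degreeLE_mono hk ?_))
      rw [contract_proj_succ]
      refine contract_mem _ _ (fun x t => ?_) s
      rw [LinearMap.compl₂_apply]
      exact h.lieDefect_mem a x (proj_mem_degreeLE m t)
  · intro y n
    have h₁ : contract (lieDefect ρ y) (ι K g y ^ n) = 0 := by
      cases n with
      | zero => simp
      | succ n => rw [contract_ι_pow_succ, lieDefect_self, smul_zero]
    rw [hE, proj_ι_pow, h.apply_pow]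
    split_ifs <;> simp [h₁]
  · intro a b k hk s
    have hks := proj_mem_degreeLE k s
    rw [lieDefect_apply, hE_low a _ (Nat.lt_succ_iff.1 hk) hks,
      hE_low b _ (Nat.lt_succ_iff.1 hk) hks, hE_low _ _ (Nat.lt_succ_iff.1 hk) hks, hE, hE]
    rcases (Nat.lt_succ_iff.1 hk).lt_or_eq with hk | rfl
    · rw [h.apply_mem a hks _ (by lia), h.apply_mem b hks _ (by lia)]
      simpa [lieDefect_apply] using h.lieDefect_proj a b hk s
    · have h₁ : ∀ a, proj K g (k + 1) (ρ a (proj K g k s)) = ι K g a * proj K g k s := by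
        intro a
        have h₂ := h.apply_sub_mem a hks (k + 1) k.lt_succ_self
        rwa [map_sub, proj_succ_ι_mul, proj_proj, if_pos rfl, sub_eq_zero] at h₂
      have h₃ := congrArg (r • ·) (h.contract_lieDefect a b s)
      rw [← Nat.cast_smul_eq_nsmul K, smul_smul, hr, one_smul] at h₃
      simp only [lieDefect_apply, smul_sub] at h₃
      rw [h₁, h₁]
      linear_combination -h₃

end IsApproxAction

theorem exists_isApproxAction [Algebra ℚ K] (m : ℕ) :
    ∃ ρ : g →ₗ[K] Module.End K (SymmetricAlgebra K g), IsApproxAction m ρ := by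
  induction m with
  | zero => exact ⟨_, isApproxAction_zero⟩
  | succ m ih =>
    obtain ⟨ρ, h⟩ := ih
    refine h.exists_succ (r := algebraMap ℚ K ((m + 2 : ℕ) : ℚ)⁻¹) ?_
    rw [← map_natCast (algebraMap ℚ K), ← map_mul, inv_mul_cancel₀ (by positivity), map_one]

end ApproxAction
end SymmetricAlgebra

section Polarization

variable {A : Type*} [Ring A] {n : ℕ}

/-- The alternating sum over the subsets containing the range of a self-map vanishes unless the
map is bijective. -/
theorem sum_neg_one_pow_card_range_subset (p : Fin n → Fin n) :
    ∑ B : Finset (Fin n), (if ∀ i, p i ∈ B then (-1 : ℤ) ^ B.card else 0) =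
      if Function.Bijective p then (-1) ^ n else 0 := by
  split_ifs with hp
  · rw [Finset.sum_eq_single Finset.univ]
    · simp
    · intro B _ hB
      rw [if_neg]
      intro h
      refine hB (Finset.eq_univ_of_forall fun j => ?_)
      obtain ⟨i, rfl⟩ := hp.2 j
      exact h i
    · simp
  · have hp' : ¬ Function.Surjective p := fun h => hp (Finite.surjective_iff_bijective.1 h)
    simp only [Function.Surjective, not_forall, not_exists] at hp'
    obtain ⟨j, hj⟩ := hp'
    refine Finset.sum_involution (fun B _ => symmDiff B {j}) ?_ ?_ (by simp) (by simp)
    · intro B _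
      have h₁ : (∀ i, p i ∈ symmDiff B {j}) ↔ ∀ i, p i ∈ B :=
        forall_congr' fun i => by simp [Finset.mem_symmDiff, hj i]
      simp only [h₁]
      split_ifs
      · by_cases hB : j ∈ B
        · have h₂ : symmDiff B {j} = B.erase j := by
            ext i; by_cases hi : i = j <;> simp_all [Finset.mem_symmDiff]
          rw [h₂, ← Finset.card_erase_add_one hB, pow_succ]
          ring
        · have h₂ : symmDiff B {j} = insert j B := by
            ext i; by_cases hi : i = j <;> simp_all [Finset.mem_symmDiff]
          rw [h₂, Finset.card_insert_of_notMem hB, pow_succ]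
          ring
      · simp
    · intro B _ _ h
      have h₁ := Finset.ext_iff.1 h j
      simp [Finset.mem_symmDiff] at h₁

/-- The polarization identity in a noncommutative ring. -/
theorem sum_perm_prod_ofFn (f : Fin n → A) :
    ∑ σ : Equiv.Perm (Fin n), (List.ofFn fun i => f (σ i)).prod =
      ∑ B : Finset (Fin n), ((-1) ^ n * (-1 : ℤ) ^ B.card) • (∑ j ∈ B, f j) ^ n := by
  have h₁ : ∀ B : Finset (Fin n), (∑ j ∈ B, f j) ^ n =
      ∑ p : Fin n → Fin n, if ∀ i, p i ∈ B then (List.ofFn fun i => f (p i)).prod else 0 := by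
    intro B
    have h₂ := (MultilinearMap.mkPiAlgebraFin ℤ n A).map_sum_finset (fun _ j => f j) fun _ => B
    rw [MultilinearMap.mkPiAlgebraFin_apply_const] at h₂
    rw [h₂, ← Finset.sum_filter]
    refine Finset.sum_congr ?_ fun p _ => by simp
    ext p
    simp
  have h₃ : ∀ p : Fin n → Fin n,
      (∑ B : Finset (Fin n), ((-1) ^ n * (-1 : ℤ) ^ B.card) •
        if ∀ i, p i ∈ B then (List.ofFn fun i => f (p i)).prod else 0) =
      if Function.Bijective p then (List.ofFn fun i => f (p i)).prod else 0 := by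
    intro p
    have h₄ := congrArg
      (fun k : ℤ => ((-1) ^ n * k) • (List.ofFn fun i => f (p i)).prod)
      (sum_neg_one_pow_card_range_subset p)
    simp only [Finset.mul_sum, Finset.sum_smul] at h₄
    convert h₄ using 1
    · refine Finset.sum_congr rfl fun B _ => ?_
      split_ifs <;> simp
    · split_ifs
      · rw [← mul_pow]; simp
      · simp
  simp only [h₁, Finset.smul_sum]
  rw [Finset.sum_comm, Finset.sum_congr rfl fun p _ => h₃ p, ← Finset.sum_filter]
  refine Finset.sum_bij (fun σ _ => ⇑σ)
    (fun σ _ => Finset.mem_filter.2 ⟨Finset.mem_univ _, σ.bijective⟩)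
    (fun σ _ τ _ h => DFunLike.coe_injective h) ?_ fun _ _ => rfl
  intro p hp
  exact ⟨Equiv.ofBijective p (by simpa using hp), by simp, rfl⟩

end Polarization

section Complement

variable {K : Type*} [CommRing K] {g : Type*} [LieRing g] [LieAlgebra K g]

theorem symTensors_le_span_pow [Algebra ℚ K] :
    symTensors K g ≤ Submodule.span K {z | ∃ (y : g) (n : ℕ), z = TensorAlgebra.ι K y ^ n} := by
  refine Submodule.span_le.2 ?_
  rintro _ ⟨n, x, rfl⟩
  refine Submodule.smul_mem _ _ ?_
  rw [sum_perm_prod_ofFn fun i => TensorAlgebra.ι K (x i)]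
  refine Submodule.sum_mem _ fun B _ => zsmul_mem (Submodule.subset_span ?_) _
  exact ⟨∑ j ∈ B, x j, n, by rw [map_sum]⟩

/-- Symmetrization in degree `n`. -/
theorem exists_symmetrization [Algebra ℚ K] (n : ℕ) :
    ∃ θ : SymmetricAlgebra K g →ₗ[K] TensorAlgebra K g, ∀ y k,
      θ (SymmetricAlgebra.ι K g y ^ k) = if k = n then TensorAlgebra.ι K y ^ k else 0 := by
  induction n with
  | zero =>
    refine ⟨Algebra.linearMap K _ ∘ₗ SymmetricAlgebra.algebraMapInv.toLinearMap, fun y k => ?_⟩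
    rcases eq_or_ne k 0 with rfl | hk
    · simp
    · simp [hk, SymmetricAlgebra.algebraMapInv_ι]
  | succ n ih =>
    obtain ⟨θ, hθ⟩ := ih
    refine ⟨algebraMap ℚ K ((n + 1 : ℕ) : ℚ)⁻¹ • SymmetricAlgebra.contract
      ((LinearMap.mul K (TensorAlgebra K g)).compl₂ θ ∘ₗ TensorAlgebra.ι K), fun y k => ?_⟩
    cases k with
    | zero => simp
    | succ k =>
      rw [LinearMap.smul_apply, SymmetricAlgebra.contract_ι_pow_succ]
      simp only [LinearMap.comp_apply, LinearMap.compl₂_apply, LinearMap.mul_apply_apply, hθ,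
        add_left_inj]
      split_ifs with hk
      · subst hk
        rw [← Nat.cast_smul_eq_nsmul K, smul_smul, ← map_natCast (algebraMap ℚ K), ← map_mul,
          inv_mul_cancel₀ (by positivity), map_one, one_smul, pow_succ']
      · simp

open SymmetricAlgebra (degreeLE IsApproxAction)

theorem SymmetricAlgebra.IsApproxAction.lift_ι_pow {m : ℕ}
    {ρ : g →ₗ[K] Module.End K (SymmetricAlgebra K g)}
    (h : IsApproxAction m ρ) (y : g) (n : ℕ) :
    TensorAlgebra.lift K ρ (TensorAlgebra.ι K y ^ n) 1 = SymmetricAlgebra.ι K g y ^ n := by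
  induction n with
  | zero => simp
  | succ n ih =>
    rw [pow_succ', map_mul, Module.End.mul_apply, ih, TensorAlgebra.lift_ι_apply, h.apply_pow]

theorem exists_lift_mem_degreeLE (t : TensorAlgebra K g) :
    ∃ d : ℕ, ∀ (m : ℕ) (ρ : g →ₗ[K] Module.End K (SymmetricAlgebra K g)), IsApproxAction m ρ →
      ∀ k, ∀ s ∈ degreeLE K g k, TensorAlgebra.lift K ρ t s ∈ degreeLE K g (k + d) := by
  induction t using TensorAlgebra.induction with
  | algebraMap r =>
    refine ⟨0, fun m ρ _ k s hs => ?_⟩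
    rw [AlgHom.commutes]
    exact Submodule.smul_mem _ r hs
  | ι x => exact ⟨1, fun m ρ h k s hs => by simpa using h.apply_mem x hs⟩
  | mul a b ha hb =>
    obtain ⟨d, hd⟩ := ha
    obtain ⟨e, he⟩ := hb
    refine ⟨e + d, fun m ρ h k s hs => ?_⟩
    rw [map_mul, ← add_assoc]
    exact hd m ρ h _ _ (he m ρ h _ _ hs)
  | add a b ha hb =>
    obtain ⟨d, hd⟩ := ha
    obtain ⟨e, he⟩ := hb
    refine ⟨d + e, fun m ρ h k s hs => ?_⟩
    rw [map_add]
    exact add_mem (SymmetricAlgebra.degreeLE_mono (by lia) (hd m ρ h k s hs))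
      (SymmetricAlgebra.degreeLE_mono (by lia) (he m ρ h k s hs))

theorem exists_lift_eq_zero {z : TensorAlgebra K g} (hz : z ∈ envIdeal K g) :
    ∃ N : ℕ, ∀ m, N ≤ m → ∀ ρ : g →ₗ[K] Module.End K (SymmetricAlgebra K g),
      IsApproxAction m ρ → TensorAlgebra.lift K ρ z 1 = 0 := by
  induction hz using Submodule.span_induction with
  | mem z hz =>
    obtain ⟨a, b, x, y, rfl⟩ := hz
    obtain ⟨d, hd⟩ := exists_lift_mem_degreeLE b
    refine ⟨d + 1, fun m hm ρ h => ?_⟩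
    have h₁ := h.lieDefect_eq_zero x y (by lia) (hd m ρ h 0 1 (SymmetricAlgebra.one_mem_degreeLE 0))
    rw [SymmetricAlgebra.lieDefect_apply] at h₁
    simp [h₁]
  | zero => exact ⟨0, by simp⟩
  | add a b _ _ ha hb =>
    obtain ⟨M, hM⟩ := ha
    obtain ⟨N, hN⟩ := hb
    exact ⟨M + N, fun m hm ρ h => by simp [hM m (by lia) ρ h, hN m (by lia) ρ h]⟩
  | smul r a _ ha =>
    obtain ⟨M, hM⟩ := ha
    exact ⟨M, fun m hm ρ h => by simp [hM m hm ρ h]⟩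

theorem symTensors_inf_envIdeal [Algebra ℚ K] : symTensors K g ⊓ envIdeal K g = ⊥ := by
  choose θ hθ using exists_symmetrization (K := K) (g := g)
  have h_sym : ∀ z ∈ symTensors K g, ∃ N : ℕ, ∀ M, N ≤ M →
      ∀ (m : ℕ) (ρ : g →ₗ[K] Module.End K (SymmetricAlgebra K g)), IsApproxAction m ρ →
        ∑ n ∈ Finset.range M, θ n (TensorAlgebra.lift K ρ z 1) = z := by
    intro z hz
    replace hz := symTensors_le_span_pow hz
    induction hz using Submodule.span_induction with
    | mem z hz =>
      obtain ⟨y, k, rfl⟩ := hz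
      refine ⟨k + 1, fun M hM m ρ h => ?_⟩
      have hk : k < M := hM
      rw [h.lift_ι_pow]
      simp [hθ, hk]
    | zero => exact ⟨0, by simp⟩
    | add a b _ _ ha hb =>
      obtain ⟨M, hM⟩ := ha
      obtain ⟨N, hN⟩ := hb
      refine ⟨M + N, fun L hL m ρ h => ?_⟩
      simp [Finset.sum_add_distrib, hM L (by lia) m ρ h, hN L (by lia) m ρ h]
    | smul r a _ ha =>
      obtain ⟨M, hM⟩ := ha
      refine ⟨M, fun L hL m ρ h => ?_⟩
      simp [← Finset.smul_sum, hM L hL m ρ h]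
  refine (Submodule.eq_bot_iff _).2 fun z hz => ?_
  obtain ⟨M, hM⟩ := h_sym z hz.1
  obtain ⟨N, hN⟩ := exists_lift_eq_zero hz.2
  obtain ⟨ρ, h⟩ := SymmetricAlgebra.exists_isApproxAction (K := K) (g := g) N
  simpa [hN N le_rfl ρ h] using (hM M le_rfl N ρ h).symm

variable (K g) in
/-- The span of the products of fewer than `n` vectors in the tensor algebra. -/
noncomputable def wordsLT (n : ℕ) : Submodule K (TensorAlgebra K g) :=
  Submodule.span K {z | ∃ l : List g, l.length < n ∧ z = (l.map (TensorAlgebra.ι K)).prod}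

theorem mul_mem_envIdeal_sup_wordsLT (x : g) {n : ℕ} {z : TensorAlgebra K g}
    (hz : z ∈ envIdeal K g ⊔ wordsLT K g n) :
    TensorAlgebra.ι K x * z ∈ envIdeal K g ⊔ wordsLT K g (n + 1) := by
  suffices h : envIdeal K g ⊔ wordsLT K g n ≤ (envIdeal K g ⊔ wordsLT K g (n + 1)).comap
      (LinearMap.mulLeft K (TensorAlgebra.ι K x)) from h hz
  refine sup_le (Submodule.span_le.2 ?_) (Submodule.span_le.2 ?_)
  · rintro _ ⟨a, b, y, w, rfl⟩
    exact Submodule.mem_sup_left (Submodule.subset_span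
      ⟨TensorAlgebra.ι K x * a, b, y, w, by simp [mul_assoc]⟩)
  · rintro _ ⟨l, hl, rfl⟩
    exact Submodule.mem_sup_right (Submodule.subset_span ⟨x :: l, by simpa using hl, by simp⟩)

theorem prod_sub_prod_mem_of_perm {l l' : List g} (h : l.Perm l') :
    (l.map (TensorAlgebra.ι K)).prod - (l'.map (TensorAlgebra.ι K)).prod ∈
      envIdeal K g ⊔ wordsLT K g l.length := by
  induction h with
  | nil => simp
  | cons x _ ih => simpa [mul_sub] using mul_mem_envIdeal_sup_wordsLT x ih
  | swap x y l =>
    refine Submodule.mem_sup.2 ⟨_, Submodule.subset_span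
      ⟨1, (l.map (TensorAlgebra.ι K)).prod, y, x, rfl⟩, _,
      Submodule.subset_span ⟨⁅y, x⁆ :: l, by simp, rfl⟩, ?_⟩
    simp only [List.map_cons, List.prod_cons]
    noncomm_ring
  | trans h₁ _ ih₁ ih₂ =>
    rw [← h₁.length_eq] at ih₂
    simpa using add_mem ih₁ ih₂

theorem wordsLT_le [Algebra ℚ K] (n : ℕ) :
    wordsLT K g n ≤ symTensors K g ⊔ envIdeal K g := by
  induction n with
  | zero =>
    refine Submodule.span_le.2 ?_
    rintro _ ⟨l, hl, _⟩
    simp at hl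
  | succ n ih =>
    refine Submodule.span_le.2 ?_
    rintro _ ⟨l, hl, rfl⟩
    rcases (Nat.lt_succ_iff.1 hl).lt_or_eq with hl | rfl
    · exact ih (Submodule.subset_span ⟨l, hl, rfl⟩)
    have h₁ : ∀ σ : Equiv.Perm (Fin l.length), (l.map (TensorAlgebra.ι K)).prod -
        (List.ofFn fun i => TensorAlgebra.ι K (l.get (σ i))).prod ∈
          symTensors K g ⊔ envIdeal K g := by
      intro σ
      have h₂ := prod_sub_prod_mem_of_perm (K := K) (σ.ofFn_comp_perm l.get).symm
      rw [List.length_ofFn, List.ofFn_get, List.map_ofFn] at h₂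
      exact sup_le le_sup_right ih h₂
    have h₃ : algebraMap ℚ K ((l.length.factorial : ℚ)⁻¹) • ∑ σ : Equiv.Perm (Fin l.length),
        (List.ofFn fun i => TensorAlgebra.ι K (l.get (σ i))).prod ∈
          symTensors K g ⊔ envIdeal K g :=
      Submodule.mem_sup_left (Submodule.subset_span ⟨_, _, rfl⟩)
    have h₄ := add_mem (Submodule.smul_mem _ (algebraMap ℚ K ((l.length.factorial : ℚ)⁻¹))
      (Submodule.sum_mem _ fun σ (_ : σ ∈ Finset.univ) => h₁ σ)) h₃
    rw [← smul_add, ← Finset.sum_add_distrib] at h₄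
    simp only [sub_add_cancel, Finset.sum_const, Finset.card_univ, Fintype.card_perm,
      Fintype.card_fin] at h₄
    rwa [← Nat.cast_smul_eq_nsmul K, smul_smul, ← map_natCast (algebraMap ℚ K), ← map_mul,
      inv_mul_cancel₀ (by positivity), map_one, one_smul] at h₄

theorem symTensors_sup_envIdeal [Algebra ℚ K] : symTensors K g ⊔ envIdeal K g = ⊤ := by
  have h₁ := congrArg Subalgebra.toSubmodule (TensorAlgebra.adjoin_range_ι (R := K) (M := g))
  rw [Algebra.adjoin_eq_span, Algebra.top_toSubmodule] at h₁
  rw [eq_top_iff, ← h₁, Submodule.span_le]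
  intro z hz
  have h₂ : ∃ l : List g, z = (l.map (TensorAlgebra.ι K)).prod := by
    induction hz using Submonoid.closure_induction with
    | mem z hz =>
      obtain ⟨x, rfl⟩ := hz
      exact ⟨[x], by simp⟩
    | one => exact ⟨[], by simp⟩
    | mul a b _ _ ha hb =>
      obtain ⟨l, rfl⟩ := ha
      obtain ⟨l', rfl⟩ := hb
      exact ⟨l ++ l', by simp⟩
  obtain ⟨l, rfl⟩ := h₂
  exact wordsLT_le (l.length + 1) (Submodule.subset_span ⟨l, Nat.lt_succ_self _, rfl⟩)

end Complement

/-- Over a `ℚ`-algebra `K`, the submodule of symmetric tensors and (the underlying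
`K`-submodule of) the ideal `J(g)` are complementary in the tensor algebra `T(g)`. -/
theorem symTensors_isCompl_envIdeal (K : Type*) [CommRing K] [Algebra ℚ K]
    (g : Type*) [LieRing g] [LieAlgebra K g] :
    symTensors K g ⊓ envIdeal K g = ⊥ ∧ symTensors K g ⊔ envIdeal K g = ⊤ := by
  exact ⟨symTensors_inf_envIdeal, symTensors_sup_envIdeal⟩
end

section
/- For every natural number n, the number of Lie-permutations of Fin n equals n!. -/
/-- A Lie-permutation of `Fin n`: a list of nonempty lists ("blocks") of elements of
`Fin n` whose entries are pairwise distinct and together exhaust `Fin n`, such that each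
block has its maximal entry as its last entry, and the maximal (i.e. last) entries of
the blocks are strictly increasing along the list. -/
structure LiePerm (n : ℕ) where
  blocks : List (List (Fin n))
  blocks_ne : ∀ l ∈ blocks, l ≠ []
  nodup : blocks.flatten.Nodup
  complete : ∀ i : Fin n, i ∈ blocks.flatten
  last_max : ∀ l ∈ blocks, ∀ x ∈ l, ∀ (h : l ≠ []), x ≤ l.getLast h
  lasts_strict_mono : blocks.Chain' fun l₁ l₂ =>
    ∀ (h₁ : l₁ ≠ []) (h₂ : l₂ ≠ []), l₁.getLast h₁ < l₂.getLast h₂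

section LieBlocks

variable {α : Type*}

/-- The word obtained by reading every block backwards. -/
def lieWord (bs : List (List α)) : List α := (bs.map List.reverse).flatten

theorem lieWord_nil : lieWord ([] : List (List α)) = [] := rfl

theorem lieWord_cons (l : List α) (bs : List (List α)) :
    lieWord (l :: bs) = l.reverse ++ lieWord bs := rfl

theorem lieWord_perm (bs : List (List α)) : (lieWord bs).Perm bs.flatten := by
  induction bs with
  | nil => exact List.Perm.refl _
  | cons l bs ih =>
    rw [lieWord_cons, List.flatten_cons]
    exact l.reverse_perm.append ih

variable [LinearOrder α]

/-- The blocks are nonempty, end with their maxima, and these maxima increase. -/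
def IsLieBlocks (bs : List (List α)) : Prop :=
  (∀ l ∈ bs, l ≠ []) ∧ (∀ l ∈ bs, ∀ x ∈ l, ∀ h : l ≠ [], x ≤ l.getLast h) ∧
    bs.IsChain fun l₁ l₂ => ∀ (h₁ : l₁ ≠ []) (h₂ : l₂ ≠ []), l₁.getLast h₁ < l₂.getLast h₂

theorem isLieBlocks_nil : IsLieBlocks ([] : List (List α)) := by
  simp [IsLieBlocks]

theorem isLieBlocks_cons (a : α) (u : List α) (bs : List (List α)) :
    IsLieBlocks ((u.reverse ++ [a]) :: bs) ↔
      (∀ x ∈ u, x ≤ a) ∧ (∀ y ∈ (lieWord bs).head?, a < y) ∧ IsLieBlocks bs := by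
  have hu : (∀ x, x ∈ u ∨ x = a → x ≤ a) ↔ ∀ x ∈ u, x ≤ a := by
    simp only [or_imp, forall_and, forall_eq, le_refl, and_true]
  cases bs with
  | nil => simp [IsLieBlocks, lieWord_nil, hu]
  | cons l bs =>
    rcases l.eq_nil_or_concat with rfl | ⟨v, b, rfl⟩
    · simp [IsLieBlocks]
    · simp [IsLieBlocks, lieWord_cons, hu]
      tauto

theorem IsLieBlocks.exists_eq_concat {l : List α} {bs : List (List α)}
    (h : IsLieBlocks (l :: bs)) : ∃ (a : α) (u : List α), l = u.reverse ++ [a] := by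
  rcases l.eq_nil_or_concat with rfl | ⟨v, a, rfl⟩
  · exact absurd rfl (h.1 [] List.mem_cons_self)
  · exact ⟨a, v.reverse, by simp⟩

theorem takeWhile_le_append {a : α} {u w : List α} (hu : ∀ x ∈ u, x ≤ a)
    (hw : ∀ y ∈ w.head?, a < y) : (u ++ w).takeWhile (· ≤ a) = u := by
  rw [List.takeWhile_append_of_pos (by simpa using hu)]
  cases w with
  | nil => simp
  | cons y w => simp [hw y rfl]

theorem IsLieBlocks.eq_of_lieWord_eq {bs cs : List (List α)} (hb : IsLieBlocks bs)
    (hc : IsLieBlocks cs) (h : lieWord bs = lieWord cs) : bs = cs := by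
  induction bs generalizing cs with
  | nil =>
    cases cs with
    | nil => rfl
    | cons m cs =>
      obtain ⟨a, u, rfl⟩ := hc.exists_eq_concat
      simp [lieWord_nil, lieWord_cons] at h
  | cons l bs ih =>
    obtain ⟨a, u, rfl⟩ := hb.exists_eq_concat
    cases cs with
    | nil => simp [lieWord_nil, lieWord_cons] at h
    | cons m cs =>
      obtain ⟨b, v, rfl⟩ := hc.exists_eq_concat
      simp only [lieWord_cons, List.reverse_append, List.reverse_reverse, List.reverse_singleton,
        List.nil_append, List.cons_append, List.cons.injEq] at h
      obtain ⟨rfl, h⟩ := h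
      rw [isLieBlocks_cons] at hb hc
      have huv : u = v := by
        rw [← takeWhile_le_append hb.1 hb.2.1, h, takeWhile_le_append hc.1 hc.2.1]
      subst huv
      rw [ih hb.2.2 hc.2.2 (List.append_cancel_left h)]

theorem exists_isLieBlocks_lieWord_eq (w : List α) :
    ∃ bs, IsLieBlocks bs ∧ lieWord bs = w := by
  induction hn : w.length using Nat.strong_induction_on generalizing w with
  | _ n ih =>
    cases w with
    | nil => exact ⟨[], isLieBlocks_nil, rfl⟩
    | cons a w =>
      have hlt : (w.dropWhile (· ≤ a)).length < n := by
        rw [← hn, List.length_cons]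
        exact Nat.lt_succ_of_le (List.dropWhile_sublist _).length_le
      obtain ⟨bs, hbs, hw⟩ := ih _ hlt (w.dropWhile (· ≤ a)) rfl
      refine ⟨((w.takeWhile (· ≤ a)).reverse ++ [a]) :: bs,
        (isLieBlocks_cons _ _ _).2 ⟨fun x hx => ?_, fun y hy => ?_, hbs⟩, ?_⟩
      · simpa using List.mem_takeWhile_imp hx
      · rw [hw] at hy
        have := List.head?_dropWhile_not (fun x => decide (x ≤ a)) w
        rw [Option.mem_def.1 hy] at this
        simpa using this
      · simp [lieWord_cons, hw]

end LieBlocks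

theorem List.nodup_and_forall_mem_iff_perm_finRange {n : ℕ} (w : List (Fin n)) :
    (w.Nodup ∧ ∀ i, i ∈ w) ↔ w.Perm (List.finRange n) := by
  constructor
  · rintro ⟨hw, hmem⟩
    exact (List.perm_ext_iff_of_nodup hw (List.nodup_finRange n)).2 (by simp [hmem])
  · intro h
    exact ⟨h.nodup_iff.2 (List.nodup_finRange n), fun i => h.mem_iff.2 (List.mem_finRange i)⟩

namespace LiePerm

theorem isLieBlocks {n : ℕ} (p : LiePerm n) : IsLieBlocks p.blocks :=
  ⟨p.blocks_ne, p.last_max, p.lasts_strict_mono⟩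

/-- Reading the blocks backwards turns a Lie-permutation into a rearrangement of `Fin n`. -/
def word {n : ℕ} (p : LiePerm n) :
    {w : List (Fin n) // w ∈ (List.finRange n).permutations.toFinset} :=
  ⟨lieWord p.blocks, by
    rw [List.mem_toFinset, List.mem_permutations]
    exact (lieWord_perm _).trans
      ((List.nodup_and_forall_mem_iff_perm_finRange _).1 ⟨p.nodup, p.complete⟩)⟩

theorem word_injective {n : ℕ} : Function.Injective (word (n := n)) := by
  intro p q h
  have hpq : p.blocks = q.blocks :=
    p.isLieBlocks.eq_of_lieWord_eq q.isLieBlocks (congrArg Subtype.val h)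
  cases p
  cases q
  cases hpq
  rfl

theorem word_surjective {n : ℕ} : Function.Surjective (word (n := n)) := by
  rintro ⟨w, hw⟩
  obtain ⟨bs, hbs, rfl⟩ := exists_isLieBlocks_lieWord_eq w
  have hperm := hw
  rw [List.mem_toFinset, List.mem_permutations] at hperm
  obtain ⟨hnodup, hmem⟩ := (List.nodup_and_forall_mem_iff_perm_finRange _).2
    ((lieWord_perm bs).symm.trans hperm)
  exact ⟨⟨bs, hbs.1, hnodup, hmem, hbs.2.1, hbs.2.2⟩, rfl⟩

end LiePerm

/-- The number of Lie-permutations of `Fin n` is `n!`. -/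
theorem card_liePerm (n : ℕ) : Nat.card (LiePerm n) = n.factorial := by
  rw [Nat.card_eq_of_bijective _ ⟨LiePerm.word_injective, LiePerm.word_surjective⟩,
    Nat.card_eq_fintype_card, Fintype.card_coe,
    List.toFinset_card_of_nodup (List.nodup_permutations _ (List.nodup_finRange n)),
    List.length_permutations, List.length_finRange]
end

section
/- Let Λ be a type and g = FreeLieAlgebra ℚ Λ, the free Lie algebra over ℚ on Λ. Then the restriction of the canonical algebra map m : T(g) → U(g) to the submodule of symmetric tensors T_Σ(g) is bijective (the symmetric Poincaré–Birkhoff–Witt theorem holds for free Lie algebras over ℚ). -/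
section Polarization

open Finset

variable {R : Type*} [CommRing R]

lemma sum_neg_one_pow_card_mul_ite_range_subset {n : ℕ} (r : Fin n → Fin n) :
    ∑ S : Finset (Fin n), (-1 : R) ^ #S * (if ∀ i, r i ∈ S then 1 else 0) =
      if Function.Surjective r then (-1) ^ n else 0 := by
  split_ifs with hr
  · rw [Finset.sum_eq_single univ]
    · simp
    · intro S _ hS
      rw [if_neg, mul_zero]
      refine fun h => hS (eq_univ_iff_forall.2 fun j => ?_)
      obtain ⟨i, rfl⟩ := hr j
      exact h i
    · simp
  · obtain ⟨j, hj⟩ : ∃ j, ∀ i, r i ≠ j := by simpa [Function.Surjective] using hr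
    refine Finset.sum_involution (fun S _ => if j ∈ S then S.erase j else insert j S)
      ?_ ?_ ?_ ?_
    · intro S _
      by_cases hS : j ∈ S
      · have h : #S = #(S.erase j) + 1 := by rw [card_erase_add_one hS]
        rw [h]
        simp only [hS, if_true, Finset.mem_erase, hj, ne_eq, not_false_eq_true, true_and, pow_succ]
        split_ifs <;> simp
      · simp [hS, hj, pow_succ]
        split_ifs <;> simp
    · intro S _ _ h
      by_cases hS : j ∈ S
      · rw [if_pos hS] at h
        exact notMem_erase j S (h.symm ▸ hS)
      · rw [if_neg hS] at h
        exact hS (h ▸ mem_insert_self j S)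
    · simp
    · intro S _
      by_cases hS : j ∈ S <;> simp [hS]

/-- The polarization identity for products in a noncommutative algebra. -/
lemma sum_perm_prod_eq_sum_pow {A : Type*} [Ring A] [Algebra R A] {n : ℕ} (x : Fin n → A) :
    ∑ σ : Equiv.Perm (Fin n), (List.ofFn fun i => x (σ i)).prod =
      (-1 : R) ^ n • ∑ S : Finset (Fin n), (-1 : R) ^ #S • (∑ i ∈ S, x i) ^ n := by
  have expand (S : Finset (Fin n)) : (∑ i ∈ S, x i) ^ n =
      ∑ r : Fin n → Fin n, (if ∀ i, r i ∈ S then (1 : R) else 0) •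
        (List.ofFn fun i => x (r i)).prod := by
    have h : ∑ i ∈ S, x i = ∑ i, (if i ∈ S then (1 : R) else 0) • x i := by
      simp [Finset.sum_ite_mem]
    rw [h, ← MultilinearMap.mkPiAlgebraFin_apply_const (R := R), MultilinearMap.map_sum]
    refine Finset.sum_congr rfl fun r _ => ?_
    rw [MultilinearMap.map_smul_univ, MultilinearMap.mkPiAlgebraFin_apply]
    congr 1
    simp [Finset.prod_ite_zero]
  simp_rw [expand, Finset.smul_sum, smul_smul]
  rw [Finset.sum_comm]
  simp_rw [← Finset.sum_smul, ← Finset.mul_sum]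
  simp_rw [sum_neg_one_pow_card_mul_ite_range_subset]
  simp only [mul_ite, ← mul_pow, mul_zero, neg_mul_neg, one_mul, one_pow, ite_smul, one_smul,
    zero_smul]
  rw [← Finset.sum_filter]
  symm
  refine Finset.sum_bij' (fun r hr => Equiv.ofBijective r
      (Finite.surjective_iff_bijective.1 (by simpa using hr))) (fun σ _ => σ) ?_ ?_ ?_ ?_ ?_
  · simp
  · intro σ _
    simpa using σ.surjective
  · intro r hr
    rfl
  · intro σ _
    ext
    rfl
  · intro r hr
    rfl

end Polarization

section SymmetricTensors

variable {K g : Type*} [Field K] [Algebra ℚ K] [LieRing g] [LieAlgebra K g]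

lemma symTensors_eq_span_pow :
    symTensors K g =
      Submodule.span K {z | ∃ (n : ℕ) (y : g), z = TensorAlgebra.ι K y ^ n} := by
  apply le_antisymm <;> rw [symTensors, Submodule.span_le]
  · rintro _ ⟨n, x, rfl⟩
    refine Submodule.smul_mem _ _ ?_
    rw [sum_perm_prod_eq_sum_pow (R := K) fun i => TensorAlgebra.ι K (x i)]
    refine Submodule.smul_mem _ _ (Submodule.sum_mem _ fun S _ => Submodule.smul_mem _ _ ?_)
    rw [← map_sum]
    exact Submodule.subset_span ⟨n, _, rfl⟩
  · rintro _ ⟨n, y, rfl⟩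
    refine Submodule.subset_span ⟨n, fun _ => y, ?_⟩
    simp only [List.ofFn_const, List.prod_replicate, Finset.sum_const, Finset.card_univ,
      Fintype.card_perm, Fintype.card_fin]
    rw [← Nat.cast_smul_eq_nsmul K, smul_smul, ← map_natCast (algebraMap ℚ K), ← map_mul,
      inv_mul_cancel₀ (by exact_mod_cast n.factorial_ne_zero), map_one, one_smul]

lemma sum_perm_prod_mem_symTensors {n : ℕ} (x : Fin n → g) :
    ∑ σ : Equiv.Perm (Fin n), (List.ofFn fun i => TensorAlgebra.ι K (x (σ i))).prod ∈
      symTensors K g := by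
  have h : algebraMap ℚ K ((n.factorial : ℚ)⁻¹) ≠ 0 := by
    rw [map_ne_zero]
    exact inv_ne_zero (by exact_mod_cast n.factorial_ne_zero)
  rw [← Submodule.smul_mem_iff _ h]
  exact Submodule.subset_span ⟨n, x, rfl⟩

end SymmetricTensors

namespace UniversalEnvelopingAlgebra

open TensorProduct

attribute [local instance] LieRing.ofAssociativeRing

section Comul

variable (R L : Type*) [CommRing R] [LieRing L] [LieAlgebra R L]

/-- The comultiplication of the universal enveloping algebra, for which `ι x` is primitive. -/
noncomputable def comul : UniversalEnvelopingAlgebra R L →ₐ[R]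
    UniversalEnvelopingAlgebra R L ⊗[R] UniversalEnvelopingAlgebra R L :=
  lift R
    { (Algebra.TensorProduct.includeLeft :
          UniversalEnvelopingAlgebra R L →ₐ[R] _).toLinearMap ∘ₗ (ι R).toLinearMap +
        (Algebra.TensorProduct.includeRight :
          UniversalEnvelopingAlgebra R L →ₐ[R] _).toLinearMap ∘ₗ (ι R).toLinearMap with
      map_lie' := by
        intro x y
        simp [LieRing.of_associative_ring_bracket, mul_add, add_mul, TensorProduct.sub_tmul,
          TensorProduct.tmul_sub]
        abel }

/-- The second Adams operation of the universal enveloping algebra. -/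
noncomputable def adams : Module.End R (UniversalEnvelopingAlgebra R L) :=
  LinearMap.mul' R _ ∘ₗ (comul R L).toLinearMap

variable {R L}

theorem comul_ι_pow (y : L) (n : ℕ) : comul R L (ι R y ^ n) =
    ∑ m ∈ Finset.range (n + 1), n.choose m • ((ι R y ^ m) ⊗ₜ[R] (ι R y ^ (n - m))) := by
  have h : comul R L (ι R y) = ι R y ⊗ₜ[R] 1 + 1 ⊗ₜ[R] ι R y := lift_ι_apply R _ y
  have hc : Commute (ι R y ⊗ₜ[R] (1 : UniversalEnvelopingAlgebra R L)) (1 ⊗ₜ[R] ι R y) := by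
    simp [commute_iff_eq]
  rw [map_pow, h, hc.add_pow]
  refine Finset.sum_congr rfl fun m _ => ?_
  simp only [Algebra.TensorProduct.tmul_pow, Algebra.TensorProduct.tmul_mul_tmul, one_pow, one_mul,
    mul_one]
  rw [nsmul_eq_mul, Nat.cast_comm]

theorem adams_ι_pow (y : L) (n : ℕ) : adams R L (ι R y ^ n) = (2 : R) ^ n • ι R y ^ n := by
  have h (m : ℕ) (hm : m ∈ Finset.range (n + 1)) :
      n.choose m • (ι R y ^ m * ι R y ^ (n - m)) = n.choose m • ι R y ^ n := by
    rw [← pow_add, Nat.add_sub_cancel' (Finset.mem_range_succ_iff.1 hm)]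
  rw [adams, LinearMap.comp_apply, AlgHom.toLinearMap_apply, comul_ι_pow, map_sum]
  simp only [map_nsmul, LinearMap.mul'_apply]
  rw [Finset.sum_congr rfl h, ← Finset.sum_smul, Nat.sum_range_choose, ← Nat.cast_smul_eq_nsmul R]
  simp

/-- Given `p : U(L) → L`, the map `U(L) → T(L)` obtained from the iterated comultiplication
`U(L) → U(L)^{⊗ n}` by applying `p` to each factor. -/
noncomputable def toTensorAlgebra (p : UniversalEnvelopingAlgebra R L →ₗ[R] L) :
    ℕ → UniversalEnvelopingAlgebra R L →ₗ[R] TensorAlgebra R L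
  | 0 => Algebra.linearMap R _ ∘ₗ (lift R (0 : L →ₗ⁅R⁆ R)).toLinearMap
  | n + 1 => LinearMap.mul' R _ ∘ₗ
      TensorProduct.map (TensorAlgebra.ι R ∘ₗ p) (toTensorAlgebra p n) ∘ₗ
      (comul R L).toLinearMap

theorem toTensorAlgebra_ι_pow {p : UniversalEnvelopingAlgebra R L →ₗ[R] L}
    (hp : ∀ y n, p (ι R y ^ n) = if n = 1 then y else 0) (n k : ℕ) (y : L) :
    toTensorAlgebra p n (ι R y ^ k) =
      if k = n then (n.factorial : R) • TensorAlgebra.ι R y ^ n else 0 := by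
  induction n generalizing k with
  | zero =>
    simp only [toTensorAlgebra, LinearMap.comp_apply, AlgHom.toLinearMap_apply, map_pow,
      lift_ι_apply]
    rcases k with _ | k <;> simp
  | succ n ih =>
    simp only [toTensorAlgebra, LinearMap.comp_apply, AlgHom.toLinearMap_apply, comul_ι_pow,
      map_sum, map_nsmul, TensorProduct.map_tmul, LinearMap.mul'_apply, hp, ih]
    rcases k with _ | k
    · simp
    · rw [Finset.sum_eq_single 1]
      · by_cases h : k = n
        · subst h
          simp only [if_true, Nat.choose_one_right, Nat.add_sub_cancel, Algebra.mul_smul_comm]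
          rw [← Nat.cast_smul_eq_nsmul R, smul_smul, ← pow_succ', Nat.factorial_succ]
          push_cast
          rfl
        · simp [h]
      · intro m _ hm
        simp [hm]
      · simp

end Comul

section Field

variable {K L : Type*} [Field K] [LieRing L] [LieAlgebra K L]

theorem exists_linearMap_ι_pow [CharZero K] (hι : Function.Injective (ι K (L := L))) :
    ∃ p : UniversalEnvelopingAlgebra K L →ₗ[K] L,
      ∀ y n, p (ι K y ^ n) = if n = 1 then y else 0 := by
  let F := ⨆ c : K, ⨆ (_ : c ≠ 2), (adams K L).eigenspace c
  have hF (y : L) (n : ℕ) (hn : n ≠ 1) : ι K y ^ n ∈ F := by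
    refine Submodule.mem_iSup_of_mem ((2 : K) ^ n) (Submodule.mem_iSup_of_mem ?_ ?_)
    · intro h
      refine hn (Nat.pow_right_injective le_rfl (a₁ := n) (a₂ := 1) ?_)
      simpa using (show 2 ^ n = 2 by exact_mod_cast h)
    · rw [Module.End.mem_eigenspace_iff, adams_ι_pow]
  have hq : LinearMap.ker (F.mkQ ∘ₗ (ι K (L := L)).toLinearMap) = ⊥ := by
    rw [LinearMap.ker_eq_bot']
    intro y hy
    have h1 : ι K y ∈ F := by simpa using hy
    have h2 : ι K y ∈ (adams K L).eigenspace 2 := by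
      rw [Module.End.mem_eigenspace_iff]
      simpa using adams_ι_pow (R := K) y 1
    refine (injective_iff_map_eq_zero (ι K (L := L))).1 hι y ?_
    exact Submodule.disjoint_def.1 ((adams K L).eigenspaces_iSupIndep 2) _ h2 h1
  obtain ⟨s, hs⟩ := LinearMap.exists_leftInverse_of_injective _ hq
  refine ⟨s ∘ₗ F.mkQ, fun y n => ?_⟩
  split_ifs with h
  · subst h
    simpa using LinearMap.congr_fun hs y
  · rw [LinearMap.comp_apply, Submodule.mkQ_apply, (Submodule.Quotient.mk_eq_zero F).2 (hF y n h),
      map_zero]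

variable (K L) in
/-- The span of the products of fewer than `n` elements of `L` in `U(L)`. -/
noncomputable def spanProdLT (n : ℕ) : Submodule K (UniversalEnvelopingAlgebra K L) :=
  Submodule.span K {u | ∃ l : List L, l.length < n ∧ u = (l.map (ι K)).prod}

theorem ι_mul_mem_spanProdLT (x : L) {n : ℕ} {u : UniversalEnvelopingAlgebra K L}
    (hu : u ∈ spanProdLT K L n) : ι K x * u ∈ spanProdLT K L (n + 1) := by
  induction hu using Submodule.span_induction with
  | mem u hu =>
    obtain ⟨l, hl, rfl⟩ := hu
    exact Submodule.subset_span ⟨x :: l, by simpa using hl, by simp⟩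
  | zero => simp
  | add u v _ _ hu hv => simpa [mul_add] using Submodule.add_mem _ hu hv
  | smul c u _ hu => simpa using Submodule.smul_mem _ c hu

theorem prod_sub_prod_mem_spanProdLT {l l' : List L} (h : l.Perm l') :
    (l.map (ι K)).prod - (l'.map (ι K)).prod ∈ spanProdLT K L l.length := by
  induction h with
  | nil => simp
  | cons x _ ih => simpa [mul_sub] using ι_mul_mem_spanProdLT x ih
  | swap x y l =>
    refine Submodule.subset_span ⟨⁅y, x⁆ :: l, by simp, ?_⟩
    simp [LieRing.of_associative_ring_bracket, sub_mul, mul_assoc]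
  | trans h _ ih ih' =>
    rw [← h.length_eq] at ih'
    simpa using Submodule.add_mem _ ih ih'

theorem span_prod_eq_top :
    Submodule.span K {u | ∃ l : List L, u = (l.map (ι K)).prod} = ⊤ := by
  refine eq_top_iff.2 fun u _ => ?_
  obtain ⟨t, rfl⟩ : ∃ t, mkAlgHom K L t = u := Quotient.exists_rep u
  induction t using TensorAlgebra.induction with
  | algebraMap r =>
    rw [AlgHom.commutes, Algebra.algebraMap_eq_smul_one]
    exact Submodule.smul_mem _ _ (Submodule.subset_span ⟨[], by simp⟩)
  | ι x => exact Submodule.subset_span ⟨[x], by simp⟩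
  | add a b ha hb =>
    rw [map_add]
    exact Submodule.add_mem _ (ha trivial) (hb trivial)
  | mul a b ha hb =>
    rw [map_mul]
    have := Submodule.mul_mem_mul (ha trivial) (hb trivial)
    rw [Submodule.span_mul_span] at this
    refine Submodule.span_mono ?_ this
    rintro _ ⟨_, ⟨l, rfl⟩, _, ⟨l', rfl⟩, rfl⟩
    exact ⟨l ++ l', by simp⟩

variable [Algebra ℚ K]

theorem list_prod_mem_map_symTensors (l : List L) :
    (l.map (ι K)).prod ∈ (symTensors K L).map (mkAlgHom K L).toLinearMap := by
  induction hn : l.length using Nat.strong_induction_on generalizing l with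
  | _ n ih =>
  have hlt : spanProdLT K L n ≤ (symTensors K L).map (mkAlgHom K L).toLinearMap := by
    rw [spanProdLT, Submodule.span_le]
    rintro _ ⟨l', hl', rfl⟩
    exact ih _ hl' l' rfl
  obtain ⟨x, rfl⟩ : ∃ x : Fin n → L, l = List.ofFn x := by
    subst hn
    exact ⟨l.get, (List.ofFn_get l).symm⟩
  have hsym := Submodule.mem_map_of_mem (f := (mkAlgHom K L).toLinearMap)
    (sum_perm_prod_mem_symTensors (K := K) x)
  have hdiff (σ : Equiv.Perm (Fin n)) : ((List.ofFn x).map (ι K)).prod -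
      mkAlgHom K L (List.ofFn fun i => TensorAlgebra.ι K (x (σ i))).prod ∈
      (symTensors K L).map (mkAlgHom K L).toLinearMap := by
    have h := prod_sub_prod_mem_spanProdLT (K := K) (Equiv.Perm.ofFn_comp_perm σ x).symm
    rw [List.length_ofFn] at h
    convert hlt h using 2
    rw [map_list_prod, List.map_ofFn, List.map_ofFn]
    rfl
  have hsum := Submodule.add_mem _ (Submodule.sum_mem _ fun σ (_ : σ ∈ Finset.univ) => hdiff σ) hsym
  rw [AlgHom.toLinearMap_apply, map_sum, ← Finset.sum_add_distrib] at hsum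
  simp only [sub_add_cancel, Finset.sum_const, Finset.card_univ, Fintype.card_perm,
    Fintype.card_fin] at hsum
  have := algebraRat.charZero K
  rw [← Nat.cast_smul_eq_nsmul K,
    Submodule.smul_mem_iff _ (by exact_mod_cast n.factorial_ne_zero)] at hsum
  exact hsum

theorem map_symTensors_eq_top : (symTensors K L).map (mkAlgHom K L).toLinearMap = ⊤ := by
  rw [eq_top_iff, ← span_prod_eq_top, Submodule.span_le]
  rintro _ ⟨l, rfl⟩
  exact list_prod_mem_map_symTensors l

theorem exists_sum_toTensorAlgebra_eq {p : UniversalEnvelopingAlgebra K L →ₗ[K] L}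
    (hp : ∀ y n, p (ι K y ^ n) = if n = 1 then y else 0) {z : TensorAlgebra K L}
    (hz : z ∈ symTensors K L) :
    ∃ N, ∀ M ≥ N, ∑ n ∈ Finset.range M,
      (n.factorial : K)⁻¹ • toTensorAlgebra p n (mkAlgHom K L z) = z := by
  have := algebraRat.charZero K
  rw [symTensors_eq_span_pow] at hz
  induction hz using Submodule.span_induction with
  | mem z hz =>
    obtain ⟨k, y, rfl⟩ := hz
    refine ⟨k + 1, fun M hM => ?_⟩
    have h : mkAlgHom K L (TensorAlgebra.ι K y ^ k) = ι K y ^ k := by simp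
    rw [h]
    simp only [toTensorAlgebra_ι_pow hp, smul_ite, smul_zero]
    rw [Finset.sum_ite_eq, if_pos (Finset.mem_range.2 hM), inv_smul_smul₀]
    exact_mod_cast k.factorial_ne_zero
  | zero => exact ⟨0, by simp⟩
  | add a b _ _ ha hb =>
    obtain ⟨N, hN⟩ := ha
    obtain ⟨N', hN'⟩ := hb
    refine ⟨max N N', fun M hM => ?_⟩
    simp only [map_add, smul_add, Finset.sum_add_distrib]
    rw [hN M (le_of_max_le_left hM), hN' M (le_of_max_le_right hM)]
  | smul c a _ ha =>
    obtain ⟨N, hN⟩ := ha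
    refine ⟨N, fun M hM => ?_⟩
    simp only [map_smul, smul_comm _ c]
    rw [← Finset.smul_sum, hN M hM]

/-- In characteristic zero, the symmetric Poincaré–Birkhoff–Witt theorem holds for every Lie
algebra that embeds in its universal enveloping algebra. -/
theorem bijective_mkAlgHom_symTensors (hι : Function.Injective (ι K (L := L))) :
    Function.Bijective (fun z : symTensors K L => mkAlgHom K L (z : TensorAlgebra K L)) := by
  have := algebraRat.charZero K
  constructor
  · obtain ⟨p, hp⟩ := exists_linearMap_ι_pow hι
    intro z w hzw
    obtain ⟨N, hN⟩ := exists_sum_toTensorAlgebra_eq hp z.2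
    obtain ⟨N', hN'⟩ := exists_sum_toTensorAlgebra_eq hp w.2
    ext
    rw [← hN _ (le_max_left N N'), ← hN' _ (le_max_right N N')]
    exact Finset.sum_congr rfl fun n _ => by rw [show mkAlgHom K L z = mkAlgHom K L w from hzw]
  · intro u
    have hu : u ∈ (symTensors K L).map (mkAlgHom K L).toLinearMap := by
      rw [map_symTensors_eq_top]
      trivial
    obtain ⟨z, hz, rfl⟩ := hu
    exact ⟨⟨z, hz⟩, rfl⟩

end Field

end UniversalEnvelopingAlgebra

section Free

attribute [local instance] LieRing.ofAssociativeRing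

namespace FreeLieAlgebra

variable {R X : Type*} [CommRing R]

theorem lieSubalgebra_eq_top (S : LieSubalgebra R (FreeLieAlgebra R X))
    (hS : ∀ a, of R a ∈ S) : S = ⊤ := by
  have h : S.incl.comp (lift R fun a => ⟨of R a, hS a⟩) = LieHom.id := by
    ext a
    simp
  refine eq_top_iff.2 fun x _ => ?_
  rw [← LieHom.id_apply (R := R) x, ← h]
  exact Subtype.property _

variable (R X) in
/-- The representation of the free Lie algebra `L` on `L × R` in which a generator `a` acts by
`(v, c) ↦ (⁅a, v⁆ + c • a, 0)`. -/
noncomputable def affineRep : FreeLieAlgebra R X →ₗ⁅R⁆ Module.End R (FreeLieAlgebra R X × R) :=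
  lift R fun a => LinearMap.inl R _ _ ∘ₗ
    ((LieAlgebra.ad R _ (of R a)).coprod (LinearMap.toSpanSingleton R _ (of R a)))

variable (R X) in
/-- The derivation of the free Lie algebra fixing the generators. -/
noncomputable def euler : Module.End R (FreeLieAlgebra R X) :=
  LinearMap.fst R _ _ ∘ₗ LinearMap.applyₗ ((0, 1) : FreeLieAlgebra R X × R) ∘ₗ (affineRep R X).toLinearMap

theorem affineRep_apply (x v : FreeLieAlgebra R X) (c : R) :
    affineRep R X x (v, c) = (⁅x, v⁆ + c • euler R X x, 0) := by
  let S : LieSubalgebra R (FreeLieAlgebra R X) :=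
    { carrier := {x | ∀ v c, affineRep R X x (v, c) = (⁅x, v⁆ + c • euler R X x, 0)}
      add_mem' := by
        intro x y hx hy v c
        rw [map_add, LinearMap.add_apply, hx, hy, map_add, add_lie, smul_add]
        ext
        · simp only [Prod.fst_add]
          abel
        · simp
      zero_mem' := by
        intro v c
        ext <;> simp
      smul_mem' := by
        intro t x hx v c
        rw [map_smul, LinearMap.smul_apply, hx, map_smul, smul_lie, smul_comm c t]
        ext <;> simp
      lie_mem' := by
        intro x y hx hy v c
        have key (v : FreeLieAlgebra R X) (c : R) : affineRep R X ⁅x, y⁆ (v, c) =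
            (⁅⁅x, y⁆, v⁆ + c • (⁅x, euler R X y⁆ - ⁅y, euler R X x⁆), 0) := by
          rw [LieHom.map_lie, LieRing.of_associative_ring_bracket, LinearMap.sub_apply,
            Module.End.mul_apply, Module.End.mul_apply, hx, hy, hx, hy]
          ext
          · simp only [Prod.fst_sub, lie_add, lie_smul, lie_lie, zero_smul, smul_sub]
            abel
          · simp
        have h : euler R X ⁅x, y⁆ = ⁅x, euler R X y⁆ - ⁅y, euler R X x⁆ := by
          simpa [euler] using congrArg Prod.fst (key 0 1)
        rw [h]
        exact key v c }
  have hS : S = ⊤ := by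
    refine lieSubalgebra_eq_top S fun a v c => ?_
    simp [euler, affineRep]
  have hx : x ∈ S := hS ▸ LieSubalgebra.mem_top x
  exact hx v c

theorem euler_of (a : X) : euler R X (of R a) = of R a := by
  simp [euler, affineRep]

theorem euler_lie (x y : FreeLieAlgebra R X) :
    euler R X ⁅x, y⁆ = ⁅x, euler R X y⁆ - ⁅y, euler R X x⁆ := by
  have h := congrArg Prod.fst (affineRep_apply ⁅x, y⁆ 0 1)
  rw [LieHom.map_lie, LieRing.of_associative_ring_bracket, LinearMap.sub_apply,
    Module.End.mul_apply, Module.End.mul_apply] at h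
  simp only [affineRep_apply] at h
  simpa using h.symm

end FreeLieAlgebra

namespace FreeLieAlgebra

variable {K X : Type*} [Field K] [CharZero K]

theorem iSup_eigenspace_euler :
    ⨆ n : ℕ, (euler K X).eigenspace (n + 1 : K) = ⊤ := by
  let S : LieSubalgebra K (FreeLieAlgebra K X) :=
    { (⨆ n : ℕ, (euler K X).eigenspace (n + 1 : K)) with
      lie_mem' := by
        intro x y hx hy
        change x ∈ ⨆ n : ℕ, (euler K X).eigenspace (n + 1 : K) at hx
        change y ∈ ⨆ n : ℕ, (euler K X).eigenspace (n + 1 : K) at hy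
        change ⁅x, y⁆ ∈ ⨆ n : ℕ, (euler K X).eigenspace (n + 1 : K)
        induction hx using Submodule.iSup_induction' with
        | zero => simp
        | add x x' _ _ hx hx' =>
          rw [add_lie]
          exact Submodule.add_mem _ hx hx'
        | mem n x hx =>
          induction hy using Submodule.iSup_induction' with
          | zero => simp
          | add y y' _ _ hy hy' =>
            rw [lie_add]
            exact Submodule.add_mem _ hy hy'
          | mem m y hy =>
            refine Submodule.mem_iSup_of_mem (n + m + 1) ?_
            rw [Module.End.mem_eigenspace_iff] at hx hy ⊢
            rw [euler_lie, hx, hy, lie_smul, lie_smul, ← lie_skew x y, smul_neg]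
            push_cast
            module }
  have hS : S = ⊤ := by
    refine lieSubalgebra_eq_top S fun a => ?_
    refine Submodule.mem_iSup_of_mem 0 ?_
    simp [euler_of]
  exact congrArg LieSubalgebra.toSubmodule hS

theorem euler_injective : Function.Injective (euler K X) := by
  rw [← LinearMap.ker_eq_bot, ← Module.End.eigenspace_zero, ← disjoint_self]
  refine ((euler K X).eigenspaces_iSupIndep 0).mono_right ?_
  refine le_top.trans (iSup_eigenspace_euler.ge.trans (iSup_le fun n => ?_))
  exact le_iSup₂_of_le (n + 1 : K) (by exact_mod_cast n.succ_ne_zero) le_rfl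

theorem universalEnvelopingAlgebra_ι_injective :
    Function.Injective (UniversalEnvelopingAlgebra.ι K (L := FreeLieAlgebra K X)) := by
  refine (injective_iff_map_eq_zero (UniversalEnvelopingAlgebra.ι K)).2 fun x hx => ?_
  have h : affineRep K X x = 0 := by
    rw [← UniversalEnvelopingAlgebra.lift_ι_apply K (affineRep K X), hx, map_zero]
  refine (injective_iff_map_eq_zero (euler K X)).1 euler_injective x ?_
  simp [euler, h]

end FreeLieAlgebra

end Free

/-- The symmetric Poincaré–Birkhoff–Witt theorem holds for free Lie algebras over `ℚ`:
the restriction of the canonical map `m : T(g) → U(g)` to the submodule of symmetric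
tensors is bijective, for `g = FreeLieAlgebra ℚ Λ`. -/
theorem symmetric_pbw_freeLieAlgebra (Λ : Type*) :
    Function.Bijective (fun p : symTensors ℚ (FreeLieAlgebra ℚ Λ) =>
      UniversalEnvelopingAlgebra.mkAlgHom ℚ (FreeLieAlgebra ℚ Λ)
        (p : TensorAlgebra ℚ (FreeLieAlgebra ℚ Λ))) := by
  exact UniversalEnvelopingAlgebra.bijective_mkAlgHom_symTensors
    FreeLieAlgebra.universalEnvelopingAlgebra_ι_injective
end

section
/- For every commutative ring K and every type Λ, the underlying K-module of the free Lie algebra FreeLieAlgebra K Λ is a free K-module. -/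
namespace List

variable {α : Type*}

theorem suffix_append_cases {s u v : List α} (h : s <:+ u ++ v) :
    s <:+ v ∨ ∃ r, r ≠ [] ∧ r <:+ u ∧ s = r ++ v := by
  obtain ⟨p, hp⟩ := h
  rcases List.append_eq_append_iff.1 hp with ⟨a, rfl, rfl⟩ | ⟨c, rfl, rfl⟩
  · rcases eq_or_ne a [] with rfl | ha
    · exact .inl ⟨[], rfl⟩
    · exact .inr ⟨a, ha, ⟨p, rfl⟩, rfl⟩
  · exact .inl ⟨c, rfl⟩

theorem suffix_tail_of_suffix_of_ne {s w : List α} (h : s <:+ w) (hne : s ≠ w) : s <:+ w.tail := by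
  cases w with
  | nil => exact h
  | cons a w => exact (List.suffix_cons_iff.1 h).resolve_left hne

variable [LinearOrder α]

theorem append_lt_append_left_iff (s : List α) {x y : List α} : s ++ x < s ++ y ↔ x < y := by
  induction s with
  | nil => rfl
  | cons a s ih => simp [ih]

theorem self_le_append (s t : List α) : s ≤ s ++ t := by
  induction s with
  | nil => exact not_lt.1 (List.not_lt_nil _)
  | cons a s ih => exact List.cons_le_cons a ih

theorem append_lt_append_of_lt_of_not_prefix {u s : List α} (h : u < s) (hp : ¬ u <+: s)
    (x y : List α) : u ++ x < s ++ y := by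
  induction u generalizing s with
  | nil => exact absurd (List.nil_prefix) hp
  | cons a u ih =>
    cases s with
    | nil => exact absurd h (List.not_lt_nil _)
    | cons b s =>
      rw [List.cons_lt_cons_iff] at h
      simp only [List.cons_append, List.cons_lt_cons_iff]
      rcases h with h | ⟨rfl, h⟩
      · exact .inl h
      · exact .inr ⟨rfl, ih h fun hne => hp (by simpa using hne)⟩

theorem append_lt_append_of_lt_of_length_eq {u s : List α} (h : u < s)
    (hl : u.length = s.length) (x y : List α) : u ++ x < s ++ y :=
  append_lt_append_of_lt_of_not_prefix h (fun hp => h.ne (hp.eq_of_length hl)) x y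

/-- A Lyndon word is a nonempty word that is minimal among its nonempty suffixes. -/
def IsLyndon (w : List α) : Prop :=
  w ≠ [] ∧ ∀ s, s <:+ w → s ≠ [] → w ≤ s

theorem isLyndon_singleton (a : α) : IsLyndon [a] := by
  refine ⟨by simp, fun s hs hs' => ?_⟩
  rw [List.suffix_cons_iff] at hs
  rcases hs with rfl | hs
  · exact le_rfl
  · exact absurd (List.suffix_nil.1 hs) hs'

theorem IsLyndon.append {u v : List α} (hu : IsLyndon u) (hv : IsLyndon v) (h : u < v) :
    IsLyndon (u ++ v) := by
  have huv : u ++ v < v := by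
    by_cases hp : u <+: v
    · obtain ⟨t, rfl⟩ := hp
      have ht : t ≠ [] := by rintro rfl; simp at h
      rw [append_lt_append_left_iff]
      refine lt_of_le_of_ne (hv.2 t (List.suffix_append _ _) ht) fun e => hu.1 ?_
      simpa using e
    · simpa using append_lt_append_of_lt_of_not_prefix h hp v []
  refine ⟨by simp [hu.1], fun s hs hs' => ?_⟩
  rcases suffix_append_cases hs with hs | ⟨r, hr, hru, rfl⟩
  · exact huv.le.trans (hv.2 s hs hs')
  · rcases (hu.2 r hru hr).eq_or_lt with e | hlt
    · rw [← e]
    · refine (append_lt_append_of_lt_of_not_prefix hlt (fun hp => hlt.ne ?_) v v).le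
      exact hp.eq_of_length_le hru.length_le

theorem IsLyndon.append_lt {u v : List α} (h : IsLyndon (u ++ v)) (hu : u ≠ []) (hv : v ≠ []) :
    u ++ v < v :=
  lt_of_le_of_ne (h.2 v (List.suffix_append _ _) hv) (by simpa using hu)

/-- The lexicographically smallest nonempty suffix of a nonempty word. -/
def minSuffix : List α → List α
  | [] => []
  | [a] => [a]
  | a :: b :: t => min (a :: b :: t) (minSuffix (b :: t))

theorem minSuffix_suffix : ∀ w : List α, minSuffix w <:+ w
  | [] => List.suffix_refl _
  | [_] => List.suffix_refl _
  | a :: b :: t => by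
    rw [minSuffix]
    rcases min_choice (a :: b :: t) (minSuffix (b :: t)) with h | h <;> rw [h]
    exact (minSuffix_suffix (b :: t)).trans (List.suffix_cons _ _)

theorem minSuffix_ne_nil : ∀ w : List α, w ≠ [] → minSuffix w ≠ []
  | [], h => absurd rfl h
  | [_], _ => by simp [minSuffix]
  | a :: b :: t, _ => by
    rw [minSuffix]
    rcases min_choice (a :: b :: t) (minSuffix (b :: t)) with h | h <;> rw [h]
    · simp
    · exact minSuffix_ne_nil _ (by simp)

theorem minSuffix_le : ∀ (w s : List α), s <:+ w → s ≠ [] → minSuffix w ≤ s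
  | [], s, h, hne => absurd (List.suffix_nil.1 h) hne
  | [a], s, h, hne => (isLyndon_singleton a).2 s h hne
  | a :: b :: t, s, h, hne => by
    rw [minSuffix]
    rcases List.suffix_cons_iff.1 h with rfl | h
    · exact min_le_left _ _
    · exact (min_le_right _ _).trans (minSuffix_le _ s h hne)

/-- `(u, v)` is the standard factorization of the word `u ++ v`: both parts are nonempty and `v`
is the smallest proper nonempty suffix. -/
structure IsStandard (u v : List α) : Prop where
  left_ne_nil : u ≠ []
  right_ne_nil : v ≠ []
  right_le : ∀ s, s <:+ (u ++ v).tail → s ≠ [] → v ≤ s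

theorem IsStandard.minSuffix_tail {u v : List α} (h : IsStandard u v) :
    minSuffix (u ++ v).tail = v := by
  have hs : v <:+ (u ++ v).tail := by
    rw [List.tail_append_of_ne_nil h.left_ne_nil]
    exact List.suffix_append _ _
  have hne : (u ++ v).tail ≠ [] := fun e => h.right_ne_nil (List.suffix_nil.1 (e ▸ hs))
  exact le_antisymm (minSuffix_le _ v hs h.right_ne_nil)
    (h.right_le _ (minSuffix_suffix _) (minSuffix_ne_nil _ hne))

theorem IsStandard.right_le_append {u v r : List α} (h : IsStandard u v) (hr : r <:+ u.tail) :
    v ≤ r ++ v := by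
  refine h.right_le _ ?_ (by simp [h.right_ne_nil])
  rw [List.tail_append_of_ne_nil h.left_ne_nil]
  obtain ⟨p, hp⟩ := hr
  exact ⟨p, by rw [← hp, List.append_assoc]⟩

theorem IsStandard.isLyndon_right {u v : List α} (h : IsStandard u v) : IsLyndon v := by
  refine ⟨h.right_ne_nil, fun s hs hs' => h.right_le s ?_ hs'⟩
  rw [List.tail_append_of_ne_nil h.left_ne_nil]
  exact hs.trans (List.suffix_append _ _)

theorem IsStandard.isLyndon_left {u v : List α} (h : IsStandard u v) (hw : IsLyndon (u ++ v)) :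
    IsLyndon u := by
  refine ⟨h.left_ne_nil, fun s hs hs' => ?_⟩
  by_contra! hlt
  have hst : s <:+ u.tail := suffix_tail_of_suffix_of_ne hs hlt.ne
  have hle : u ++ v ≤ s ++ v := hw.2 _ (by obtain ⟨p, rfl⟩ := hs; simp) (by simp [hs'])
  by_cases hp : s <+: u
  · obtain ⟨t, rfl⟩ := hp
    have ht : t ≠ [] := by rintro rfl; simp at hlt
    rw [List.append_assoc, ← not_lt, append_lt_append_left_iff, not_lt] at hle
    have h1 : v ≤ t ++ v := h.right_le_append (r := t) (by
      rw [List.tail_append_of_ne_nil hs']; exact List.suffix_append _ _)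
    exact ht (by simpa using le_antisymm hle h1)
  · exact hle.not_gt (append_lt_append_of_lt_of_not_prefix hlt hp v v)

theorem exists_isStandard {w : List α} (hw : 2 ≤ w.length) :
    ∃ u v, IsStandard u v ∧ u ++ v = w := by
  have hne : w.tail ≠ [] := by
    intro e
    have := congrArg List.length e
    simp at this
    omega
  obtain ⟨p, hp⟩ := minSuffix_suffix w.tail
  obtain _ | ⟨a, t⟩ := w
  · simp at hw
  refine ⟨a :: p, minSuffix t, ⟨by simp, minSuffix_ne_nil t hne, ?_⟩, by simpa using hp⟩
  intro s hs hs'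
  have hp' : p ++ minSuffix t = t := hp
  simp only [List.cons_append, List.tail_cons, hp'] at hs
  exact minSuffix_le _ _ hs hs'

theorem isStandard_singleton {a : α} {v : List α} (hv : IsLyndon v) : IsStandard [a] v :=
  ⟨by simp, hv.1, fun s hs hs' => hv.2 s hs hs'⟩

theorem IsStandard.append {u₁ u₂ v : List α} (h : IsStandard u₁ u₂) (hv : IsLyndon v)
    (hle : v ≤ u₂) : IsStandard (u₁ ++ u₂) v := by
  refine ⟨by simp [h.left_ne_nil], hv.1, fun s hs hs' => ?_⟩
  rw [List.tail_append_of_ne_nil (by simp [h.left_ne_nil])] at hs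
  rcases suffix_append_cases hs with hs | ⟨r, hr, hru, rfl⟩
  · exact hv.2 s hs hs'
  · exact hle.trans ((h.right_le r hru hr).trans (self_le_append r v))

theorem finite_setOf_subperm (l : List α) : {x : List α | x <+~ l}.Finite := by
  refine (l.permutations.flatMap List.sublists).toFinset.finite_toSet.subset fun x hx => ?_
  obtain ⟨y, hy, hyl⟩ := List.subperm_iff.1 hx
  simp only [Finset.mem_coe, List.mem_toFinset, List.mem_flatMap, List.mem_permutations,
    List.mem_sublists]
  exact ⟨y, hy, hyl⟩
end List

theorem linearIndependent_of_coeff_triangular {K M ι : Type*} [CommRing K]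
    [AddCommGroup M] [Module K M] [LinearOrder ι] (b : ι → M) (c : ι → M →ₗ[K] K)
    (h₁ : ∀ i, c i (b i) = 1) (h₂ : ∀ i j, i < j → c i (b j) = 0) : LinearIndependent K b := by
  rw [linearIndependent_iff]
  intro l hl
  by_contra hne
  have hs := Finsupp.support_nonempty_iff.2 hne
  set i := l.support.min' hs
  have hi : i ∈ l.support := l.support.min'_mem hs
  refine Finsupp.mem_support_iff.1 hi ?_
  have h := congrArg (c i) hl
  rw [Finsupp.linearCombination_apply, Finsupp.sum, map_sum, map_zero,
    Finset.sum_eq_single_of_mem i hi] at h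
  · simpa [h₁] using h
  · intro j hj hji
    rw [map_smul, h₂ i j (lt_of_le_of_ne (l.support.min'_le j hj) hji.symm), smul_zero]

namespace FreeLieAlgebra

open List

variable {Λ : Type*} [LinearOrder Λ] {L : Type*} [LieRing L]

/-- The iterated bracket of a word prescribed by its successive standard factorizations. -/
def standardBracket (f : Λ → L) : List Λ → L
  | [] => 0
  | [a] => f a
  | a :: b :: t =>
    ⁅standardBracket f ((a :: b :: t).take ((a :: b :: t).length - (minSuffix (b :: t)).length)),
      standardBracket f (minSuffix (b :: t))⁆
  termination_by w => w.length
  decreasing_by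
    · have := List.length_pos_of_ne_nil (minSuffix_ne_nil (b :: t) (by simp))
      simp only [List.length_take, List.length_cons]
      omega
    · have := (minSuffix_suffix (b :: t)).length_le
      simp only [List.length_cons] at this ⊢
      omega

theorem standardBracket_append (f : Λ → L) {u v : List Λ} (h : IsStandard u v) :
    standardBracket f (u ++ v) = ⁅standardBracket f u, standardBracket f v⁆ := by
  have hm := h.minSuffix_tail
  obtain ⟨a, b, t, e⟩ : ∃ a b t, u ++ v = a :: b :: t := by
    obtain ⟨a, u', rfl⟩ := List.exists_cons_of_ne_nil h.left_ne_nil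
    obtain ⟨b, t, e⟩ := List.exists_cons_of_ne_nil (l := u' ++ v) (by simp [h.right_ne_nil])
    exact ⟨a, b, t, by simp [e]⟩
  rw [e, List.tail_cons] at hm
  rw [e, standardBracket, hm, ← e]
  simp

section Span

variable (K : Type*) [CommRing K] [LieAlgebra K L]

/-- The span of the standard brackets of the Lyndon words that are rearrangements of `l` and
smaller than `m`. -/
def lyndonSpan (f : Λ → L) (l m : List Λ) : Submodule K L :=
  Submodule.span K (standardBracket f '' {w | IsLyndon w ∧ w ~ l ∧ w < m})

variable {K}

theorem lyndonSpan_mono (f : Λ → L) {l l' m m' : List Λ} (hl : l ~ l') (hm : m ≤ m') :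
    lyndonSpan K f l m ≤ lyndonSpan K f l' m' :=
  Submodule.span_mono <| Set.image_mono fun _ hw => ⟨hw.1, hw.2.1.trans hl, hw.2.2.trans_le hm⟩

theorem lie_mem_of_forall_mem_lyndonSpan {f : Λ → L} {l m : List Λ} {x y : L} {N : Submodule K L}
    (hy : y ∈ lyndonSpan K f l m)
    (h : ∀ w, IsLyndon w → w ~ l → w < m → ⁅x, standardBracket f w⁆ ∈ N) : ⁅x, y⁆ ∈ N := by
  have : lyndonSpan K f l m ≤ N.comap (LieAlgebra.ad K L x) := by
    refine Submodule.span_le.2 ?_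
    rintro _ ⟨w, ⟨h1, h2, h3⟩, rfl⟩
    exact h w h1 h2 h3
  exact this hy

theorem lie_mem_lyndonSpan_max {f : Λ → L} {u v l m : List Λ}
    (hu : IsLyndon u) (hv : IsLyndon v) (hum : u < m) (hvm : v < m) (hl : u ++ v ~ l)
    (h : ∀ u v, IsLyndon u → IsLyndon v → u < v → v < m → u ++ v ~ l →
      ⁅standardBracket f u, standardBracket f v⁆ ∈ lyndonSpan K f l v) :
    ⁅standardBracket f u, standardBracket f v⁆ ∈ lyndonSpan K f l m := by
  rcases lt_trichotomy u v with huv | rfl | huv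
  · exact lyndonSpan_mono f (.refl _) hvm.le (h u v hu hv huv hvm hl)
  · rw [lie_self]
    exact Submodule.zero_mem _
  · rw [← lie_skew]
    exact Submodule.neg_mem _ (lyndonSpan_mono f (.refl _) hum.le
      (h v u hv hu huv hum (List.perm_append_comm.trans hl)))

/-- The bracket of the standard brackets of two Lyndon words `u < v` is a combination of standard
brackets of Lyndon words smaller than `v`. -/
theorem lie_mem_lyndonSpan (f : Λ → L) {l u v : List Λ} (hu : IsLyndon u) (hv : IsLyndon v)
    (huv : u < v) (hl : u ++ v ~ l) :
    ⁅standardBracket f u, standardBracket f v⁆ ∈ lyndonSpan K f l v := by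
  induction hln : l.length using Nat.strong_induction_on generalizing l u v with
  | _ n ihn =>
  have hvl : v <+~ l := (List.sublist_append_right u v).subperm.trans hl.subperm
  suffices H : ∀ u, IsLyndon u → IsLyndon v → u < v → u ++ v ~ l →
      ⁅standardBracket f u, standardBracket f v⁆ ∈ lyndonSpan K f l v from H u hu hv huv hl
  clear hu hv huv hl u
  refine (finite_setOf_subperm l).wellFoundedOn (r := (· < ·)) |>.induction
    (P := fun v => ∀ u, IsLyndon u → IsLyndon v → u < v → u ++ v ~ l →
      ⁅standardBracket f u, standardBracket f v⁆ ∈ lyndonSpan K f l v) hvl ?_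
  intro v _ ihv u hu hv huv hl
  have hmax : ∀ x w, IsLyndon x → IsLyndon w → x < v → w < v → x ++ w ~ l →
      ⁅standardBracket f x, standardBracket f w⁆ ∈ lyndonSpan K f l v :=
    fun x w hx hw hxv hwv hxw => lie_mem_lyndonSpan_max hx hw hxv hwv hxw
      fun a b ha hb hab hbv hl' => ihv b
        ((List.sublist_append_right a b).subperm.trans hl'.subperm) hbv a ha hb hab hl'
  have hstd : IsStandard u v →
      ⁅standardBracket f u, standardBracket f v⁆ ∈ lyndonSpan K f l v := fun h => by
    rw [← standardBracket_append f h]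
    exact Submodule.subset_span ⟨_, ⟨hu.append hv huv, hl,
      (hu.append hv huv).append_lt hu.1 hv.1⟩, rfl⟩
  rcases Nat.lt_or_ge u.length 2 with h2 | h2
  · obtain ⟨a, rfl⟩ : ∃ a, u = [a] := List.length_eq_one_iff.1 <| by
      have := List.length_pos_of_ne_nil hu.1
      omega
    exact hstd (isStandard_singleton hv)
  obtain ⟨u₁, u₂, hs, rfl⟩ := exists_isStandard h2
  rcases le_or_gt v u₂ with hle | hlt
  · exact hstd (hs.append hv hle)
  have hu₁ := hs.isLyndon_left hu
  have hu₂ := hs.isLyndon_right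
  have h₁v : u₁ < v := (self_le_append u₁ u₂).trans_lt huv
  have hlen := hl.length_eq
  simp only [List.length_append] at hlen
  have hpos₁ := List.length_pos_of_ne_nil hu₁.1
  have hpos₂ := List.length_pos_of_ne_nil hu₂.1
  have hswap : u₂ ++ (u₁ ++ v) ~ l := by
    rw [← List.append_assoc]
    exact (List.perm_append_comm.append_right v).trans hl
  rw [List.append_assoc] at hl
  rw [standardBracket_append f hs, lie_lie]
  refine Submodule.sub_mem _ ?_ ?_
  · exact lie_mem_of_forall_mem_lyndonSpan
      (ihn _ (by simp only [List.length_append]; omega) hu₂ hv hlt (.refl _) rfl)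
      fun w hw hwl hwv => hmax u₁ w hu₁ hw h₁v hwv ((hwl.append_left u₁).trans hl)
  · exact lie_mem_of_forall_mem_lyndonSpan
      (ihn _ (by simp only [List.length_append]; omega) hu₁ hv h₁v (.refl _) rfl)
      fun w hw hwl hwv => hmax u₂ w hu₂ hw hlt hwv ((hwl.append_left u₂).trans hswap)

theorem lie_mem_span_standardBracket (f : Λ → L) {u v : List Λ} (hu : IsLyndon u)
    (hv : IsLyndon v) : ⁅standardBracket f u, standardBracket f v⁆ ∈
      Submodule.span K (standardBracket f '' {w | IsLyndon w}) := by
  have key : ∀ u v : List Λ, IsLyndon u → IsLyndon v → u < v →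
      ⁅standardBracket f u, standardBracket f v⁆ ∈
        Submodule.span K (standardBracket f '' {w | IsLyndon w}) := fun u v hu hv huv =>
    Submodule.span_mono (Set.image_mono fun _ hw => hw.1)
      (lie_mem_lyndonSpan (K := K) f hu hv huv (.refl _))
  rcases lt_trichotomy u v with huv | rfl | huv
  · exact key u v hu hv huv
  · rw [lie_self]
    exact Submodule.zero_mem _
  · rw [← lie_skew]
    exact Submodule.neg_mem _ (key v u hv hu huv)

variable (K) in
/-- The Lie subalgebra spanned by the standard brackets of Lyndon words. -/
def lyndonSubalgebra (f : Λ → L) : LieSubalgebra K L where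
  __ := Submodule.span K (standardBracket f '' {w | IsLyndon w})
  lie_mem' {x y} hx hy := by
    refine (LinearMap.BilinMap.apply_apply_mem_of_mem_span
      (Submodule.span K (standardBracket f '' {w | IsLyndon w})) _ _
      (LieAlgebra.ad K L : L →ₗ[K] L →ₗ[K] L) ?_ x y hx hy)
    rintro _ ⟨u, hu, rfl⟩ _ ⟨v, hv, rfl⟩
    exact lie_mem_span_standardBracket f hu hv

end Span

theorem span_standardBracket_eq_top (K : Type*) [CommRing K] :
    Submodule.span K (standardBracket (FreeLieAlgebra.of K (X := Λ)) '' {w | IsLyndon w}) = ⊤ := by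
  set f := FreeLieAlgebra.of K (X := Λ)
  have hf : ∀ a, f a ∈ lyndonSubalgebra K f := fun a =>
    Submodule.subset_span ⟨[a], isLyndon_singleton a, by rw [standardBracket]⟩
  have hid : (lyndonSubalgebra K f).incl.comp (FreeLieAlgebra.lift K fun a => ⟨f a, hf a⟩) =
      LieHom.id := by
    refine FreeLieAlgebra.hom_ext fun a => ?_
    simp [f]
  refine eq_top_iff.2 fun x _ => ?_
  have hx := congrArg (fun g => g x) hid
  simp only [LieHom.comp_apply, LieHom.id_apply] at hx
  rw [← hx]
  exact (FreeLieAlgebra.lift K (fun a => (⟨f a, hf a⟩ : lyndonSubalgebra K f)) x).2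

theorem map_standardBracket {K L L' : Type*} [CommRing K] [LieRing L] [LieAlgebra K L]
    [LieRing L'] [LieAlgebra K L'] (φ : L →ₗ⁅K⁆ L') (f : Λ → L) (w : List Λ) :
    φ (standardBracket f w) = standardBracket (φ ∘ f) w := by
  induction w using standardBracket.induct with
  | case1 => simp [standardBracket]
  | case2 a => simp [standardBracket]
  | case3 a b t h₁ h₂ => rw [standardBracket, standardBracket, LieHom.map_lie, h₁, h₂]

section WordSpan

variable {α : Type*} (K : Type*) [CommRing K]

/-- The submodule of the monoid algebra of words spanned by a set of words. -/
noncomputable def wordSpan (S : Set (List α)) : Submodule K (MonoidAlgebra K (FreeMonoid α)) :=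
  Submodule.span K ((fun x => MonoidAlgebra.of K _ (FreeMonoid.ofList x)) '' S)

variable {K}

theorem mul_mem_wordSpan {S T U : Set (List α)} (h : ∀ x ∈ S, ∀ y ∈ T, x ++ y ∈ U)
    {p q : MonoidAlgebra K (FreeMonoid α)} (hp : p ∈ wordSpan K S) (hq : q ∈ wordSpan K T) :
    p * q ∈ wordSpan K U := by
  have hpq := Submodule.mul_mem_mul hp hq
  rw [wordSpan, wordSpan, Submodule.span_mul_span] at hpq
  refine Submodule.span_le.2 ?_ hpq
  rintro _ ⟨_, ⟨x, hx, rfl⟩, _, ⟨y, hy, rfl⟩, rfl⟩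
  refine Submodule.subset_span ⟨x ++ y, h x hx y hy, ?_⟩
  simp only [FreeMonoid.ofList_append, map_mul]

theorem coeff_eq_zero_of_mem_wordSpan {S : Set (List α)} {p : MonoidAlgebra K (FreeMonoid α)}
    (hp : p ∈ wordSpan K S) {x : List α} (hx : x ∉ S) : p.coeff (FreeMonoid.ofList x) = 0 := by
  induction hp using Submodule.span_induction with
  | mem p hp =>
    obtain ⟨y, hy, rfl⟩ := hp
    have : y ≠ x := fun e => hx (e ▸ hy)
    simp [this]
  | zero => simp
  | add p q _ _ hp hq => simp [hp, hq]
  | smul c p _ hp => simp [hp]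

end WordSpan

section Triangular

variable {K : Type*} [CommRing K]

attribute [local instance] LieRing.ofAssociativeRing

/-- In the free associative algebra, the standard bracket of a Lyndon word is the word itself plus a
combination of larger words of the same length. -/
theorem standardBracket_sub_mem_wordSpan {w : List Λ} (hw : IsLyndon w) :
    standardBracket (fun a => MonoidAlgebra.of K (FreeMonoid Λ) (FreeMonoid.of a)) w -
      MonoidAlgebra.of K _ (FreeMonoid.ofList w) ∈
        wordSpan K {x : List Λ | x.length = w.length ∧ w < x} := by
  induction hn : w.length using Nat.strong_induction_on generalizing w with
  | _ n ih =>
  rcases Nat.lt_or_ge w.length 2 with h2 | h2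
  · obtain ⟨a, rfl⟩ : ∃ a, w = [a] := List.length_eq_one_iff.1 <| by
      have := List.length_pos_of_ne_nil hw.1
      omega
    rw [standardBracket, FreeMonoid.ofList_singleton, sub_self]
    exact Submodule.zero_mem _
  obtain ⟨u, v, hs, rfl⟩ := exists_isStandard h2
  have hpos₁ := List.length_pos_of_ne_nil hs.left_ne_nil
  have hpos₂ := List.length_pos_of_ne_nil hs.right_ne_nil
  rw [List.length_append] at hn
  subst hn
  have hu := ih _ (by omega) (hs.isLyndon_left hw) rfl
  have hv := ih _ (by omega) hs.isLyndon_right rfl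
  rw [standardBracket_append _ hs, LieRing.of_associative_ring_bracket]
  set p := standardBracket (fun a => MonoidAlgebra.of K (FreeMonoid Λ) (FreeMonoid.of a)) u
  set q := standardBracket (fun a => MonoidAlgebra.of K (FreeMonoid Λ) (FreeMonoid.of a)) v
  have hle : ∀ {y : List Λ} {r : MonoidAlgebra K (FreeMonoid Λ)},
      r - MonoidAlgebra.of K _ (FreeMonoid.ofList y) ∈
        wordSpan K {x : List Λ | x.length = y.length ∧ y < x} →
      r ∈ wordSpan K {x : List Λ | x.length = y.length ∧ y ≤ x} := fun {y r} hr => by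
    rw [← sub_add_cancel r (MonoidAlgebra.of K _ (FreeMonoid.ofList y))]
    have hsub : {x : List Λ | x.length = y.length ∧ y < x} ⊆ {x | x.length = y.length ∧ y ≤ x} :=
      fun x hx => ⟨hx.1, hx.2.le⟩
    exact Submodule.add_mem _ (Submodule.span_mono (Set.image_mono hsub) hr)
      (Submodule.subset_span ⟨y, ⟨rfl, le_rfl⟩, rfl⟩)
  have happ : ∀ {x y x' y' : List Λ}, x'.length = x.length → x ≤ x' → y ≤ y' →
      x ++ y ≤ x' ++ y' := fun {x y x' y'} hl hx hy => by
    rcases hx.eq_or_lt with rfl | hx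
    · rwa [← not_lt, append_lt_append_left_iff, not_lt]
    · exact (append_lt_append_of_lt_of_length_eq hx hl.symm _ _).le
  have huv : u ++ v < v ++ u :=
    (hw.append_lt hs.left_ne_nil hs.right_ne_nil).trans_le (self_le_append v u)
  have e : p * q - q * p - MonoidAlgebra.of K _ (FreeMonoid.ofList (u ++ v)) =
      (p - MonoidAlgebra.of K _ (FreeMonoid.ofList u)) * q +
        MonoidAlgebra.of K _ (FreeMonoid.ofList u) *
          (q - MonoidAlgebra.of K _ (FreeMonoid.ofList v)) - q * p := by
    rw [FreeMonoid.ofList_append, map_mul]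
    noncomm_ring
  rw [e]
  refine Submodule.sub_mem _ (Submodule.add_mem _ ?_ ?_) ?_
  · refine mul_mem_wordSpan ?_ hu (hle hv)
    rintro x ⟨hx, hux⟩ y ⟨hy, -⟩
    exact ⟨by simp [hx, hy], append_lt_append_of_lt_of_length_eq hux hx.symm _ _⟩
  · refine mul_mem_wordSpan (S := {u}) ?_ (Submodule.subset_span (Set.mem_image_of_mem _ rfl)) hv
    rintro _ rfl y ⟨hy, hvy⟩
    exact ⟨by simp [hy], (append_lt_append_left_iff _).2 hvy⟩
  · refine mul_mem_wordSpan ?_ (hle hv) (hle hu)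
    rintro x ⟨hx, hvx⟩ y ⟨hy, huy⟩
    exact ⟨by simp [hx, hy, add_comm], huv.trans_le (happ hx hvx huy)⟩

theorem coeff_standardBracket_self {w : List Λ} (hw : IsLyndon w) :
    (standardBracket (fun a => MonoidAlgebra.of K (FreeMonoid Λ) (FreeMonoid.of a)) w).coeff
      (FreeMonoid.ofList w) = 1 := by
  have h := coeff_eq_zero_of_mem_wordSpan (standardBracket_sub_mem_wordSpan (K := K) hw)
    (x := w) fun h => lt_irrefl _ h.2
  simpa [sub_eq_zero] using h

theorem coeff_standardBracket_of_lt {w x : List Λ} (hw : IsLyndon w) (hx : x < w) :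
    (standardBracket (fun a => MonoidAlgebra.of K (FreeMonoid Λ) (FreeMonoid.of a)) w).coeff
      (FreeMonoid.ofList x) = 0 := by
  have h := coeff_eq_zero_of_mem_wordSpan (standardBracket_sub_mem_wordSpan (K := K) hw)
    (x := x) fun h => hx.not_gt h.2
  simpa [hx.ne'] using h

theorem linearIndependent_standardBracket :
    LinearIndependent K fun w : {w : List Λ // IsLyndon w} =>
      standardBracket (FreeLieAlgebra.of K (X := Λ)) w := by
  let f : Λ → MonoidAlgebra K (FreeMonoid Λ) := fun a => MonoidAlgebra.of K _ (FreeMonoid.of a)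
  let φ := FreeLieAlgebra.lift K f
  have hφ : ∀ w, φ (standardBracket (FreeLieAlgebra.of K) w) = standardBracket f w := fun w => by
    rw [map_standardBracket, FreeLieAlgebra.of_comp_lift]
  let coeffHom (x : List Λ) : MonoidAlgebra K (FreeMonoid Λ) →ₗ[K] K :=
    { toFun := fun p => p.coeff (FreeMonoid.ofList x)
      map_add' := fun p q => by simp
      map_smul' := fun c p => by simp }
  refine linearIndependent_of_coeff_triangular _
    (fun w => coeffHom w ∘ₗ (φ : FreeLieAlgebra K Λ →ₗ[K] MonoidAlgebra K (FreeMonoid Λ))) ?_ ?_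
  · rintro ⟨w, hw⟩
    exact (congrArg (coeffHom w) (hφ w)).trans (coeff_standardBracket_self hw)
  · rintro ⟨x, _⟩ ⟨w, hw⟩ hlt
    exact (congrArg (coeffHom x) (hφ w)).trans (coeff_standardBracket_of_lt hw hlt)

end Triangular

end FreeLieAlgebra

/-- The underlying `K`-module of a free Lie algebra is a free `K`-module. -/
theorem freeLieAlgebra_module_free (K : Type*) [CommRing K] (Λ : Type*) :
    Module.Free K (FreeLieAlgebra K Λ) := by
  classical
  let _ : LinearOrder Λ := linearOrderOfSTO WellOrderingRel
  refine Module.Free.of_basis (Module.Basis.mk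
    (FreeLieAlgebra.linearIndependent_standardBracket (Λ := Λ)) ?_)
  rw [← FreeLieAlgebra.span_standardBracket_eq_top K, Set.image_eq_range]
  rfl
end

section
/- Let K be a commutative ring and Λ a type. The canonical K-linear map K ⊗_ℤ FreeLieAlgebra ℤ Λ → FreeLieAlgebra K Λ, obtained by K-linear extension from the ℤ-Lie-algebra morphism FreeLieAlgebra ℤ Λ → FreeLieAlgebra K Λ that sends each generator to the corresponding generator, is bijective. -/
open scoped TensorProduct

/-- The `ℤ`-Lie-algebra morphism `FreeLieAlgebra ℤ Λ → FreeLieAlgebra K Λ` sending each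
generator to the corresponding generator. -/
noncomputable def freeLieBaseChangeHom (K : Type*) [CommRing K] (Λ : Type*) :
    FreeLieAlgebra ℤ Λ →ₗ⁅ℤ⁆ FreeLieAlgebra K Λ :=
  FreeLieAlgebra.lift ℤ fun a => FreeLieAlgebra.of K a

/-- The `A`-linear extension of a morphism of `R`-Lie algebras `L → L'`, where `L'` is an `A`-Lie
algebra, is a morphism of `A`-Lie algebras. -/
noncomputable def LieHom.liftBaseChange {R A L L' : Type*} [CommRing R] [CommRing A] [Algebra R A]
    [LieRing L] [LieAlgebra R L] [LieRing L'] [LieAlgebra R L'] [LieAlgebra A L']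
    [IsScalarTower R A L'] (f : L →ₗ⁅R⁆ L') : A ⊗[R] L →ₗ⁅A⁆ L' :=
  { LinearMap.liftBaseChange A f.toLinearMap with
    map_lie' {x y} := by
      change LinearMap.liftBaseChange A f.toLinearMap ⁅x, y⁆ =
        ⁅LinearMap.liftBaseChange A f.toLinearMap x, LinearMap.liftBaseChange A f.toLinearMap y⁆
      induction x with
      | zero => simp
      | add x₁ x₂ h₁ h₂ => simp only [add_lie, map_add, h₁, h₂]
      | tmul a l =>
        induction y with
        | zero => simp
        | add y₁ y₂ h₁ h₂ => simp only [lie_add, map_add, h₁, h₂]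
        | tmul b m => simp [mul_smul, smul_comm a b] }

namespace LieHom

variable {R K Λ L M : Type*} [CommRing R] [CommRing K] [Algebra R K] [LieRing L] [LieAlgebra R L]
  [LieRing M] [LieAlgebra R M] [LieAlgebra K M] [IsScalarTower R K M]

theorem apply_eq_one_tmul {i : Λ → L}
    (hi : ∀ F G : L →ₗ⁅R⁆ K ⊗[R] L, (∀ a, F (i a) = G (i a)) → F = G)
    (f : L →ₗ⁅R⁆ M) (g : M →ₗ⁅K⁆ K ⊗[R] L) (hg : ∀ a, g (f (i a)) = 1 ⊗ₜ i a) (x : L) :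
    g (f x) = 1 ⊗ₜ x := by
  let F : L →ₗ⁅R⁆ K ⊗[R] L :=
    { g.toLinearMap.restrictScalars R ∘ₗ f.toLinearMap with
      map_lie' := by intro x y; simp }
  let G : L →ₗ⁅R⁆ K ⊗[R] L :=
    { TensorProduct.mk R K L 1 with
      map_lie' := by intro x y; simp }
  exact LieHom.congr_fun (hi F G hg) x

/-- A morphism `f : L → M` from an `R`-Lie algebra to a `K`-Lie algebra becomes bijective after
extending scalars to `K` as soon as morphisms out of `L` and `M` are determined by their values on
the families `i` and `f ∘ i`, and some morphism `g : M → K ⊗[R] L` sends `f (i a)` to `1 ⊗ i a`. -/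
theorem bijective_liftBaseChange {i : Λ → L}
    (hi : ∀ F G : L →ₗ⁅R⁆ K ⊗[R] L, (∀ a, F (i a) = G (i a)) → F = G)
    (f : L →ₗ⁅R⁆ M) (hf : ∀ F G : M →ₗ⁅K⁆ M, (∀ a, F (f (i a)) = G (f (i a))) → F = G)
    (g : M →ₗ⁅K⁆ K ⊗[R] L) (hg : ∀ a, g (f (i a)) = 1 ⊗ₜ i a) :
    Function.Bijective (LinearMap.liftBaseChange K f.toLinearMap) := by
  rw [Function.bijective_iff_has_inverse]
  refine ⟨g, fun x => ?_, fun y => ?_⟩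
  · induction x with
    | zero => simp
    | add x₁ x₂ h₁ h₂ => rw [map_add, map_add, h₁, h₂]
    | tmul k l =>
      rw [LinearMap.liftBaseChange_tmul, map_smul, LieHom.coe_toLinearMap,
        apply_eq_one_tmul hi f g hg, TensorProduct.smul_tmul', smul_eq_mul, mul_one]
  · refine LieHom.congr_fun (hf (f.liftBaseChange.comp g) LieHom.id fun a => ?_) y
    change LinearMap.liftBaseChange K f.toLinearMap (g (f (i a))) = f (i a)
    simp [hg]

end LieHom

/-- `FreeLieAlgebra.hom_ext` for the canonical `ℤ`-Lie algebra structure that every Lie ring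
carries. -/
theorem FreeLieAlgebra.int_hom_ext {Λ L : Type*} [LieRing L] [LieAlgebra ℤ L]
    {F G : FreeLieAlgebra ℤ Λ →ₗ⁅ℤ⁆ L}
    (h : ∀ a, F (FreeLieAlgebra.of ℤ a) = G (FreeLieAlgebra.of ℤ a)) : F = G :=
  FreeLieAlgebra.hom_ext h

theorem freeLieBaseChangeHom_of (K : Type*) [CommRing K] {Λ : Type*} (a : Λ) :
    freeLieBaseChangeHom K Λ (FreeLieAlgebra.of ℤ a) = FreeLieAlgebra.of K a :=
  FreeLieAlgebra.lift_of_apply (R := ℤ) (fun a => FreeLieAlgebra.of K a) a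

/-- The canonical `K`-linear map `K ⊗_ℤ FreeLieAlgebra ℤ Λ → FreeLieAlgebra K Λ`,
obtained by `K`-linear extension of `freeLieBaseChangeHom`, is bijective. -/
theorem freeLieAlgebra_baseChange_bijective (K : Type*) [CommRing K] (Λ : Type*) :
    Function.Bijective
      ⇑(LinearMap.liftBaseChange K (freeLieBaseChangeHom K Λ).toLinearMap :
        K ⊗[ℤ] FreeLieAlgebra ℤ Λ →ₗ[K] FreeLieAlgebra K Λ) := by
  have hi (F G : FreeLieAlgebra ℤ Λ →ₗ⁅ℤ⁆ K ⊗[ℤ] FreeLieAlgebra ℤ Λ)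
      (h : ∀ a, F (FreeLieAlgebra.of ℤ a) = G (FreeLieAlgebra.of ℤ a)) : F = G :=
    FreeLieAlgebra.int_hom_ext h
  refine LieHom.bijective_liftBaseChange hi (freeLieBaseChangeHom K Λ)
    (fun F G h => FreeLieAlgebra.hom_ext fun a => ?_)
    (FreeLieAlgebra.lift K fun a => 1 ⊗ₜ FreeLieAlgebra.of ℤ a) fun a => ?_
  · rw [← freeLieBaseChangeHom_of]
    exact h a
  · rw [freeLieBaseChangeHom_of]
    exact FreeLieAlgebra.lift_of_apply _ a
end
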